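/- arXiv:2604.01731 — 12 statements merged into one kernel-verified Lean document; each statement's English description precedes it below -/
import Mathlib

section
/- Poisson summation for the trace pairing on a matrix algebra: Let K be a finite field, F ⊆ K a subfield, R a commutative ring, and ψ : (F,+) → R^× a nondegenerate additive character, i.e. Σ_{x∈F} ψ(tx) = 0 for every t ∈ F^×. Set Ψ(a) = ψ(Tr_{K/F}(trace(a))) for a ∈ M_n(K), fix r ∈ R^× with r² equal to the image of |M_n(K)| in R, and define the normalized Fourier transform of Φ : M_n(K) → R by F_ψΦ(a) = r^{-1}·Σ_{g∈M_n(K)} Φ(g)Ψ(ga). Let 𝓗 be an F-linear subspace of M_n(K) and 𝓗^⊥ = { b ∈ M_n(K) : Ψ(ab) = 1 for all a ∈ 𝓗 }. Then for every Φ : M_n(K) → R and every x ∈ GL_n(K): Σ_{a∈𝓗} Φ(ax) = |𝓗| · r^{-1} · Σ_{b∈𝓗^⊥} F_ψΦ(x^{-1}b), where |𝓗| denotes the image of the cardinality of 𝓗 in R. -/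
open Matrix
noncomputable section

theorem isUnit_card_of_isUnit_card_module {F V R : Type*} [Field F] [Fintype F] [AddCommGroup V]
    [Module F V] [Fintype V] [Nontrivial V] [CommRing R] (hV : IsUnit (Fintype.card V : R)) :
    IsUnit (Fintype.card F : R) := by
  rw [Module.card_eq_pow_finrank (K := F) (V := V), Nat.cast_pow] at hV
  exact (isUnit_pow_iff (Module.finrank_pos (R := F) (M := V)).ne').1 hV

theorem sum_addChar_comp_linear_eq_zero {F U R : Type*} [Field F] [Fintype F] [AddCommGroup U]
    [Module F U] [Fintype U] [CommRing R] {ψ : AddChar F R}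
    (hψ : ∀ t : F, t ≠ 0 → ∑ x : F, ψ (t * x) = 0) (hF : IsUnit (Fintype.card F : R))
    {l : U →ₗ[F] F} (hl : l ≠ 0) : ∑ u, ψ (l u) = 0 := by
  obtain ⟨v, hv⟩ : ∃ v, l v ≠ 0 := by
    by_contra! h
    exact hl (LinearMap.ext h)
  have key : ∑ c : F, ∑ u, ψ (l (u + c • v)) = 0 := by
    rw [Finset.sum_comm]
    refine Finset.sum_eq_zero fun u _ => ?_
    simp_rw [map_add, map_smul, smul_eq_mul, AddChar.map_add_eq_mul, ← Finset.mul_sum,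
      mul_comm _ (l v), hψ _ hv, mul_zero]
  have shift (c : F) : ∑ u, ψ (l (u + c • v)) = ∑ u, ψ (l u) :=
    Equiv.sum_comp (Equiv.addRight (c • v)) fun u => ψ (l u)
  simp_rw [shift, Finset.sum_const, Finset.card_univ, nsmul_eq_mul] at key
  exact hF.mul_right_eq_zero.1 key

theorem forall_addChar_eq_one_iff_mem_orthogonal {F V R : Type*} [Field F] [Fintype F]
    [AddCommGroup V] [Module F V] [Fintype V] [CommRing R] [Nontrivial R] {ψ : AddChar F R}
    (hψ : ∀ t : F, t ≠ 0 → ∑ x : F, ψ (t * x) = 0) (hV : IsUnit (Fintype.card V : R))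
    (B : LinearMap.BilinForm F V) (W : Submodule F V) (b : V) :
    (∀ a ∈ W, ψ (B a b) = 1) ↔ b ∈ B.orthogonal W := by
  rw [LinearMap.BilinForm.mem_orthogonal_iff]
  refine ⟨fun h a ha => ?_, fun h a ha => ?_⟩
  · by_contra hab
    change B a b ≠ 0 at hab
    have : Nontrivial V := nontrivial_of_ne a 0 fun h0 => hab (by simp [h0])
    have hF : IsUnit (Fintype.card F : R) := isUnit_card_of_isUnit_card_module (V := V) hV
    have h1 (x : F) : ψ (B a b * x) = 1 := by
      simpa [mul_comm] using h (x • a) (W.smul_mem x ha)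
    have h0 := hψ _ hab
    simp_rw [h1, Finset.sum_const, Finset.card_univ, nsmul_eq_mul, mul_one] at h0
    exact hF.ne_zero h0
  · rw [show B a b = 0 from h a ha, AddChar.map_zero_eq_one]

open Classical in
theorem sum_orthogonal_addChar {F V R : Type*} [Field F] [Fintype F]
    [AddCommGroup V] [Module F V] [Fintype V] [CommRing R] {ψ : AddChar F R}
    (hψ : ∀ t : F, t ≠ 0 → ∑ x : F, ψ (t * x) = 0) (hV : IsUnit (Fintype.card V : R))
    {B : LinearMap.BilinForm F V} (hB : B.Nondegenerate) (hB' : B.IsRefl) (W : Submodule F V)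
    (g : V) :
    ∑ b : B.orthogonal W, ψ (B g b) = if g ∈ W then (Nat.card (B.orthogonal W) : R) else 0 := by
  split_ifs with hg
  · have h1 (b : B.orthogonal W) : ψ (B g b) = 1 := by
      rw [show B g b = 0 from LinearMap.BilinForm.mem_orthogonal_iff.1 b.2 g hg,
        AddChar.map_zero_eq_one]
    simp [h1]
  · have hl : (B g).comp (B.orthogonal W).subtype ≠ 0 := fun h => hg <| by
      rw [← LinearMap.BilinForm.orthogonal_orthogonal hB hB' W,
        LinearMap.BilinForm.mem_orthogonal_iff]
      exact fun b hb => hB' _ _ (LinearMap.congr_fun h ⟨b, hb⟩)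
    have : Nontrivial V := nontrivial_of_ne g 0 fun h0 => hg (h0 ▸ W.zero_mem)
    exact sum_addChar_comp_linear_eq_zero hψ (isUnit_card_of_isUnit_card_module (V := V) hV) hl

theorem card_mul_card_orthogonal {F V : Type*} [Field F] [Finite F] [AddCommGroup V]
    [Module F V] [Finite V] {B : LinearMap.BilinForm F V} (hB : B.Nondegenerate)
    (W : Submodule F V) : Nat.card W * Nat.card (B.orthogonal W) = Nat.card V := by
  rw [Module.natCard_eq_pow_finrank (K := F) (V := W),
    Module.natCard_eq_pow_finrank (K := F) (V := B.orthogonal W),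
    Module.natCard_eq_pow_finrank (K := F) (V := V), ← pow_add,
    LinearMap.BilinForm.finrank_orthogonal hB, Nat.add_sub_cancel' W.finrank_le]

/-- Poisson summation for a nondegenerate reflexive bilinear form on a finite vector space. -/
theorem card_mul_sum_eq_card_mul_sum_orthogonal {F V R : Type*} [Field F] [Fintype F]
    [AddCommGroup V] [Module F V] [Fintype V] [CommRing R] [Nontrivial R] {ψ : AddChar F R}
    (hψ : ∀ t : F, t ≠ 0 → ∑ x : F, ψ (t * x) = 0) (hV : IsUnit (Fintype.card V : R))
    {B : LinearMap.BilinForm F V} (hB : B.Nondegenerate) (hB' : B.IsRefl) (W : Submodule F V)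
    (f : V → R) :
    (Fintype.card V : R) * ∑ᶠ a ∈ (W : Set V), f a =
      Nat.card W * ∑ᶠ b ∈ {b | ∀ a ∈ W, ψ (B a b) = 1}, ∑ g, f g * ψ (B g b) := by
  classical
  have hset : {b | ∀ a ∈ W, ψ (B a b) = 1} = (B.orthogonal W : Set V) :=
    Set.ext (forall_addChar_eq_one_iff_mem_orthogonal hψ hV B W)
  have hcard : (Fintype.card V : R) = Nat.card W * Nat.card (B.orthogonal W) := by
    rw [← Nat.cast_mul, card_mul_card_orthogonal hB, Nat.card_eq_fintype_card]
  have hsum : ∑ᶠ b ∈ (B.orthogonal W : Set V), ∑ g, f g * ψ (B g b) =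
      ∑ g, f g * ∑ b : B.orthogonal W, ψ (B g b) := by
    rw [← finsum_set_coe_eq_finsum_mem, finsum_eq_sum_of_fintype, Finset.sum_comm]
    simp_rw [Finset.mul_sum]
    rfl
  rw [hset, hsum, hcard, mul_assoc]
  simp_rw [sum_orthogonal_addChar hψ hV hB hB', finsum_mem_def, finsum_eq_sum_of_fintype,
    Finset.mul_sum, Set.indicator_apply, SetLike.mem_coe]
  refine Finset.sum_congr rfl fun g _ => ?_
  split_ifs <;> ring

/-- The bilinear form `(a, b) ↦ Tr_{K/F} (trace (a * b))` on square matrices. -/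
def matrixTraceForm (F K m : Type*) [Field F] [Field K] [Algebra F K] [Fintype m] :
    LinearMap.BilinForm F (Matrix m m K) :=
  LinearMap.mk₂ F (fun a b => Algebra.trace F K (trace (a * b)))
    (by simp [add_mul]) (by simp) (by simp [mul_add]) (by simp)

@[simp]
theorem matrixTraceForm_apply {F K m : Type*} [Field F] [Field K] [Algebra F K] [Fintype m]
    (a b : Matrix m m K) :
    matrixTraceForm F K m a b = Algebra.trace F K (trace (a * b)) :=
  rfl

theorem matrixTraceForm_isSymm (F K m : Type*) [Field F] [Field K] [Algebra F K] [Fintype m] :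
    (matrixTraceForm F K m).IsSymm :=
  ⟨fun a b => by simp [trace_mul_comm a b]⟩

theorem matrixTraceForm_nondegenerate (F K m : Type*) [Field F] [Field K] [Algebra F K]
    [FiniteDimensional F K] [Algebra.IsSeparable F K] [Fintype m] :
    (matrixTraceForm F K m).Nondegenerate := by
  classical
  refine (LinearMap.IsRefl.nondegenerate_iff_separatingRight
    (matrixTraceForm_isSymm F K m).isRefl).2 ?_
  intro b hb
  refine ext_iff_trace_mul_left.2 fun a => ?_
  rw [mul_zero, trace_zero]
  refine (traceForm_nondegenerate F K).2 _ fun c => ?_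
  simpa using hb (c • a)

/-- **Poisson summation for the trace pairing on a matrix algebra.**
`K` is a finite field, `F ⊆ K` a subfield (encoded as an `Algebra F K`), `R` a commutative
ring, `ψ` a nondegenerate additive character of `F` valued in `R`, and
`Ψ a = ψ (Tr_{K/F} (trace a))`.  For an `F`-subspace `𝓗` of `M_n(K)` with orthogonal
complement `𝓗^⊥ = {b | Ψ (a * b) = 1 ∀ a ∈ 𝓗}`, every `Φ : M_n(K) → R` and every
`x ∈ GL_n(K)` satisfy
`Σ_{a ∈ 𝓗} Φ (a x) = |𝓗| · r⁻¹ · Σ_{b ∈ 𝓗^⊥} F_ψΦ (x⁻¹ b)`,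
where `F_ψΦ (a) = r⁻¹ · Σ_g Φ g · Ψ (g a)` is the normalized Fourier transform. -/
theorem poisson_summation_trace_pairing
    {F K R : Type*} [Field F] [Field K] [Algebra F K] [Fintype F] [Fintype K]
    [DecidableEq K] [CommRing R] (n : ℕ)
    (ψ : AddChar F R)
    (hψ : ∀ t : F, t ≠ 0 → ∑ x : F, ψ (t * x) = 0)
    (r : Rˣ) (hr : (r : R) ^ 2 = (Fintype.card (Matrix (Fin n) (Fin n) K) : R))
    (𝓗 : Submodule F (Matrix (Fin n) (Fin n) K))
    (Φ : Matrix (Fin n) (Fin n) K → R) (x : GL (Fin n) K) :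
    ∑ᶠ a ∈ (𝓗 : Set (Matrix (Fin n) (Fin n) K)), Φ (a * (x : Matrix (Fin n) (Fin n) K))
      = (Nat.card 𝓗 : R) * ↑r⁻¹ *
        ∑ᶠ b ∈ {b : Matrix (Fin n) (Fin n) K |
            ∀ a ∈ 𝓗, ψ (Algebra.trace F K (Matrix.trace (a * b))) = 1},
          (↑r⁻¹ * ∑ g : Matrix (Fin n) (Fin n) K,
            Φ g * ψ (Algebra.trace F K (Matrix.trace (g * ((x⁻¹ : GL (Fin n) K) * b : Matrix (Fin n) (Fin n) K))))) := by
  cases subsingleton_or_nontrivial R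
  · exact Subsingleton.elim _ _
  have := Module.Finite.of_finite (R := F) (M := K)
  have hV : IsUnit (Fintype.card (Matrix (Fin n) (Fin n) K) : R) := hr ▸ r.isUnit.pow 2
  have poisson := card_mul_sum_eq_card_mul_sum_orthogonal hψ hV
    (matrixTraceForm_nondegenerate F K (Fin n)) (matrixTraceForm_isSymm F K (Fin n)).isRefl 𝓗
    fun a => Φ (a * (x : Matrix (Fin n) (Fin n) K))
  have reindex (b : Matrix (Fin n) (Fin n) K) :
      ∑ g, Φ (g * (x : Matrix (Fin n) (Fin n) K)) * ψ (Algebra.trace F K (trace (g * b))) =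
        ∑ g, Φ g * ψ (Algebra.trace F K
          (trace (g * ((x⁻¹ : GL (Fin n) K) * b : Matrix (Fin n) (Fin n) K)))) := by
    rw [← Equiv.sum_comp (Units.mulRight x) fun g => Φ g * _]
    simp only [Units.mulRight_apply, mul_assoc, Units.mul_inv_cancel_left]
  simp_rw [matrixTraceForm_apply, reindex] at poisson
  rw [← mul_finsum_mem' _ (↑r⁻¹ : R) (Set.toFinite _), ← hV.mul_right_inj, poisson, ← hr]
  have hrr : (r : R) * ↑r⁻¹ = 1 := r.mul_inv
  generalize (∑ᶠ b ∈ {b : Matrix (Fin n) (Fin n) K | _}, _ : R) = S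
  linear_combination (-(Nat.card 𝓗 : R) * S * (r * ↑r⁻¹ + 1)) * hrr
end
end

section
/- Weak Godement–Jacquet functional equation from the Kondo scalar: Let (π,V) be an R-representation of GL_n(𝒌) and suppose γ ∈ R satisfies the operator identity r^{-1}·Σ_{g∈GL_n(𝒌)} Ψ(g)·π^∨(g) = γ·Id on V^∨ (equality of R-linear endomorphisms of V^∨). Then for every Φ : M_n(𝒌) → R vanishing outside GL_n(𝒌) and every v ∈ V, v^∨ ∈ V^∨, one has Z(F_ψΦ, (f_{v,v^∨})^∨) = γ · Z(Φ, f_{v,v^∨}). -/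
open Matrix
noncomputable section

namespace Stmt1

variable {k R V : Type*} [Field k] [Fintype k] [DecidableEq k] [CommRing R]
  [AddCommGroup V] [Module R V] {n : ℕ}

/-- The Godement–Jacquet sum `Z(Φ, f) = Σ_{g ∈ GL_n(𝒌)} Φ(g) f(g)`. -/
def Z (Φ : Matrix (Fin n) (Fin n) k → R) (f : GL (Fin n) k → R) : R :=
  ∑ g : GL (Fin n) k, Φ (g : Matrix (Fin n) (Fin n) k) * f g

/-- The Fourier transform with normalization constant `c`:
`F Φ (a) = c · Σ_{g ∈ M_n(𝒌)} Φ(g) ψ(trace (g a))`. -/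
def fourier (c : R) (ψ : AddChar k R) (Φ : Matrix (Fin n) (Fin n) k → R) :
    Matrix (Fin n) (Fin n) k → R :=
  fun a => c * ∑ g : Matrix (Fin n) (Fin n) k, Φ g * ψ (Matrix.trace (g * a))

/-- The matrix coefficient `f_{v,v^∨}(g) = v^∨(π(g) v)`. -/
def mc (π : Representation R (GL (Fin n) k) V) (v : V) (v' : Module.Dual R V) :
    GL (Fin n) k → R := fun g => v' (π g v)

/-- `f^∨(g) = f(g⁻¹)`. -/
def inve (f : GL (Fin n) k → R) : GL (Fin n) k → R := fun g => f g⁻¹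

/-- A sum over all matrices of a function vanishing off the units is a sum over `GL`. -/
theorem sum_eq_sum_GL (F : Matrix (Fin n) (Fin n) k → R)
    (hF : ∀ a : Matrix (Fin n) (Fin n) k, ¬ IsUnit a → F a = 0) :
    ∑ a, F a = ∑ g : GL (Fin n) k, F (g : Matrix (Fin n) (Fin n) k) := by
  classical
  symm
  refine Finset.sum_of_injOn (fun g : GL (Fin n) k => (g : Matrix (Fin n) (Fin n) k))
    (fun _ _ _ _ h => Units.ext h) (fun _ _ => Finset.mem_coe.2 (Finset.mem_univ _)) ?_
    (fun _ _ => rfl)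
  intro a _ ha
  refine hF a fun ⟨u, hu⟩ => ha ⟨u, by simp, hu⟩

/-- **Weak Godement–Jacquet functional equation from the Kondo scalar.**  If
`r⁻¹ · Σ_g Ψ(g) π^∨(g) = γ · Id` on `V^∨`, then for every `Φ` vanishing outside
`GL_n(𝒌)` and all `v, v^∨`, `Z(F_ψΦ, (f_{v,v^∨})^∨) = γ · Z(Φ, f_{v,v^∨})`. -/
theorem weak_GJ_from_Kondo_scalar (ψ : AddChar k R) (hψ : ∃ x, ψ x ≠ 1)
    (r : Rˣ) (hr : (r : R) ^ 2 = (Fintype.card (Matrix (Fin n) (Fin n) k) : R))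
    (π : Representation R (GL (Fin n) k) V) (γ : R)
    (hK : ((r⁻¹ : Rˣ) : R) • (∑ g : GL (Fin n) k,
        ψ (Matrix.trace (g : Matrix (Fin n) (Fin n) k)) • π.dual g)
      = γ • (LinearMap.id : Module.Dual R V →ₗ[R] Module.Dual R V))
    (Φ : Matrix (Fin n) (Fin n) k → R)
    (hΦ : ∀ a : Matrix (Fin n) (Fin n) k, ¬ IsUnit a → Φ a = 0)
    (v : V) (v' : Module.Dual R V) :
    Z (fourier (↑r⁻¹) ψ Φ) (inve (mc π v v')) = γ * Z Φ (mc π v v') := by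
  have key (w : V) : ((r⁻¹ : Rˣ) : R) * ∑ x : GL (Fin n) k,
      ψ (Matrix.trace (x : Matrix (Fin n) (Fin n) k)) * v' (π x⁻¹ w) = γ * v' w := by
    have h := LinearMap.congr_fun (LinearMap.congr_fun hK v') w
    simpa [LinearMap.sum_apply, Representation.dual_apply, Module.Dual.transpose_apply] using h
  have shift (g : GL (Fin n) k) : ∑ h : GL (Fin n) k,
      ψ (Matrix.trace ((g : Matrix (Fin n) (Fin n) k) * h.val)) * v' (π h⁻¹ v)
      = ∑ x : GL (Fin n) k,
        ψ (Matrix.trace (x : Matrix (Fin n) (Fin n) k)) * v' (π x⁻¹ (π g v)) := by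
    refine Fintype.sum_equiv (Equiv.mulLeft g) _ _ fun h => ?_
    rw [Equiv.coe_mulLeft, Units.val_mul, ← Module.End.mul_apply, ← map_mul]
    simp
  unfold Z fourier inve mc
  calc
    _ = ∑ h : GL (Fin n) k, ∑ g : GL (Fin n) k, Φ g * (((r⁻¹ : Rˣ) : R) *
        (ψ (Matrix.trace ((g : Matrix (Fin n) (Fin n) k) * h.val)) * v' (π h⁻¹ v))) := by
      refine Finset.sum_congr rfl fun h _ => ?_
      rw [sum_eq_sum_GL _ fun a ha => by rw [hΦ a ha, zero_mul], Finset.mul_sum, Finset.sum_mul]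
      exact Finset.sum_congr rfl fun g _ => by ring
    _ = ∑ g : GL (Fin n) k, Φ g * (γ * v' (π g v)) := by
      rw [Finset.sum_comm]
      refine Finset.sum_congr rfl fun g _ => ?_
      rw [← Finset.mul_sum, ← Finset.mul_sum, shift, key]
    _ = _ := by
      rw [Finset.mul_sum]
      exact Finset.sum_congr rfl fun g _ => by ring

end Stmt1
end
end

section
/- Converse to the weak functional equation: Let (π,V) be an R-representation of GL_n(𝒌) and γ ∈ R such that Z(F_ψΦ, (f_{v,v^∨})^∨) = γ·Z(Φ, f_{v,v^∨}) for every Φ : M_n(𝒌) → R vanishing outside GL_n(𝒌) and every v ∈ V, v^∨ ∈ V^∨. Then the operator r^{-1}·Σ_{g∈GL_n(𝒌)} Ψ(g)·π^∨(g) on V^∨ equals γ·Id. -/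
open Matrix
noncomputable section

namespace Stmt2

variable {k R V : Type*} [Field k] [Fintype k] [DecidableEq k] [CommRing R]
  [AddCommGroup V] [Module R V] {n : ℕ}

/-- The Godement–Jacquet sum `Z(Φ, f) = Σ_{g ∈ GL_n(𝒌)} Φ(g) f(g)`. -/
def Z (Φ : Matrix (Fin n) (Fin n) k → R) (f : GL (Fin n) k → R) : R :=
  ∑ g : GL (Fin n) k, Φ (g : Matrix (Fin n) (Fin n) k) * f g

/-- The Fourier transform with normalization constant `c`:
`F Φ (a) = c · Σ_{g ∈ M_n(𝒌)} Φ(g) ψ(trace (g a))`. -/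
def fourier (c : R) (ψ : AddChar k R) (Φ : Matrix (Fin n) (Fin n) k → R) :
    Matrix (Fin n) (Fin n) k → R :=
  fun a => c * ∑ g : Matrix (Fin n) (Fin n) k, Φ g * ψ (Matrix.trace (g * a))

/-- The matrix coefficient `f_{v,v^∨}(g) = v^∨(π(g) v)`. -/
def mc (π : Representation R (GL (Fin n) k) V) (v : V) (v' : Module.Dual R V) :
    GL (Fin n) k → R := fun g => v' (π g v)

/-- `f^∨(g) = f(g⁻¹)`. -/
def inve (f : GL (Fin n) k → R) : GL (Fin n) k → R := fun g => f g⁻¹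


/-- **Converse to the weak functional equation.**  If
`Z(F_ψΦ, (f_{v,v^∨})^∨) = γ · Z(Φ, f_{v,v^∨})` for every `Φ` vanishing outside
`GL_n(𝒌)` and all `v ∈ V`, `v^∨ ∈ V^∨`, then
`r⁻¹ · Σ_{g ∈ GL_n(𝒌)} Ψ(g) π^∨(g) = γ · Id` as an endomorphism of `V^∨`. -/
theorem Kondo_scalar_from_weak_GJ (ψ : AddChar k R) (hψ : ∃ x, ψ x ≠ 1)
    (r : Rˣ) (hr : (r : R) ^ 2 = (Fintype.card (Matrix (Fin n) (Fin n) k) : R))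
    (π : Representation R (GL (Fin n) k) V) (γ : R)
    (hFE : ∀ Φ : Matrix (Fin n) (Fin n) k → R,
      (∀ a : Matrix (Fin n) (Fin n) k, ¬ IsUnit a → Φ a = 0) →
      ∀ (v : V) (v' : Module.Dual R V),
        Z (fourier (↑r⁻¹) ψ Φ) (inve (mc π v v')) = γ * Z Φ (mc π v v')) :
    ((r⁻¹ : Rˣ) : R) • (∑ g : GL (Fin n) k,
        ψ (Matrix.trace (g : Matrix (Fin n) (Fin n) k)) • π.dual g)
      = γ • (LinearMap.id : Module.Dual R V →ₗ[R] Module.Dual R V) := by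
  classical
  have dual_apply_eq (v' : Module.Dual R V) (v : V) :
      ((r⁻¹ : Rˣ) : R) * ∑ g : GL (Fin n) k,
        ψ (Matrix.trace (g : Matrix (Fin n) (Fin n) k)) * v' (π g⁻¹ v) = γ * v' v := by
    have h := hFE (Pi.single 1 1)
      (fun a ha => by
        have hne : a ≠ 1 := by
          rintro rfl
          exact ha isUnit_one
        simp [hne]) v v'
    simpa [Z, fourier, inve, mc, Pi.single_apply, Finset.mul_sum, mul_assoc] using h
  ext v' v
  simpa [LinearMap.sum_apply, Representation.dual_apply, Module.Dual.transpose_apply]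
    using dual_apply_eq v' v

end Stmt2
end
end

section
/- Product formula for gamma constants of a representation and its dual: Let ψ : (𝒌,+) → R^× be a nondegenerate additive character (Σ_{x∈𝒌}ψ(tx) = 0 for all t ∈ 𝒌^×). Let (π,V) be an R-representation of GL_n(𝒌); suppose π satisfies the strong Godement–Jacquet functional equation with respect to ψ with constant γ ∈ R, that π^∨ satisfies the strong functional equation with respect to ψ^{-1} with constant γ' ∈ R, and that there exist v ∈ V and v^∨ ∈ V^∨ with v^∨(v) = 1. Then γ·γ' = 1; in particular γ ∈ R^×. -/
open Matrix
noncomputable section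

namespace Stmt4

variable {k R V : Type*} [Field k] [Fintype k] [DecidableEq k] [CommRing R]
  [AddCommGroup V] [Module R V] {n : ℕ}

/-- The Godement–Jacquet sum `Z(Φ, f) = Σ_{g ∈ GL_n(𝒌)} Φ(g) f(g)`. -/
def Z (Φ : Matrix (Fin n) (Fin n) k → R) (f : GL (Fin n) k → R) : R :=
  ∑ g : GL (Fin n) k, Φ (g : Matrix (Fin n) (Fin n) k) * f g

/-- The Fourier transform with normalization constant `c`:
`F Φ (a) = c · Σ_{g ∈ M_n(𝒌)} Φ(g) ψ(trace (g a))`. -/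
def fourier (c : R) (ψ : AddChar k R) (Φ : Matrix (Fin n) (Fin n) k → R) :
    Matrix (Fin n) (Fin n) k → R :=
  fun a => c * ∑ g : Matrix (Fin n) (Fin n) k, Φ g * ψ (Matrix.trace (g * a))

/-- The matrix coefficient `f_{v,v^∨}(g) = v^∨(π(g) v)`. -/
def mc (π : Representation R (GL (Fin n) k) V) (v : V) (v' : Module.Dual R V) :
    GL (Fin n) k → R := fun g => v' (π g v)

/-- `f^∨(g) = f(g⁻¹)`. -/
def inve (f : GL (Fin n) k → R) : GL (Fin n) k → R := fun g => f g⁻¹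

/-- Orthogonality: a nondegenerate character sums to zero along every nonzero linear form
`g ↦ trace (g m)` as soon as the cardinality of `𝒌` is invertible in the coefficients. -/
theorem sum_char_trace_mul_eq_zero (ψ : AddChar k R)
    (hψ : ∀ t : k, t ≠ 0 → ∑ x : k, ψ (t * x) = 0)
    (hcard : IsUnit (Fintype.card (Matrix (Fin n) (Fin n) k) : R))
    {m : Matrix (Fin n) (Fin n) k} (hm : m ≠ 0) :
    ∑ g : Matrix (Fin n) (Fin n) k, ψ (trace (g * m)) = 0 := by
  obtain ⟨i, j, hij⟩ : ∃ i j, m i j ≠ 0 := by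
    by_contra! h
    exact hm (Matrix.ext h)
  have hn : n ≠ 0 := fun h => (h ▸ i).elim0
  have hq : IsUnit (Fintype.card k : R) := by
    have hpow : Fintype.card (Matrix (Fin n) (Fin n) k) = Fintype.card k ^ (n * n) := by
      rw [← Nat.card_eq_fintype_card, ← Nat.card_eq_fintype_card]
      simp [Matrix, pow_mul]
    rw [hpow, Nat.cast_pow] at hcard
    exact (isUnit_pow_iff (mul_ne_zero hn hn)).1 hcard
  have htrans (x : k) : ∑ g : Matrix (Fin n) (Fin n) k, ψ (trace (g * m)) =
      ψ (m i j * x) * ∑ g : Matrix (Fin n) (Fin n) k, ψ (trace (g * m)) := by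
    rw [Finset.mul_sum, ← Equiv.sum_comp (Equiv.addLeft (Matrix.single j i x))]
    refine Finset.sum_congr rfl fun g _ => ?_
    rw [Equiv.coe_addLeft, add_mul, trace_add, AddChar.map_add_eq_mul,
      Matrix.trace_single_mul, smul_eq_mul, mul_comm x]
  have hzero : (Fintype.card k : R) *
      ∑ g : Matrix (Fin n) (Fin n) k, ψ (trace (g * m)) = 0 := by
    calc
      _ = ∑ _x : k, ∑ g : Matrix (Fin n) (Fin n) k, ψ (trace (g * m)) := by simp
      _ = ∑ x : k, ψ (m i j * x) * ∑ g : Matrix (Fin n) (Fin n) k, ψ (trace (g * m)) :=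
        Finset.sum_congr rfl fun x _ => htrans x
      _ = 0 := by rw [← Finset.sum_mul, hψ _ hij, zero_mul]
  exact hq.mul_right_eq_zero.1 hzero

/-- Fourier inversion on `M_n(𝒌)`. -/
theorem fourier_inv_fourier (ψ : AddChar k R)
    (hψ : ∀ t : k, t ≠ 0 → ∑ x : k, ψ (t * x) = 0)
    (r : Rˣ) (hr : (r : R) ^ 2 = (Fintype.card (Matrix (Fin n) (Fin n) k) : R))
    (Φ : Matrix (Fin n) (Fin n) k → R) :
    fourier (↑r⁻¹) ψ⁻¹ (fourier (↑r⁻¹) ψ Φ) = Φ := by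
  have hcard : IsUnit (Fintype.card (Matrix (Fin n) (Fin n) k) : R) := hr ▸ r.isUnit.pow 2
  funext a
  have hkernel (h : Matrix (Fin n) (Fin n) k) :
      ∑ g : Matrix (Fin n) (Fin n) k, ψ (trace (h * g)) * ψ⁻¹ (trace (g * a)) =
        if h = a then (r : R) ^ 2 else 0 := by
    have hdiff (g : Matrix (Fin n) (Fin n) k) :
        ψ (trace (h * g)) * ψ⁻¹ (trace (g * a)) = ψ (trace (g * (h - a))) := by
      rw [AddChar.inv_apply, ← AddChar.map_add_eq_mul, trace_mul_comm h g, mul_sub, trace_sub,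
        sub_eq_add_neg]
    simp_rw [hdiff]
    split_ifs with hha
    · simp [hha, hr]
    · exact sum_char_trace_mul_eq_zero ψ hψ hcard (sub_ne_zero.2 hha)
  calc
    _ = ↑r⁻¹ * (↑r⁻¹ * ∑ h : Matrix (Fin n) (Fin n) k, Φ h *
          ∑ g : Matrix (Fin n) (Fin n) k, ψ (trace (h * g)) * ψ⁻¹ (trace (g * a))) := by
      simp only [fourier, Finset.mul_sum, Finset.sum_mul]
      rw [Finset.sum_comm]
      simp only [mul_assoc]
    _ = Φ a := by
      simp_rw [hkernel]
      simp only [mul_ite, mul_zero, Finset.sum_ite_eq', Finset.mem_univ, if_true]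
      rw [mul_comm (Φ a), pow_two, mul_assoc, Units.inv_mul_cancel_left,
        Units.inv_mul_cancel_left]

/-- Integrating the indicator function of the identity evaluates at the identity. -/
theorem Z_single_one (f : GL (Fin n) k → R) : Z (Pi.single 1 1) f = f 1 := by
  simp [Z, Pi.single_apply]

/-- **Product formula for the gamma constants of a representation and its dual.**
If `ψ` is nondegenerate, `π` satisfies the strong Godement–Jacquet functional equation
for `ψ` with constant `γ`, its dual `π^∨` satisfies the strong functional equation for
`ψ⁻¹` with constant `γ'`, and the pairing admits `v, v^∨` with `v^∨(v) = 1`, then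
`γ · γ' = 1`; in particular `γ` is a unit of `R`. -/
theorem gamma_mul_gamma_dual_eq_one (ψ : AddChar k R)
    (hψ : ∀ t : k, t ≠ 0 → ∑ x : k, ψ (t * x) = 0)
    (r : Rˣ) (hr : (r : R) ^ 2 = (Fintype.card (Matrix (Fin n) (Fin n) k) : R))
    (π : Representation R (GL (Fin n) k) V) (γ γ' : R)
    (hFE : ∀ (Φ : Matrix (Fin n) (Fin n) k → R) (v : V) (v' : Module.Dual R V),
        Z (fourier (↑r⁻¹) ψ Φ) (inve (mc π v v')) = γ * Z Φ (mc π v v'))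
    (hFEdual : ∀ (Φ : Matrix (Fin n) (Fin n) k → R) (w : Module.Dual R V)
        (w' : Module.Dual R (Module.Dual R V)),
        Z (fourier (↑r⁻¹) ψ⁻¹ Φ) (inve (mc π.dual w w'))
          = γ' * Z Φ (mc π.dual w w'))
    (hpair : ∃ (v : V) (v' : Module.Dual R V), v' v = 1) :
    γ * γ' = 1 ∧ IsUnit γ := by
  obtain ⟨v, v', hv⟩ := hpair
  have hdual : mc π.dual v' (Module.Dual.eval R V v) = inve (mc π v v') := by
    funext g
    simp [mc, inve, Representation.dual_apply, Module.Dual.transpose_apply]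
  have hinv : inve (inve (mc π v v')) = mc π v v' := by
    funext g
    simp [inve]
  have hΦ := hFEdual (fourier (↑r⁻¹) ψ (Pi.single 1 1)) v' (Module.Dual.eval R V v)
  rw [fourier_inv_fourier ψ hψ r hr, hdual, hinv, hFE, Z_single_one] at hΦ
  have hone : γ * γ' = 1 := by
    simpa [mc, hv, mul_comm, eq_comm] using hΦ
  exact ⟨hone, IsUnit.of_mul_eq_one _ hone⟩

end Stmt4
end
end

section
/- Cuspidal Godement–Jacquet functional equation: Let n ≥ 2, let ψ : (𝒌,+) → R^× be a nondegenerate additive character (Σ_{x∈𝒌}ψ(tx) = 0 for all t ∈ 𝒌^×), and let (π,V) be an R-representation of GL_n(𝒌) such that the dual π^∨ is cuspidal and satisfies Schur's lemma, i.e. every R-linear GL_n(𝒌)-equivariant endomorphism of V^∨ is multiplication by a scalar of R. Then there exists γ ∈ R such that Z(F_ψΦ, (f_{v,v^∨})^∨) = γ·Z(Φ, f_{v,v^∨}) for every Φ : M_n(𝒌) → R and every v ∈ V, v^∨ ∈ V^∨ (the strong Godement–Jacquet functional equation). -/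
open Matrix
noncomputable section

namespace Stmt6

variable {k R V : Type*} [Field k] [Fintype k] [DecidableEq k] [CommRing R]
  [AddCommGroup V] [Module R V] {n : ℕ}

/-- The Godement–Jacquet sum `Z(Φ, f) = Σ_{g ∈ GL_n(𝒌)} Φ(g) f(g)`. -/
def Z (Φ : Matrix (Fin n) (Fin n) k → R) (f : GL (Fin n) k → R) : R :=
  ∑ g : GL (Fin n) k, Φ (g : Matrix (Fin n) (Fin n) k) * f g

/-- The Fourier transform with normalization constant `c`. -/
def fourier (c : R) (ψ : AddChar k R) (Φ : Matrix (Fin n) (Fin n) k → R) :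
    Matrix (Fin n) (Fin n) k → R :=
  fun a => c * ∑ g : Matrix (Fin n) (Fin n) k, Φ g * ψ (Matrix.trace (g * a))

/-- The matrix coefficient `f_{v,v^∨}(g) = v^∨(π(g) v)`. -/
def mc (π : Representation R (GL (Fin n) k) V) (v : V) (v' : Module.Dual R V) :
    GL (Fin n) k → R := fun g => v' (π g v)

/-- `f^∨(g) = f(g⁻¹)`. -/
def inve (f : GL (Fin n) k → R) : GL (Fin n) k → R := fun g => f g⁻¹

/-- `u` lies in the unipotent radical of the standard parabolic subgroup determined by
the block function `b`. -/
def UnipCond {N : ℕ} (b : Fin n → Fin N) (u : GL (Fin n) k) : Prop :=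
  (∀ i j, b j < b i → (u : Matrix (Fin n) (Fin n) k) i j = 0) ∧
  (∀ i j, b i = b j → (u : Matrix (Fin n) (Fin n) k) i j = if i = j then 1 else 0)

/-- Cuspidality: the coinvariants vanish for the unipotent radical of every proper
parabolic subgroup (a conjugate of a standard block unipotent subgroup attached to a
non-constant block function). -/
def IsCuspidal (π : Representation R (GL (Fin n) k) V) : Prop :=
  ∀ (N : ℕ) (b : Fin n → Fin N), (∃ i j, b i ≠ b j) → ∀ h : GL (Fin n) k,
    Submodule.span R {x : V | ∃ u : GL (Fin n) k, UnipCond b u ∧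
      ∃ v : V, x = v - π (h * u * h⁻¹) v} = ⊤

/-- The determinant of the identity matrix with row `i` replaced by `w` is `w i`. -/
theorem det_updateRow_one {m A : Type*} [Fintype m] [DecidableEq m] [CommRing A]
    (i : m) (w : m → A) : ((1 : Matrix m m A).updateRow i w).det = w i := by
  have h := congrFun (congrArg DFunLike.coe (Matrix.cramer_one (n := m) (α := A))) w
  have h' := congrFun h i
  rw [Matrix.cramer_apply] at h'
  rw [← Matrix.det_transpose, ← Matrix.updateCol_transpose, Matrix.transpose_one, h']
  rfl

/-- A singular matrix acquires a zero row after left multiplication by an invertible one. -/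
theorem exists_GL_mul_row_eq_zero {F : Type*} [Field F] (a : Matrix (Fin n) (Fin n) F)
    (ha : a.det = 0) :
    ∃ (P : GL (Fin n) F) (i : Fin n),
      ∀ j, ((P : Matrix (Fin n) (Fin n) F) * a) i j = 0 := by
  obtain ⟨w, hw, hwa⟩ := Matrix.exists_vecMul_eq_zero_iff.mpr ha
  obtain ⟨i, hi⟩ := Function.ne_iff.mp hw
  refine ⟨Matrix.GeneralLinearGroup.mkOfDetNeZero ((1 : Matrix _ _ F).updateRow i w)
    (by rw [det_updateRow_one]; exact hi), i, fun j => ?_⟩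
  have := congrFun hwa j
  simpa [Matrix.GeneralLinearGroup.mkOfDetNeZero, Matrix.mul_apply, Matrix.vecMul,
    dotProduct] using this

/-- The block function singling out the index `i` as the last block. -/
def lastBlock (i : Fin n) : Fin n → Fin 2 := fun j => if j = i then 1 else 0

/-- The unipotent radical attached to `lastBlock i` fixes the matrices whose `i`-th row
vanishes. -/
theorem UnipCond.mul_eq_of_row_eq_zero {i : Fin n} {u : GL (Fin n) k}
    (hu : UnipCond (lastBlock i) u) {a : Matrix (Fin n) (Fin n) k} (ha : ∀ j, a i j = 0) :
    (u : Matrix (Fin n) (Fin n) k) * a = a := by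
  ext s j
  rw [Matrix.mul_apply, ← congrFun (congrFun (Matrix.one_mul a) s) j, Matrix.mul_apply]
  refine Finset.sum_congr rfl fun l _ => ?_
  by_cases hl : l = i
  · rw [hl]
    simp [ha]
  · congr 1
    by_cases hs : s = i
    · rw [hu.1 s l (by simp [lastBlock, hl, hs]), hs, Matrix.one_apply_ne (Ne.symm hl)]
    · rw [hu.2 s l (by simp [lastBlock, hl, hs]), Matrix.one_apply]

/-- The operator `Σ_{g ∈ GL_n(𝒌)} ψ(tr(a g)) ρ(g)`. -/
def gaussOp (ψ : AddChar k R) (ρ : Representation R (GL (Fin n) k) V)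
    (a : Matrix (Fin n) (Fin n) k) : V →ₗ[R] V :=
  ∑ g : GL (Fin n) k, ψ (Matrix.trace (a * (g : Matrix (Fin n) (Fin n) k))) • ρ g

theorem gaussOp_apply (ψ : AddChar k R) (ρ : Representation R (GL (Fin n) k) V)
    (a : Matrix (Fin n) (Fin n) k) (v : V) :
    gaussOp ψ ρ a v =
      ∑ g : GL (Fin n) k, ψ (Matrix.trace (a * (g : Matrix (Fin n) (Fin n) k))) • ρ g v := by
  simp [gaussOp, LinearMap.sum_apply]

theorem gaussOp_mul_apply (ψ : AddChar k R) (ρ : Representation R (GL (Fin n) k) V)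
    (x : GL (Fin n) k) (a : Matrix (Fin n) (Fin n) k) (v : V) :
    gaussOp ψ ρ ((x : Matrix (Fin n) (Fin n) k) * a) (ρ x v) = gaussOp ψ ρ a v := by
  rw [gaussOp_apply, gaussOp_apply]
  refine Fintype.sum_equiv (Equiv.mulRight x) _ _ fun g => ?_
  rw [Equiv.coe_mulRight, map_mul, Units.val_mul, ← Matrix.mul_assoc,
    Matrix.trace_mul_comm (a * (g : Matrix (Fin n) (Fin n) k)), Matrix.mul_assoc]
  rfl

theorem apply_gaussOp_mul (ψ : AddChar k R) (ρ : Representation R (GL (Fin n) k) V)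
    (x : GL (Fin n) k) (a : Matrix (Fin n) (Fin n) k) (v : V) :
    ρ x (gaussOp ψ ρ (a * (x : Matrix (Fin n) (Fin n) k)) v) = gaussOp ψ ρ a v := by
  rw [gaussOp_apply, gaussOp_apply, map_sum]
  refine Fintype.sum_equiv (Equiv.mulLeft x) _ _ fun g => ?_
  rw [Equiv.coe_mulLeft, map_mul, Units.val_mul, Matrix.mul_assoc, map_smul]
  rfl

theorem gaussOp_one_comm (ψ : AddChar k R) (ρ : Representation R (GL (Fin n) k) V)
    (x : GL (Fin n) k) : gaussOp ψ ρ 1 ∘ₗ ρ x = ρ x ∘ₗ gaussOp ψ ρ 1 := by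
  ext v
  have h := gaussOp_mul_apply ψ ρ x ((x⁻¹ : GL (Fin n) k) : Matrix (Fin n) (Fin n) k) v
  rw [← Units.val_mul, mul_inv_cancel, Units.val_one] at h
  rw [LinearMap.comp_apply, LinearMap.comp_apply, h, ← apply_gaussOp_mul ψ ρ x,
    ← Units.val_mul, inv_mul_cancel, Units.val_one]

/-- For a cuspidal representation the operator attached to a singular matrix vanishes. -/
theorem IsCuspidal.gaussOp_eq_zero (hn : 2 ≤ n) (ψ : AddChar k R)
    {ρ : Representation R (GL (Fin n) k) V} (hρ : IsCuspidal ρ)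
    (a : Matrix (Fin n) (Fin n) k) (ha : a.det = 0) : gaussOp ψ ρ a = 0 := by
  obtain ⟨P, i, hP⟩ := exists_GL_mul_row_eq_zero a ha
  have : Nontrivial (Fin n) := Fin.nontrivial_iff_two_le.mpr hn
  obtain ⟨j, hj⟩ := exists_ne i
  have htop := hρ 2 (lastBlock i) ⟨i, j, by simp [lastBlock, hj]⟩ P⁻¹
  refine LinearMap.ext_on htop ?_
  rintro _ ⟨u, hu, v, rfl⟩
  have hfix : ((P⁻¹ * u * P⁻¹⁻¹ : GL (Fin n) k) : Matrix (Fin n) (Fin n) k) * a = a := by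
    rw [inv_inv, Units.val_mul, Units.val_mul, Matrix.mul_assoc, Matrix.mul_assoc,
      hu.mul_eq_of_row_eq_zero hP, ← Matrix.mul_assoc, ← Units.val_mul, inv_mul_cancel,
      Units.val_one, Matrix.one_mul]
  have h := gaussOp_mul_apply ψ ρ (P⁻¹ * u * P⁻¹⁻¹) a v
  rw [hfix] at h
  rw [map_sub, h, sub_self, LinearMap.zero_apply]

theorem Z_fourier_inve_mc (c : R) (ψ : AddChar k R)
    (π : Representation R (GL (Fin n) k) V) (Φ : Matrix (Fin n) (Fin n) k → R)
    (v : V) (v' : Module.Dual R V) :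
    Z (fourier c ψ Φ) (inve (mc π v v')) =
      c * ∑ a : Matrix (Fin n) (Fin n) k, Φ a * gaussOp ψ π.dual a v' v := by
  simp only [Z, fourier, inve, mc, gaussOp_apply, LinearMap.sum_apply, LinearMap.smul_apply,
    Representation.dual_apply, Module.Dual.transpose_apply, LinearMap.comp_apply, smul_eq_mul,
    Finset.mul_sum, Finset.sum_mul]
  rw [Finset.sum_comm]
  exact Finset.sum_congr rfl fun _ _ => Finset.sum_congr rfl fun _ _ => by ring

/-- **Cuspidal Godement–Jacquet functional equation.**  If `n ≥ 2`, `ψ` is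
nondegenerate and the dual `π^∨` is cuspidal and satisfies Schur's lemma, then `π`
satisfies the strong Godement–Jacquet functional equation:
`Z(F_ψΦ, (f_{v,v^∨})^∨) = γ · Z(Φ, f_{v,v^∨})` for all `Φ : M_n(𝒌) → R`, `v`, `v^∨`. -/
theorem cuspidal_strong_GJ (hn : 2 ≤ n)
    (ψ : AddChar k R) (hψ : ∀ t : k, t ≠ 0 → ∑ x : k, ψ (t * x) = 0)
    (r : Rˣ) (hr : (r : R) ^ 2 = (Fintype.card (Matrix (Fin n) (Fin n) k) : R))
    (π : Representation R (GL (Fin n) k) V)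
    (hcusp : IsCuspidal π.dual)
    (hschur : ∀ φ : Module.Dual R V →ₗ[R] Module.Dual R V,
      (∀ g : GL (Fin n) k, φ ∘ₗ π.dual g = π.dual g ∘ₗ φ) →
      ∃ c : R, φ = c • LinearMap.id) :
    ∃ γ : R, ∀ (Φ : Matrix (Fin n) (Fin n) k → R) (v : V) (v' : Module.Dual R V),
      Z (fourier (↑r⁻¹) ψ Φ) (inve (mc π v v')) = γ * Z Φ (mc π v v') := by
  obtain ⟨c, hc⟩ := hschur (gaussOp ψ π.dual 1) (gaussOp_one_comm ψ π.dual)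
  have hGL (g : GL (Fin n) k) (v : V) (v' : Module.Dual R V) :
      gaussOp ψ π.dual (g : Matrix (Fin n) (Fin n) k) v' v = c * v' (π g v) := by
    have h := apply_gaussOp_mul ψ π.dual g 1 v'
    rw [Matrix.one_mul, hc] at h
    have h' := LinearMap.congr_fun h (π g v)
    rw [Representation.dual_apply, Module.Dual.transpose_apply, LinearMap.comp_apply,
      Representation.inv_self_apply] at h'
    exact h'
  refine ⟨↑r⁻¹ * c, fun Φ v v' => ?_⟩
  rw [Z_fourier_inve_mc, mul_assoc, Z]
  congr 1
  rw [Finset.mul_sum]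
  symm
  refine Finset.sum_of_injOn (fun g : GL (Fin n) k => (g : Matrix (Fin n) (Fin n) k))
    Units.val_injective.injOn (fun _ _ => Finset.mem_coe.mpr (Finset.mem_univ _))
    (fun a _ ha => ?_) (fun g _ => ?_)
  · rw [hcusp.gaussOp_eq_zero hn ψ a, LinearMap.zero_apply, LinearMap.zero_apply, mul_zero]
    by_contra hdet
    exact ha ⟨Matrix.GeneralLinearGroup.mkOfDetNeZero a hdet, by simp, rfl⟩
  · rw [hGL, mc]
    ring

end Stmt6
end
end

section
/- Subquotients inherit the functional equation with the same constant: Let (π,V) be an R-representation of GL_n(𝒌) satisfying the strong (resp. weak) Godement–Jacquet functional equation with respect to ψ with constant γ ∈ R. Let V2 ⊆ V1 ⊆ V be subrepresentations with V1/V2 nonzero, and assume the restriction map Hom_R(V,R) → Hom_R(V1,R) is surjective. Then the subquotient representation π' on V1/V2 satisfies the strong (resp. weak) Godement–Jacquet functional equation with respect to ψ with the same constant γ. -/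
open Matrix
noncomputable section

namespace Stmt8

variable {k R V W : Type*} [Field k] [Fintype k] [DecidableEq k] [CommRing R]
  [AddCommGroup V] [Module R V] [AddCommGroup W] [Module R W] {n : ℕ}

/-- The Godement–Jacquet sum `Z(Φ, f) = Σ_{g ∈ GL_n(𝒌)} Φ(g) f(g)`. -/
def Z (Φ : Matrix (Fin n) (Fin n) k → R) (f : GL (Fin n) k → R) : R :=
  ∑ g : GL (Fin n) k, Φ (g : Matrix (Fin n) (Fin n) k) * f g

/-- The Fourier transform with normalization constant `c`. -/
def fourier (c : R) (ψ : AddChar k R) (Φ : Matrix (Fin n) (Fin n) k → R) :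
    Matrix (Fin n) (Fin n) k → R :=
  fun a => c * ∑ g : Matrix (Fin n) (Fin n) k, Φ g * ψ (Matrix.trace (g * a))

/-- The matrix coefficient `f_{v,v^∨}(g) = v^∨(σ(g) v)`. -/
def mc {M : Type*} [AddCommGroup M] [Module R M]
    (σ : Representation R (GL (Fin n) k) M) (v : M) (v' : Module.Dual R M) :
    GL (Fin n) k → R := fun g => v' (σ g v)

/-- `f^∨(g) = f(g⁻¹)`. -/
def inve (f : GL (Fin n) k → R) : GL (Fin n) k → R := fun g => f g⁻¹

/-- Every matrix coefficient of a subquotient, realized by an equivariant surjection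
`q : V₁ → W`, is a matrix coefficient of the ambient representation as soon as functionals
on `V₁` extend to `V`. -/
theorem exists_mc_eq_of_subquotient
    (π : Representation R (GL (Fin n) k) V) (V₁ : Submodule R V)
    (hV₁ : ∀ g : GL (Fin n) k, ∀ x ∈ V₁, π g x ∈ V₁)
    (π' : Representation R (GL (Fin n) k) W)
    (q : V₁ →ₗ[R] W) (hqsurj : Function.Surjective q)
    (hqequiv : ∀ (g : GL (Fin n) k) (x : V₁) (hx : π g (x : V) ∈ V₁),
      q ⟨π g (x : V), hx⟩ = π' g (q x))
    (hres : ∀ lam : V₁ →ₗ[R] R, ∃ Λ : Module.Dual R V, ∀ x : V₁, Λ (x : V) = lam x)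
    (w : W) (w' : Module.Dual R W) :
    ∃ (v : V) (v' : Module.Dual R V), mc π v v' = mc π' w w' := by
  obtain ⟨x, rfl⟩ := hqsurj w
  obtain ⟨Λ, hΛ⟩ := hres (w' ∘ₗ q)
  refine ⟨x, Λ, funext fun g => ?_⟩
  have hx := hV₁ g x x.2
  calc Λ (π g x) = w' (q ⟨π g x, hx⟩) := hΛ ⟨π g x, hx⟩
    _ = w' (π' g (q x)) := by rw [hqequiv]

/-- **Subquotients inherit the functional equation with the same constant.**
Let `π` be a representation of `GL_n(𝒌)` on `V`, `V₂ ⊆ V₁ ⊆ V` invariant submodules with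
`V₁/V₂` nonzero, realized by an equivariant surjection `q : V₁ → W` with kernel `V₂`,
and suppose the restriction map `Hom_R(V,R) → Hom_R(V₁,R)` is surjective.
If `π` satisfies the strong (resp. weak) Godement–Jacquet functional equation for `ψ`
with constant `γ`, then so does the subquotient representation `π'` on `W ≅ V₁/V₂`. -/
theorem subquotient_functional_equation
    (ψ : AddChar k R) (hψ : ∃ x, ψ x ≠ 1)
    (r : Rˣ) (hr : (r : R) ^ 2 = (Fintype.card (Matrix (Fin n) (Fin n) k) : R))
    (π : Representation R (GL (Fin n) k) V) (γ : R)
    (V₁ V₂ : Submodule R V) (hle : V₂ ≤ V₁)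
    (hV₁ : ∀ g : GL (Fin n) k, ∀ x ∈ V₁, π g x ∈ V₁)
    (hV₂ : ∀ g : GL (Fin n) k, ∀ x ∈ V₂, π g x ∈ V₂)
    (π' : Representation R (GL (Fin n) k) W)
    (q : V₁ →ₗ[R] W) (hqsurj : Function.Surjective q)
    (hqker : ∀ x : V₁, q x = 0 ↔ (x : V) ∈ V₂)
    (hqequiv : ∀ (g : GL (Fin n) k) (x : V₁) (hx : π g (x : V) ∈ V₁),
      q ⟨π g (x : V), hx⟩ = π' g (q x))
    (hnonzero : ∃ w : W, w ≠ 0)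
    (hres : ∀ lam : V₁ →ₗ[R] R, ∃ Λ : Module.Dual R V, ∀ x : V₁, Λ (x : V) = lam x) :
    ((∀ (Φ : Matrix (Fin n) (Fin n) k → R) (v : V) (v' : Module.Dual R V),
        Z (fourier (↑r⁻¹) ψ Φ) (inve (mc π v v')) = γ * Z Φ (mc π v v')) →
      ∀ (Φ : Matrix (Fin n) (Fin n) k → R) (w : W) (w' : Module.Dual R W),
        Z (fourier (↑r⁻¹) ψ Φ) (inve (mc π' w w')) = γ * Z Φ (mc π' w w')) ∧
    ((∀ (Φ : Matrix (Fin n) (Fin n) k → R),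
        (∀ a : Matrix (Fin n) (Fin n) k, ¬ IsUnit a → Φ a = 0) →
        ∀ (v : V) (v' : Module.Dual R V),
          Z (fourier (↑r⁻¹) ψ Φ) (inve (mc π v v')) = γ * Z Φ (mc π v v')) →
      ∀ (Φ : Matrix (Fin n) (Fin n) k → R),
        (∀ a : Matrix (Fin n) (Fin n) k, ¬ IsUnit a → Φ a = 0) →
        ∀ (w : W) (w' : Module.Dual R W),
          Z (fourier (↑r⁻¹) ψ Φ) (inve (mc π' w w')) = γ * Z Φ (mc π' w w')) := by
  have key := exists_mc_eq_of_subquotient π V₁ hV₁ π' q hqsurj hqequiv hres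
  constructor
  · intro h Φ w w'
    obtain ⟨v, v', hv⟩ := key w w'
    rw [← hv]
    exact h Φ v v'
  · intro h Φ hΦ w w'
    obtain ⟨v, v', hv⟩ := key w w'
    rw [← hv]
    exact h Φ hΦ v v'

end Stmt8
end
end

section
/- The GL(1) functional equation with its degenerate term: Let ψ : (𝒌,+) → R^× be a nondegenerate additive character (Σ_{x∈𝒌}ψ(tx) = 0 for all t ∈ 𝒌^×), fix s ∈ R^× with s² equal to the image of q in R, and let χ : 𝒌^× → R^× be a group homomorphism. Define γ(χ,ψ) = s^{-1}·Σ_{x∈𝒌^×} ψ(x)χ(x)^{-1} and, for Φ : 𝒌 → R, F_ψΦ(a) = s^{-1}·Σ_{y∈𝒌} Φ(y)ψ(ya). Then for every Φ : 𝒌 → R: Σ_{x∈𝒌^×} F_ψΦ(x)·χ(x)^{-1} = γ(χ,ψ)·(Σ_{x∈𝒌^×} Φ(x)χ(x)) + s^{-1}·Φ(0)·(Σ_{x∈𝒌^×} χ(x)^{-1}). -/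
noncomputable section

/-- A sum over a field splits into the term at `0` and the sum over the units. -/
theorem sum_eq_zero_add_sum_units {k M : Type*} [Field k] [Fintype k] [Fintype kˣ]
    [AddCommMonoid M] (f : k → M) : ∑ y : k, f y = f 0 + ∑ y : kˣ, f y := by
  classical
  rw [Fintype.sum_eq_add_sum_subtype_ne f 0]
  congr 1
  exact (Fintype.sum_equiv unitsEquivNeZero _ _ fun _ => rfl).symm

/-- Dilating the argument by a unit `y` multiplies a twisted sum over units by `χ y`. -/
theorem sum_units_dilate_mul_inv {k R : Type*} [CommRing k] [Fintype kˣ] [CommRing R]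
    (f : k → R) (χ : kˣ →* Rˣ) (y : kˣ) :
    ∑ x : kˣ, f (y * x) * (((χ x)⁻¹ : Rˣ) : R)
      = χ y * ∑ x : kˣ, f x * (((χ x)⁻¹ : Rˣ) : R) := by
  rw [Finset.mul_sum]
  refine Fintype.sum_equiv (Equiv.mulLeft y) _ _ fun x => ?_
  simp only [Equiv.coe_mulLeft, map_mul, mul_inv, Units.val_mul]
  linear_combination -(f (y * x) * (((χ x)⁻¹ : Rˣ) : R)) * (χ y).mul_inv

/-- **The GL(1) functional equation with its degenerate term.**  For a nondegenerate
additive character `ψ` of a finite field `𝒌`, `s ∈ R^×` with `s² = q`, and a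
multiplicative character `χ : 𝒌^× → R^×`, setting
`γ(χ,ψ) = s⁻¹ Σ_{x∈𝒌^×} ψ(x) χ(x)⁻¹` and `F_ψΦ(a) = s⁻¹ Σ_y Φ(y) ψ(y a)`, one has
`Σ_{x∈𝒌^×} F_ψΦ(x) χ(x)⁻¹ = γ(χ,ψ) (Σ_{x∈𝒌^×} Φ(x) χ(x)) + s⁻¹ Φ(0) Σ_{x∈𝒌^×} χ(x)⁻¹`. -/
theorem GL1_functional_equation
    {k R : Type*} [Field k] [Fintype k] [DecidableEq k] [CommRing R]
    (ψ : AddChar k R) (hψ : ∀ t : k, t ≠ 0 → ∑ x : k, ψ (t * x) = 0)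
    (s : Rˣ) (hs : (s : R) ^ 2 = (Fintype.card k : R))
    (χ : kˣ →* Rˣ) (Φ : k → R) :
    ∑ x : kˣ, ((s⁻¹ : Rˣ) * ∑ y : k, Φ y * ψ (y * (x : k))) * (((χ x)⁻¹ : Rˣ) : R)
      = ((s⁻¹ : Rˣ) * ∑ x : kˣ, ψ (x : k) * (((χ x)⁻¹ : Rˣ) : R)) *
          (∑ x : kˣ, Φ (x : k) * ((χ x : Rˣ) : R))
        + ((s⁻¹ : Rˣ) : R) * Φ 0 * ∑ x : kˣ, (((χ x)⁻¹ : Rˣ) : R) := by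
  have split_inner (x : kˣ) : ∑ y : k, Φ y * ψ (y * (x : k))
      = Φ 0 + ∑ y : kˣ, Φ y * ψ (y * x) := by
    rw [sum_eq_zero_add_sum_units]
    simp
  have units_part : ∑ x : kˣ, (∑ y : kˣ, Φ y * ψ (y * x)) * (((χ x)⁻¹ : Rˣ) : R)
      = (∑ x : kˣ, ψ (x : k) * (((χ x)⁻¹ : Rˣ) : R)) *
          ∑ y : kˣ, Φ y * ((χ y : Rˣ) : R) := by
    simp only [Finset.sum_mul]
    rw [Finset.sum_comm, ← Finset.sum_mul, Finset.mul_sum]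
    refine Finset.sum_congr rfl fun y _ => ?_
    simp only [mul_assoc (Φ y)]
    rw [← Finset.mul_sum, sum_units_dilate_mul_inv]
    ring
  simp only [split_inner, mul_assoc, add_mul, Finset.sum_add_distrib, ← Finset.mul_sum]
  rw [units_part]
  ring
end
end

section
/- Every irreducible representation over an algebraically closed field satisfies the weak Godement–Jacquet functional equation: Let R be an algebraically closed field of characteristic different from p, ψ : (𝒌,+) → R^× a nontrivial additive character, and (π,V) an irreducible R-representation of GL_n(𝒌). Then there exists γ ∈ R such that Z(F_ψΦ, (f_{v,v^∨})^∨) = γ·Z(Φ, f_{v,v^∨}) for every Φ : M_n(𝒌) → R vanishing outside GL_n(𝒌) and every v ∈ V, v^∨ ∈ V^∨. -/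
open Matrix
noncomputable section

namespace Stmt10

variable {k R V : Type*} [Field k] [Fintype k] [DecidableEq k] [Field R]
  [AddCommGroup V] [Module R V] {n : ℕ}

/-- The Godement–Jacquet sum `Z(Φ, f) = Σ_{g ∈ GL_n(𝒌)} Φ(g) f(g)`. -/
def Z (Φ : Matrix (Fin n) (Fin n) k → R) (f : GL (Fin n) k → R) : R :=
  ∑ g : GL (Fin n) k, Φ (g : Matrix (Fin n) (Fin n) k) * f g

/-- The Fourier transform with normalization constant `c`. -/
def fourier (c : R) (ψ : AddChar k R) (Φ : Matrix (Fin n) (Fin n) k → R) :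
    Matrix (Fin n) (Fin n) k → R :=
  fun a => c * ∑ g : Matrix (Fin n) (Fin n) k, Φ g * ψ (Matrix.trace (g * a))

/-- The matrix coefficient `f_{v,v^∨}(g) = v^∨(π(g) v)`. -/
def mc (π : Representation R (GL (Fin n) k) V) (v : V) (v' : Module.Dual R V) :
    GL (Fin n) k → R := fun g => v' (π g v)

/-- `f^∨(g) = f(g⁻¹)`. -/
def inve (f : GL (Fin n) k → R) : GL (Fin n) k → R := fun g => f g⁻¹

/-- The operator `Σ_x ψ(tr x) π(x⁻¹)`, through which the Gauss sum of `π` is defined. -/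
def gaussOperator (ψ : AddChar k R) (π : Representation R (GL (Fin n) k) V) : Module.End R V :=
  ∑ x : GL (Fin n) k, ψ (Matrix.trace (x : Matrix (Fin n) (Fin n) k)) • π x⁻¹

theorem gaussOperator_comm (ψ : AddChar k R) (π : Representation R (GL (Fin n) k) V)
    (g : GL (Fin n) k) : gaussOperator ψ π * π g = π g * gaussOperator ψ π := by
  rw [gaussOperator, Finset.sum_mul, Finset.mul_sum]
  refine Fintype.sum_equiv (MulAut.conj g⁻¹).toEquiv _ _ fun x => ?_
  have hx : (MulAut.conj g⁻¹).toEquiv x = g⁻¹ * x * g := by simp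
  have ht : Matrix.trace ((g⁻¹ * x * g : GL (Fin n) k) : Matrix (Fin n) (Fin n) k) =
      Matrix.trace (x : Matrix (Fin n) (Fin n) k) := by
    rw [Units.val_mul, Units.val_mul, Matrix.trace_mul_comm, ← mul_assoc, Units.mul_inv, one_mul]
  rw [hx, ht, smul_mul_assoc, mul_smul_comm, ← map_mul, ← map_mul]
  congr 2
  group

/-- A space irreducible under a finite group is finite-dimensional. -/
theorem finite_of_irreducible {G : Type*} [Group G] [Finite G] (π : Representation R G V)
    (hV : ∃ v : V, v ≠ 0)
    (hirr : ∀ W : Submodule R V, (∀ (g : G), ∀ v ∈ W, π g v ∈ W) → W = ⊥ ∨ W = ⊤) :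
    Module.Finite R V := by
  obtain ⟨v, hv⟩ := hV
  have hmem (g : G) : π g v ∈ Submodule.span R (Set.range fun g => π g v) :=
    Submodule.subset_span ⟨g, rfl⟩
  rcases hirr (Submodule.span R (Set.range fun g => π g v)) (fun g w hw => by
    induction hw using Submodule.span_induction with
    | mem x hx =>
      obtain ⟨h, rfl⟩ := hx
      simpa using hmem (g * h)
    | zero => simp
    | add x y _ _ hx hy => simpa using add_mem hx hy
    | smul a x _ hx => simpa using Submodule.smul_mem _ a hx) with h | h
  · have h1 := hmem 1
    rw [h] at h1
    exact absurd (by simpa using h1) hv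
  · exact ⟨Submodule.fg_def.2 ⟨_, Set.finite_range _, h⟩⟩

/-- Schur's lemma: an operator commuting with an irreducible representation of a finite group
over an algebraically closed field is a scalar. -/
theorem exists_eq_smul_of_irreducible [IsAlgClosed R] {G : Type*} [Group G] [Finite G]
    (π : Representation R G V) (hV : ∃ v : V, v ≠ 0)
    (hirr : ∀ W : Submodule R V, (∀ (g : G), ∀ v ∈ W, π g v ∈ W) → W = ⊥ ∨ W = ⊤)
    (T : Module.End R V) (hT : ∀ g, T * π g = π g * T) :
    ∃ c : R, ∀ v, T v = c • v := by
  have := finite_of_irreducible π hV hirr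
  have : Nontrivial V := by
    obtain ⟨v, hv⟩ := hV
    exact ⟨v, 0, hv⟩
  obtain ⟨c, hc⟩ := Module.End.exists_eigenvalue T
  refine ⟨c, fun v => ?_⟩
  rcases hirr (T.eigenspace c) (fun g v hv => by
    rw [Module.End.mem_eigenspace_iff] at hv ⊢
    rw [← Module.End.mul_apply, hT, Module.End.mul_apply, hv, map_smul]) with h | h
  · exact absurd h hc
  · exact Module.End.mem_eigenspace_iff.1 (h ▸ Submodule.mem_top)

theorem sum_matrix_eq_sum_GL (F : Matrix (Fin n) (Fin n) k → R)
    (hF : ∀ a, ¬ IsUnit a → F a = 0) :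
    ∑ a, F a = ∑ g : GL (Fin n) k, F g := by
  symm
  refine Finset.sum_of_injOn (fun g : GL (Fin n) k => (g : Matrix (Fin n) (Fin n) k))
    (Units.val_injective.injOn) (by simp [Set.MapsTo]) (fun a _ ha => hF a ?_) (fun _ _ => rfl)
  rintro ⟨u, rfl⟩
  exact ha ⟨u, by simp, rfl⟩

theorem Z_fourier_eq (c : R) (ψ : AddChar k R) (π : Representation R (GL (Fin n) k) V)
    (Φ : Matrix (Fin n) (Fin n) k → R) (hΦ : ∀ a, ¬ IsUnit a → Φ a = 0)
    (v : V) (v' : Module.Dual R V) :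
    Z (fourier c ψ Φ) (inve (mc π v v')) = c * Z Φ (mc π (gaussOperator ψ π v) v') := by
  have hsum (h : GL (Fin n) k) : fourier c ψ Φ h =
      c * ∑ g : GL (Fin n) k, Φ g * ψ (Matrix.trace (g * h : Matrix (Fin n) (Fin n) k)) := by
    rw [fourier, sum_matrix_eq_sum_GL]
    intro a ha
    rw [hΦ a ha, zero_mul]
  simp only [Z, hsum, inve, mc, mul_assoc, Finset.sum_mul]
  rw [← Finset.mul_sum, Finset.sum_comm]
  congr 1
  refine Finset.sum_congr rfl fun g _ => ?_
  rw [← Finset.mul_sum, gaussOperator]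
  congr 1
  simp only [LinearMap.sum_apply, map_sum, LinearMap.smul_apply, map_smul, smul_eq_mul]
  refine Fintype.sum_equiv (Equiv.mulRight g) _ _ fun h => ?_
  rw [Equiv.coe_mulRight, Matrix.trace_mul_comm, Units.val_mul, _root_.mul_inv_rev,
    ← Module.End.mul_apply, ← map_mul, mul_inv_cancel_left]

/-- **Every irreducible representation over an algebraically closed field of
characteristic different from `p` satisfies the weak Godement–Jacquet functional
equation.** -/
theorem irreducible_weak_GJ [IsAlgClosed R] (hchar : ringChar R ≠ ringChar k)
    (ψ : AddChar k R) (hψ : ∃ x, ψ x ≠ 1)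
    (r : Rˣ) (hr : (r : R) ^ 2 = (Fintype.card (Matrix (Fin n) (Fin n) k) : R))
    (π : Representation R (GL (Fin n) k) V)
    (hV : ∃ v : V, v ≠ 0)
    (hirr : ∀ W : Submodule R V, (∀ (g : GL (Fin n) k), ∀ v ∈ W, π g v ∈ W) →
      W = ⊥ ∨ W = ⊤) :
    ∃ γ : R, ∀ (Φ : Matrix (Fin n) (Fin n) k → R),
      (∀ a : Matrix (Fin n) (Fin n) k, ¬ IsUnit a → Φ a = 0) →
      ∀ (v : V) (v' : Module.Dual R V),
        Z (fourier (↑r⁻¹) ψ Φ) (inve (mc π v v')) = γ * Z Φ (mc π v v') := by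
  obtain ⟨c, hc⟩ := exists_eq_smul_of_irreducible π hV hirr _ (gaussOperator_comm ψ π)
  refine ⟨↑r⁻¹ * c, fun Φ hΦ v v' => ?_⟩
  rw [Z_fourier_eq _ ψ π Φ hΦ, hc, mul_assoc]
  simp only [Z, mc, map_smul, smul_eq_mul, Finset.mul_sum, mul_left_comm]

end Stmt10
end
end

section
/- Strong functional equation for irreducible representations (generalized Macdonald): Let R be an algebraically closed field of characteristic ℓ different from p, ψ : (𝒌,+) → R^× a nontrivial additive character, and (π,V) an irreducible R-representation of GL_n(𝒌) which is an irreducible subquotient of a parabolically induced representation ρ1 × … × ρk where each ρ_i is an irreducible cuspidal R-representation of GL_{n_i}(𝒌) and n = n1+…+nk. If either (i) no ρ_i is the trivial one-dimensional representation of GL_1(𝒌), or (ii) ℓ > 0 and ℓ divides q − 1, then there exists γ ∈ R such that Z(F_ψΦ, (f_{v,v^∨})^∨) = γ·Z(Φ, f_{v,v^∨}) for every Φ : M_n(𝒌) → R and every v ∈ V, v^∨ ∈ V^∨. -/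
open Matrix
open scoped TensorProduct
noncomputable section

namespace Stmt11

variable {k R : Type*} [Field k] [Fintype k] [DecidableEq k] [Field R]

/-- The Godement–Jacquet sum `Z(Φ, f) = Σ_{g ∈ GL(𝒌)} Φ(g) f(g)`. -/
def Z {ι : Type*} [Fintype ι] [DecidableEq ι]
    (Φ : Matrix ι ι k → R) (f : GL ι k → R) : R :=
  ∑ g : GL ι k, Φ (g : Matrix ι ι k) * f g

/-- The Fourier transform with normalization constant `c`. -/
def fourier {ι : Type*} [Fintype ι] [DecidableEq ι]
    (c : R) (ψ : AddChar k R) (Φ : Matrix ι ι k → R) : Matrix ι ι k → R :=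
  fun a => c * ∑ g : Matrix ι ι k, Φ g * ψ (Matrix.trace (g * a))

/-- The matrix coefficient `f_{v,v^∨}(g) = v^∨(σ(g) v)`. -/
def mc {ι : Type*} [Fintype ι] [DecidableEq ι] {M : Type*} [AddCommGroup M] [Module R M]
    (σ : Representation R (GL ι k) M) (v : M) (v' : Module.Dual R M) :
    GL ι k → R := fun g => v' (σ g v)

/-- `f^∨(g) = f(g⁻¹)`. -/
def inve {ι : Type*} [Fintype ι] [DecidableEq ι] (f : GL ι k → R) : GL ι k → R :=
  fun g => f g⁻¹

/-- `u` lies in the unipotent radical of the parabolic subgroup determined by `b`. -/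
def UnipCond {ι : Type*} [Fintype ι] [DecidableEq ι] {N : ℕ} (b : ι → Fin N)
    (u : GL ι k) : Prop :=
  (∀ i j, b j < b i → (u : Matrix ι ι k) i j = 0) ∧
  (∀ i j, b i = b j → (u : Matrix ι ι k) i j = if i = j then 1 else 0)

/-- Cuspidality: coinvariants vanish for the unipotent radical of every proper parabolic
subgroup. -/
def IsCuspidal {ι : Type*} [Fintype ι] [DecidableEq ι] {M : Type*} [AddCommGroup M]
    [Module R M] (σ : Representation R (GL ι k) M) : Prop :=
  ∀ (N : ℕ) (b : ι → Fin N), (∃ i j, b i ≠ b j) → ∀ h : GL ι k,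
    Submodule.span R {x : M | ∃ u : GL ι k, UnipCond b u ∧
      ∃ v : M, x = v - σ (h * u * h⁻¹) v} = ⊤

/-- The right regular representation of `GL(𝒌)` on `M`-valued functions. -/
def rightReg {ι : Type*} [Fintype ι] [DecidableEq ι] (M : Type*) [AddCommGroup M]
    [Module R M] : Representation R (GL ι k) (GL ι k → M) where
  toFun g :=
    { toFun := fun φ x => φ (x * g)
      map_add' := fun φ φ' => rfl
      map_smul' := fun c φ => rfl }
  map_one' := LinearMap.ext fun φ => funext fun x => by simp
  map_mul' g h := LinearMap.ext fun φ => funext fun x => by simp [mul_assoc]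

variable {K : ℕ} {nn : Fin K → ℕ}

/-- `u` lies in the unipotent radical `U_{(n₁,…,n_K)}` of the standard parabolic
subgroup of `GL_n(𝒌)`, `n = n₁+…+n_K`, the rows and columns being indexed by the
blocks `(i : Fin K) × Fin (nn i)`. -/
def IsBlockUnip (u : GL ((i : Fin K) × Fin (nn i)) k) : Prop :=
  (∀ (i : Fin K) (a : Fin (nn i)) (j : Fin K) (b : Fin (nn j)), j < i →
    (u : Matrix ((i : Fin K) × Fin (nn i)) ((i : Fin K) × Fin (nn i)) k) ⟨i, a⟩ ⟨j, b⟩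
      = 0) ∧
  (∀ (i : Fin K) (a b : Fin (nn i)),
    (u : Matrix ((i : Fin K) × Fin (nn i)) ((i : Fin K) × Fin (nn i)) k) ⟨i, a⟩ ⟨i, b⟩
      = if a = b then 1 else 0)

/-- `m` is the block diagonal element `diag(mb 0, …, mb (K-1))` of `GL_n(𝒌)`. -/
def IsBlockDiag (m : GL ((i : Fin K) × Fin (nn i)) k)
    (mb : ∀ i, GL (Fin (nn i)) k) : Prop :=
  ∀ (i : Fin K) (a : Fin (nn i)) (j : Fin K) (b : Fin (nn j)),
    (m : Matrix ((i : Fin K) × Fin (nn i)) ((i : Fin K) × Fin (nn i)) k) ⟨i, a⟩ ⟨j, b⟩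
      = if h : i = j then
          ((mb i : Matrix (Fin (nn i)) (Fin (nn i)) k)) a (Fin.cast (by rw [h]) b)
        else 0

variable {V : ∀ i : Fin K, Type*} [∀ i, AddCommGroup (V i)] [∀ i, Module R (V i)]

/-- The parabolically induced representation `ρ₁ × … × ρ_K`: the submodule of
`(⨂ᵢ Vᵢ)`-valued functions `φ` on `GL_n(𝒌)` satisfying
`φ(u · diag(g₁,…,g_K) · g) = (ρ₁(g₁) ⊗ … ⊗ ρ_K(g_K))(φ(g))`, on which `GL_n(𝒌)` acts
by right translation. -/
def IndSub (ρ : ∀ i : Fin K, Representation R (GL (Fin (nn i)) k) (V i)) :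
    Submodule R (GL ((i : Fin K) × Fin (nn i)) k → ⨂[R] i, V i) where
  carrier := {φ | ∀ (u m : GL ((i : Fin K) × Fin (nn i)) k)
    (mb : ∀ i, GL (Fin (nn i)) k) (g : GL ((i : Fin K) × Fin (nn i)) k),
    IsBlockUnip u → IsBlockDiag m mb →
    φ (u * m * g) = PiTensorProduct.map (fun i => ρ i (mb i)) (φ g)}
  add_mem' := by
    intro φ φ' hφ hφ' u m mb g hu hm
    simp only [Pi.add_apply, hφ u m mb g hu hm, hφ' u m mb g hu hm, map_add]
  zero_mem' := by
    intro u m mb g hu hm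
    simp only [Pi.zero_apply, map_zero]
  smul_mem' := by
    intro c φ hφ u m mb g hu hm
    simp only [Pi.smul_apply, hφ u m mb g hu hm, LinearMap.map_smul]

set_option linter.unusedSectionVars false

/-- The operator `Σ_h ψ(tr(A h⁻¹)) σ(h)` attached to a matrix `A`. -/
def gjOp {ι : Type*} [Fintype ι] [DecidableEq ι] {M : Type*} [AddCommGroup M] [Module R M]
    (ψ : AddChar k R) (σ : Representation R (GL ι k) M) (A : Matrix ι ι k) : Module.End R M :=
  ∑ h : GL ι k, ψ (Matrix.trace (A * ((h⁻¹ : GL ι k) : Matrix ι ι k))) • σ h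

section Operator

variable {ι : Type*} [Fintype ι] [DecidableEq ι] {M : Type*} [AddCommGroup M] [Module R M]
  (ψ : AddChar k R) (σ : Representation R (GL ι k) M)

theorem gjOp_mul_right (A : Matrix ι ι k) (g : GL ι k) :
    gjOp ψ σ (A * g) = gjOp ψ σ A * σ g := by
  unfold gjOp
  rw [Finset.sum_mul]
  refine (Fintype.sum_equiv (Equiv.mulRight g) _ _ fun h => ?_).symm
  simp [Matrix.mul_assoc]

theorem gjOp_mul_left (A : Matrix ι ι k) (g : GL ι k) :
    gjOp ψ σ (g * A) = σ g * gjOp ψ σ A := by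
  unfold gjOp
  rw [Finset.mul_sum]
  refine (Fintype.sum_equiv (Equiv.mulLeft g) _ _ fun h => ?_).symm
  have : Matrix.trace ((g : Matrix ι ι k) * A * (((g * h)⁻¹ : GL ι k) : Matrix ι ι k))
      = Matrix.trace (A * ((h⁻¹ : GL ι k) : Matrix ι ι k)) := by
    rw [Matrix.mul_assoc, Matrix.trace_mul_comm, _root_.mul_inv_rev, Units.val_mul]
    simp [Matrix.mul_assoc]
  simp only [Equiv.coe_mulLeft, this, map_mul, mul_smul_comm]

/-- A matrix with vanishing determinant kills a nonzero vector, which is the `i`-th column of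
some invertible matrix. -/
theorem exists_GL_mulVec_single {A : Matrix ι ι k} (hA : A.det = 0) (i : ι) :
    ∃ h : GL ι k, A *ᵥ ((h : Matrix ι ι k) *ᵥ Pi.single i 1) = 0 := by
  obtain ⟨v, hv, hAv⟩ := Matrix.exists_mulVec_eq_zero_iff.mpr hA
  obtain ⟨j, hj⟩ := Function.ne_iff.mp hv
  refine ⟨Matrix.GeneralLinearGroup.mkOfDetNeZero
    (((1 : Matrix ι ι k).updateCol j v).submatrix id (Equiv.swap i j)) ?_, ?_⟩
  · rw [Matrix.det_permute', ← Matrix.cramer_apply, Matrix.cramer_one]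
    refine mul_ne_zero ?_ hj
    rcases Int.units_eq_one_or (Equiv.Perm.sign (Equiv.swap i j)) with h | h <;> simp [h]
  · rw [Matrix.mulVec_single_one]
    convert! hAv using 2
    ext a
    simp [Matrix.GeneralLinearGroup.mkOfDetNeZero]

/-- For a cuspidal representation of `GL_n`, `n ≥ 2`, the operators attached to singular
matrices vanish. -/
theorem IsCuspidal.gjOp_eq_zero (hσ : IsCuspidal σ) [Nontrivial ι] {A : Matrix ι ι k}
    (hA : A.det = 0) : gjOp ψ σ A = 0 := by
  obtain ⟨i, j, hij⟩ := exists_pair_ne ι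
  obtain ⟨h, hh⟩ := exists_GL_mulVec_single hA i
  have hspan := hσ 2 (fun a => if a = i then 0 else 1) ⟨i, j, by simp [hij.symm]⟩ h
  rw [← LinearMap.ker_eq_top, eq_top_iff, ← hspan, Submodule.span_le]
  rintro x ⟨u, ⟨hu₁, hu₂⟩, v, rfl⟩
  have key : A * ((h * u * h⁻¹ : GL ι k) : Matrix ι ι k) = A := by
    have hcol : ∀ a, (A * (h : Matrix ι ι k)) a i = 0 := by
      intro a
      have := congrFun hh a
      rwa [Matrix.mulVec_mulVec, Matrix.mulVec_single_one] at this
    have hAu : A * (h : Matrix ι ι k) * (u : Matrix ι ι k) = A * (h : Matrix ι ι k) := by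
      ext a b
      rw [Matrix.mul_apply]
      rw [Finset.sum_eq_single b]
      · rw [hu₂ b b rfl, if_pos rfl, mul_one]
      · intro c _ hcb
        by_cases hci : c = i
        · rw [hci, hcol, zero_mul]
        · by_cases hbi : b = i
          · rw [hu₁ c b (by simp [hci, hbi]), mul_zero]
          · rw [hu₂ c b (by simp [hci, hbi]), if_neg hcb, mul_zero]
      · simp
    calc A * ((h * u * h⁻¹ : GL ι k) : Matrix ι ι k)
        = A * (h : Matrix ι ι k) * (u : Matrix ι ι k) * ((h⁻¹ : GL ι k) : Matrix ι ι k) := by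
          simp only [Units.val_mul, Matrix.mul_assoc]
      _ = A * ((h * h⁻¹ : GL ι k) : Matrix ι ι k) := by
          rw [hAu, Units.val_mul, Matrix.mul_assoc]
      _ = A := by simp
  have := gjOp_mul_right ψ σ A (h * u * h⁻¹)
  rw [key] at this
  simp only [SetLike.mem_coe, LinearMap.mem_ker, map_sub]
  rw [sub_eq_zero]
  exact LinearMap.congr_fun this v

/-- For an irreducible representation, the sum of all group elements acts as zero unless the
representation is trivial. -/
theorem gjOp_zero_eq_zero
    (hirr : ∀ W : Submodule R M, (∀ (g : GL ι k), ∀ v ∈ W, σ g v ∈ W) → W = ⊥ ∨ W = ⊤)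
    (h : (∀ g, σ g = LinearMap.id) → Module.finrank R M = 1 → (Fintype.card (GL ι k) : R) = 0) :
    gjOp ψ σ 0 = 0 := by
  by_contra hne
  obtain ⟨v, hv⟩ : ∃ v, gjOp ψ σ 0 v ≠ 0 := by
    by_contra! hcon
    exact hne (LinearMap.ext hcon)
  have hfix : ∀ g, σ g (gjOp ψ σ 0 v) = gjOp ψ σ 0 v := fun g => by
    have := gjOp_mul_left ψ σ 0 g
    rw [Matrix.mul_zero] at this
    exact (LinearMap.congr_fun this v).symm
  have htop : R ∙ (gjOp ψ σ 0 v) = ⊤ := by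
    refine (hirr (R ∙ gjOp ψ σ 0 v) fun g x hx => ?_).resolve_left ?_
    · obtain ⟨c, rfl⟩ := Submodule.mem_span_singleton.mp hx
      rw [map_smul, hfix]
      exact hx
    · rwa [Submodule.span_singleton_eq_bot]
  have htriv : ∀ g, σ g = LinearMap.id := fun g => LinearMap.ext fun x => by
    obtain ⟨c, rfl⟩ := Submodule.mem_span_singleton.mp (htop ▸ Submodule.mem_top (x := x))
    rw [map_smul, hfix, LinearMap.id_apply]
  have hcard := h htriv (by rw [← finrank_top, ← htop, finrank_span_singleton hv])
  apply hne
  simp only [gjOp, Matrix.zero_mul, Matrix.trace_zero, AddChar.map_zero_eq_one, one_smul, htriv,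
    Finset.sum_const, Finset.card_univ]
  rw [← Nat.cast_smul_eq_nsmul R, hcard, zero_smul]

/-- Schur's lemma: an operator commuting with an irreducible representation is a scalar. -/
theorem exists_eq_smul_of_commute [IsAlgClosed R] (hne : ∃ w : M, w ≠ 0)
    (hirr : ∀ W : Submodule R M, (∀ (g : GL ι k), ∀ v ∈ W, σ g v ∈ W) → W = ⊥ ∨ W = ⊤)
    (T : Module.End R M) (hT : ∀ g, T * σ g = σ g * T) :
    ∃ μ : R, ∀ v, T v = μ • v := by
  obtain ⟨w, hw⟩ := hne
  have hspan : Submodule.span R (Set.range fun g => σ g w) = ⊤ := by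
    refine (hirr _ fun g v hv => ?_).resolve_left fun hbot => hw ?_
    · have hle : Submodule.span R (Set.range fun g => σ g w) ≤
          (Submodule.span R (Set.range fun g => σ g w)).comap (σ g) := by
        rw [Submodule.span_le]
        rintro _ ⟨g', rfl⟩
        exact Submodule.subset_span ⟨g * g', by simp⟩
      exact hle hv
    · have : w ∈ Submodule.span R (Set.range fun g => σ g w) :=
        Submodule.subset_span ⟨1, by simp⟩
      rwa [hbot, Submodule.mem_bot] at this
  have : Module.Finite R M := ⟨by
    rw [← hspan]
    exact Submodule.fg_span (Set.finite_range _)⟩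
  have : Nontrivial M := ⟨w, 0, hw⟩
  obtain ⟨μ, hμ⟩ := Module.End.exists_eigenvalue T
  refine ⟨μ, fun v => ?_⟩
  have htop : Module.End.eigenspace T μ = ⊤ := by
    refine (hirr _ fun g x hx => ?_).resolve_left hμ
    rw [Module.End.mem_eigenspace_iff] at hx ⊢
    have := LinearMap.congr_fun (hT g) x
    simp only [Module.End.mul_apply] at this
    rw [this, hx, map_smul]
  exact Module.End.mem_eigenspace_iff.mp (htop ▸ Submodule.mem_top)

/-- If the operators attached to singular matrices vanish on an irreducible representation, then
the strong functional equation holds. -/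
theorem exists_gamma_of_gjOp_eq_zero [IsAlgClosed R] (c : R) (hne : ∃ w : M, w ≠ 0)
    (hirr : ∀ W : Submodule R M, (∀ (g : GL ι k), ∀ v ∈ W, σ g v ∈ W) → W = ⊥ ∨ W = ⊤)
    (hsing : ∀ A : Matrix ι ι k, A.det = 0 → gjOp ψ σ A = 0) :
    ∃ γ : R, ∀ (Φ : Matrix ι ι k → R) (w : M) (w' : Module.Dual R M),
      Z (fourier c ψ Φ) (inve (mc σ w w')) = γ * Z Φ (mc σ w w') := by
  obtain ⟨μ, hμ⟩ := exists_eq_smul_of_commute σ hne hirr (gjOp ψ σ 1) fun g => by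
    rw [← gjOp_mul_right, ← gjOp_mul_left, one_mul, mul_one]
  refine ⟨c * μ, fun Φ w w' => ?_⟩
  have hleft : Z (fourier c ψ Φ) (inve (mc σ w w')) =
      c * ∑ g : Matrix ι ι k, Φ g * w' (gjOp ψ σ g w) := by
    simp only [Z, fourier, inve, mc, gjOp, LinearMap.sum_apply, map_sum, LinearMap.smul_apply,
      map_smul, smul_eq_mul, Finset.mul_sum, Finset.sum_mul]
    rw [Finset.sum_comm]
    refine Finset.sum_congr rfl fun g _ => Fintype.sum_equiv (Equiv.inv _) _ _ fun h => ?_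
    simp only [Equiv.inv_apply, inv_inv]
    ring
  have hright : ∑ g : GL ι k, Φ g * (μ * w' (σ g w)) =
      ∑ g : Matrix ι ι k, Φ g * w' (gjOp ψ σ g w) := by
    refine Finset.sum_of_injOn (fun g : GL ι k => (g : Matrix ι ι k))
      (fun _ _ _ _ h => Units.ext h) (by simp [Set.MapsTo]) ?_ ?_
    · intro g _ hg
      rw [hsing g, LinearMap.zero_apply, map_zero, mul_zero]
      by_contra hdet
      exact hg ⟨Matrix.GeneralLinearGroup.mkOfDetNeZero g hdet, by simp, rfl⟩
    · intro g _
      have := gjOp_mul_right ψ σ 1 g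
      rw [one_mul] at this
      rw [this, Module.End.mul_apply, hμ, map_smul, smul_eq_mul]
  rw [hleft, ← hright, Z, mul_assoc, Finset.mul_sum (a := μ)]
  congr 1
  refine Finset.sum_congr rfl fun g _ => ?_
  simp only [mc]
  ring

end Operator

/-- A sum over a finite group vanishes if it vanishes on every coset of a subgroup. -/
theorem sum_eq_zero_of_sum_coset {G H M : Type*} [Group G] [Fintype G] [Group H] [Fintype H]
    [AddCommMonoid M] (d : H →* G) (hd : Function.Injective d) (F : G → M)
    (hF : ∀ y, ∑ m, F (d m * y) = 0) : ∑ y, F y = 0 := by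
  classical
  refine Finset.sum_cancels_of_partition_cancels (QuotientGroup.rightRel d.range) fun y _ => ?_
  rw [← hF y]
  refine (Finset.sum_bij (fun m _ => d m * y) ?_ ?_ ?_ fun _ _ => rfl).symm
  · intro m _
    simp only [Finset.mem_filter, Finset.mem_univ, true_and, QuotientGroup.rightRel_apply]
    exact ⟨m⁻¹, by simp⟩
  · intro m _ m' _ h
    exact hd (mul_right_cancel h)
  · intro z hz
    simp only [Finset.mem_filter, Finset.mem_univ, true_and, QuotientGroup.rightRel_apply] at hz
    obtain ⟨m, hm⟩ := hz
    exact ⟨m⁻¹, by simp, by simp [hm]⟩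

/-- Strictly block upper triangular matrices. -/
def strictUpper (nn : Fin K → ℕ) (k : Type*) [Field k] :
    AddSubgroup (Matrix ((i : Fin K) × Fin (nn i)) ((i : Fin K) × Fin (nn i)) k) where
  carrier := {ν | ∀ a b, b.1 ≤ a.1 → ν a b = 0}
  add_mem' h h' a b hab := by simp [h a b hab, h' a b hab]
  zero_mem' a b hab := rfl
  neg_mem' h a b hab := by simp [h a b hab]

/-- The block diagonal embedding `∏ GL_{n_i} → GL_n`. -/
def blockDiagHom (nn : Fin K → ℕ) (k : Type*) [Field k] :
    (∀ i, GL (Fin (nn i)) k) →* GL ((i : Fin K) × Fin (nn i)) k :=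
  (Units.map (Matrix.blockDiagonal'RingHom (fun i => Fin (nn i)) k).toMonoidHom).comp
    MulEquiv.piUnits.symm.toMonoidHom

theorem coe_blockDiagHom (mb : ∀ i, GL (Fin (nn i)) k) :
    (blockDiagHom nn k mb : Matrix _ _ k) =
      Matrix.blockDiagonal' fun i => (mb i : Matrix (Fin (nn i)) (Fin (nn i)) k) := rfl

theorem addChar_map_sum {A ι : Type*} [AddCommMonoid A] (ψ : AddChar A R) (s : Finset ι)
    (f : ι → A) : ψ (∑ i ∈ s, f i) = ∏ i ∈ s, ψ (f i) := by
  classical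
  induction s using Finset.induction_on with
  | empty => simp
  | insert i s hi ih =>
    rw [Finset.sum_insert hi, Finset.prod_insert hi, AddChar.map_add_eq_mul, ih]

theorem blockDiagHom_injective : Function.Injective (blockDiagHom nn k) := fun m m' h => by
  have := congrArg Units.val h
  rw [coe_blockDiagHom, coe_blockDiagHom, Matrix.blockDiagonal'_inj] at this
  exact funext fun i => Units.ext (congrFun this i)

theorem isBlockDiag_blockDiagHom (mb : ∀ i, GL (Fin (nn i)) k) :
    IsBlockDiag (blockDiagHom nn k mb) mb := by
  intro i a j b
  rw [coe_blockDiagHom]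
  by_cases h : i = j
  · subst h
    simp
  · rw [Matrix.blockDiagonal'_apply_ne _ _ _ h, dif_neg h]

theorem trace_mul_blockDiagonal'
    (A : Matrix ((i : Fin K) × Fin (nn i)) ((i : Fin K) × Fin (nn i)) k)
    (D : ∀ i, Matrix (Fin (nn i)) (Fin (nn i)) k) :
    Matrix.trace (A * Matrix.blockDiagonal' D) =
      ∑ i, Matrix.trace (Matrix.blockDiag' A i * D i) := by
  simp only [Matrix.trace, Matrix.diag_apply, Fintype.sum_sigma]
  refine Finset.sum_congr rfl fun i _ => Finset.sum_congr rfl fun a _ => ?_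
  rw [Matrix.mul_apply, Matrix.mul_apply, Fintype.sum_sigma, Finset.sum_eq_single i]
  · simp [Matrix.blockDiag'_apply]
  · intro j _ hj
    simp [Matrix.blockDiagonal'_apply_ne _ _ _ hj]
  · simp

/-- The determinant of a block upper triangular matrix is the product of the determinants of its
diagonal blocks. -/
theorem det_eq_prod_det_blockDiag'
    {A : Matrix ((i : Fin K) × Fin (nn i)) ((i : Fin K) × Fin (nn i)) k}
    (hA : A.BlockTriangular Sigma.fst) : A.det = ∏ i, (Matrix.blockDiag' A i).det := by
  rw [hA.det_fintype]
  refine Finset.prod_congr rfl fun i _ => ?_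
  rw [← Matrix.det_submatrix_equiv_self (Equiv.sigmaSubtype i).symm]
  rfl

theorem blockTriangular_mul_blockDiagHom_iff
    (A : Matrix ((i : Fin K) × Fin (nn i)) ((i : Fin K) × Fin (nn i)) k)
    (mb : ∀ i, GL (Fin (nn i)) k) :
    (A * (blockDiagHom nn k mb : Matrix _ _ k)).BlockTriangular Sigma.fst ↔
      A.BlockTriangular Sigma.fst := by
  have hd : ∀ mb : ∀ i, GL (Fin (nn i)) k, Matrix.BlockTriangular
      (blockDiagHom nn k mb : Matrix ((i : Fin K) × Fin (nn i)) ((i : Fin K) × Fin (nn i)) k)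
      Sigma.fst := fun mb => by
    rw [coe_blockDiagHom]
    exact Matrix.blockTriangular_blockDiagonal' _
  refine ⟨fun h => ?_, fun h => h.mul (hd mb)⟩
  have := h.mul (hd mb⁻¹)
  rwa [Matrix.mul_assoc, ← Units.val_mul, ← map_mul, mul_inv_cancel, map_one, Units.val_one,
    Matrix.mul_one] at this

open scoped Classical in
/-- Orthogonality of characters on the strictly block upper triangular matrices. -/
theorem sum_strictUpper (ψ : AddChar k R) (hψ : ∃ x, ψ x ≠ 1)
    (A : Matrix ((i : Fin K) × Fin (nn i)) ((i : Fin K) × Fin (nn i)) k) :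
    ∑ ν : strictUpper nn k, ψ (Matrix.trace (A * (ν : Matrix _ _ k))) =
      if A.BlockTriangular Sigma.fst then (Fintype.card (strictUpper nn k) : R) else 0 := by
  let χ : AddChar (strictUpper nn k) R := ψ.compAddMonoidHom
    ((Matrix.traceAddMonoidHom _ k).comp
      ((AddMonoidHom.mulLeft A).comp (strictUpper nn k).subtype))
  have hχ : ∀ ν, χ ν = ψ (Matrix.trace (A * (ν : Matrix _ _ k))) := fun _ => rfl
  have htriv : χ = 0 ↔ A.BlockTriangular Sigma.fst := by
    constructor
    · intro h a b hab
      by_contra hne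
      obtain ⟨x, hx⟩ := hψ
      apply hx
      have hmem : Matrix.single b a (x / A a b) ∈ strictUpper nn k := by
        intro c d hdc
        rw [Matrix.single_apply, if_neg]
        rintro ⟨rfl, rfl⟩
        exact absurd hab (not_lt.mpr hdc)
      have h1 : χ ⟨_, hmem⟩ = 1 := by rw [h]; rfl
      rw [hχ] at h1
      rw [← h1]
      congr 1
      rw [Matrix.trace_mul_single, MulOpposite.smul_eq_mul_unop, MulOpposite.unop_op,
        mul_div_cancel₀ _ hne]
    · intro h
      ext ν
      rw [hχ]
      have : Matrix.trace (A * (ν : Matrix _ _ k)) = 0 := by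
        refine Finset.sum_eq_zero fun a _ => Finset.sum_eq_zero fun b _ => ?_
        change A a b * (ν : Matrix _ _ k) b a = 0
        rcases lt_or_ge b.1 a.1 with hba | hab
        · rw [h hba, zero_mul]
        · rw [ν.2 b a hab, mul_zero]
      rw [this]
      simp
  simp only [← hχ, ← htriv]
  exact AddChar.sum_eq_ite χ

/-- If `ν` is strictly block upper triangular, then `1 + ν` is an element of the block unipotent
subgroup. -/
theorem exists_GL_eq_one_add {ν : Matrix ((i : Fin K) × Fin (nn i)) ((i : Fin K) × Fin (nn i)) k}
    (hν : ν ∈ strictUpper nn k) :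
    ∃ u : GL ((i : Fin K) × Fin (nn i)) k, (u : Matrix _ _ k) = 1 + ν ∧ IsBlockUnip u := by
  have hdiag : ∀ i a b, (1 + ν) ⟨i, a⟩ ⟨i, b⟩ = if a = b then 1 else 0 := fun i a b => by
    rw [Matrix.add_apply, hν ⟨i, a⟩ ⟨i, b⟩ le_rfl, add_zero, Matrix.one_apply]
    simp
  have hlow : (1 + ν).BlockTriangular Sigma.fst := fun a b hab => by
    rw [Matrix.add_apply, hν _ _ hab.le, add_zero, Matrix.one_apply_ne]
    rintro rfl
    exact lt_irrefl _ hab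
  have hdet : (1 + ν).det ≠ 0 := by
    rw [det_eq_prod_det_blockDiag' hlow, Finset.prod_eq_one fun i _ => ?_]
    · exact one_ne_zero
    · have : Matrix.blockDiag' (1 + ν) i = 1 := by
        ext a b
        rw [Matrix.blockDiag'_apply, hdiag, Matrix.one_apply]
      rw [this, Matrix.det_one]
  exact ⟨Matrix.GeneralLinearGroup.mkOfDetNeZero _ hdet, rfl,
    fun i a j b hij => hlow hij, hdiag⟩

section Induced

variable (ψ : AddChar k R) (ρ : ∀ i : Fin K, Representation R (GL (Fin (nn i)) k) (V i))

theorem IndSub.unip_mul {φ : GL ((i : Fin K) × Fin (nn i)) k → ⨂[R] i, V i}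
    (hφ : φ ∈ IndSub ρ) {u : GL ((i : Fin K) × Fin (nn i)) k} (hu : IsBlockUnip u) (y) :
    φ (u * y) = φ y := by
  have := hφ u 1 1 y hu (by simpa using isBlockDiag_blockDiagHom (nn := nn) (k := k) 1)
  rw [mul_one] at this
  rw [this]
  simp [Module.End.one_eq_id]

theorem IndSub.blockDiagHom_mul {φ : GL ((i : Fin K) × Fin (nn i)) k → ⨂[R] i, V i}
    (hφ : φ ∈ IndSub ρ) (mb : ∀ i, GL (Fin (nn i)) k) (y) :
    φ (blockDiagHom nn k mb * y) = PiTensorProduct.map (fun i => ρ i (mb i)) (φ y) := by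
  obtain ⟨u, hu, hu'⟩ := exists_GL_eq_one_add (nn := nn) (k := k) (zero_mem _)
  have := hφ u _ mb y hu' (isBlockDiag_blockDiagHom mb)
  rwa [mul_assoc, IndSub.unip_mul ρ hφ hu'] at this

/-- Summing over the Levi subgroup factors as a tensor product of operators on the blocks. -/
theorem sum_levi (A : Matrix ((i : Fin K) × Fin (nn i)) ((i : Fin K) × Fin (nn i)) k) :
    ∑ mb : ∀ i, GL (Fin (nn i)) k,
      ψ (Matrix.trace (A * (blockDiagHom nn k mb⁻¹ : Matrix _ _ k))) •
        PiTensorProduct.map (fun i => ρ i (mb i)) =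
      PiTensorProduct.map fun i => gjOp ψ (ρ i) (Matrix.blockDiag' A i) := by
  have := (PiTensorProduct.mapMultilinear R V V).map_sum
    (fun i (h : GL (Fin (nn i)) k) =>
      ψ (Matrix.trace (Matrix.blockDiag' A i * ((h⁻¹ : GL _ k) : Matrix _ _ k))) • ρ i h)
  refine Eq.trans (Finset.sum_congr rfl fun mb _ => ?_) this.symm
  rw [MultilinearMap.map_smul_univ, coe_blockDiagHom, trace_mul_blockDiagonal',
    addChar_map_sum]
  rfl

/-- If the operators attached to singular matrices vanish for every `ρ i`, they vanish on the
parabolically induced representation. -/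
theorem gjOp_rightReg_eq_zero (hψ : ∃ x, ψ x ≠ 1)
    (hcard : (Fintype.card
      (Matrix ((i : Fin K) × Fin (nn i)) ((i : Fin K) × Fin (nn i)) k) : R) ≠ 0)
    (hρ : ∀ i, ∀ A : Matrix (Fin (nn i)) (Fin (nn i)) k, A.det = 0 → gjOp ψ (ρ i) A = 0)
    {A : Matrix ((i : Fin K) × Fin (nn i)) ((i : Fin K) × Fin (nn i)) k} (hA : A.det = 0)
    {φ : GL ((i : Fin K) × Fin (nn i)) k → ⨂[R] i, V i} (hφ : φ ∈ IndSub ρ) :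
    gjOp ψ (rightReg (R := R) (⨂[R] i, V i)) A φ = 0 := by
  classical
  have hN : (Fintype.card (strictUpper nn k) : R) ≠ 0 := fun h0 => hcard <| by
    obtain ⟨c, hc⟩ := AddSubgroup.card_addSubgroup_dvd_card (strictUpper nn k)
    rw [Nat.card_eq_fintype_card, Nat.card_eq_fintype_card] at hc
    rw [hc, Nat.cast_mul, h0, zero_mul]
  ext x
  set B : Matrix ((i : Fin K) × Fin (nn i)) ((i : Fin K) × Fin (nn i)) k :=
    (x : Matrix _ _ k) * A with hB
  have hBdet : B.det = 0 := by rw [hB, Matrix.det_mul, hA, mul_zero]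
  let t : GL ((i : Fin K) × Fin (nn i)) k → Matrix _ _ k := fun y =>
    B * ((y⁻¹ : GL _ k) : Matrix _ _ k)
  have hS : gjOp ψ (rightReg (R := R) (⨂[R] i, V i)) A φ x =
      ∑ y, ψ (Matrix.trace (t y)) • φ y := by
    simp only [gjOp, LinearMap.sum_apply, Finset.sum_apply, LinearMap.smul_apply, Pi.smul_apply]
    refine Fintype.sum_equiv (Equiv.mulLeft x) _ _ fun h => ?_
    have : Matrix.trace (t (x * h)) = Matrix.trace (A * ((h⁻¹ : GL _ k) : Matrix _ _ k)) := by
      simp only [t, hB]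
      rw [Matrix.mul_assoc, Matrix.trace_mul_comm, _root_.mul_inv_rev, Units.val_mul]
      simp [Matrix.mul_assoc]
    simp only [Equiv.coe_mulLeft, this]
    rfl
  have hunip : ∀ ν : strictUpper nn k, ∑ y, ψ (Matrix.trace (t y)) • φ y =
      ∑ y, (ψ (Matrix.trace (t y)) * ψ (Matrix.trace (t y * (ν : Matrix _ _ k)))) • φ y := by
    intro ν
    obtain ⟨u, hu, hu'⟩ := exists_GL_eq_one_add ν.2
    refine Fintype.sum_equiv (Equiv.mulLeft u) _ _ fun y => ?_
    have ht : t (u * y) + t (u * y) * (ν : Matrix _ _ k) = t y := by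
      calc _ = t (u * y) * (u : Matrix _ _ k) := by rw [hu, Matrix.mul_add, Matrix.mul_one]
        _ = t y := by
          simp only [t]
          rw [Matrix.mul_assoc, ← Units.val_mul, _root_.mul_inv_rev, inv_mul_cancel_right]
    rw [Equiv.coe_mulLeft, IndSub.unip_mul ρ hφ hu', ← AddChar.map_add_eq_mul,
      ← Matrix.trace_add, ht]
  have hzero : ∑ y, (ψ (Matrix.trace (t y)) *
      ∑ ν : strictUpper nn k, ψ (Matrix.trace (t y * (ν : Matrix _ _ k)))) • φ y = 0 := by
    refine sum_eq_zero_of_sum_coset (blockDiagHom nn k) blockDiagHom_injective _ fun y => ?_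
    have htm : ∀ mb, t (blockDiagHom nn k mb * y) =
        t y * (blockDiagHom nn k mb⁻¹ : Matrix _ _ k) := fun mb => by
      simp only [t, _root_.mul_inv_rev, Units.val_mul, map_inv, Matrix.mul_assoc]
    simp only [sum_strictUpper ψ hψ, htm, blockTriangular_mul_blockDiagHom_iff,
      IndSub.blockDiagHom_mul ρ hφ]
    by_cases hT : (t y).BlockTriangular Sigma.fst
    · simp only [if_pos hT, mul_comm _ (Fintype.card (strictUpper nn k) : R), mul_smul]
      have hdet : (t y).det = 0 := by simp only [t]; rw [Matrix.det_mul, hBdet, zero_mul]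
      rw [det_eq_prod_det_blockDiag' hT, Finset.prod_eq_zero_iff] at hdet
      obtain ⟨i, -, hi⟩ := hdet
      have := LinearMap.congr_fun (sum_levi ψ ρ (t y)) (φ y)
      rw [show PiTensorProduct.map (fun i => gjOp ψ (ρ i) (Matrix.blockDiag' (t y) i)) = 0 from
        (PiTensorProduct.mapMultilinear R V V).map_coord_zero i (hρ i _ hi)] at this
      simp only [LinearMap.sum_apply, LinearMap.smul_apply, LinearMap.zero_apply] at this
      rw [← Finset.smul_sum, this, smul_zero]
    · simp [if_neg hT]
  rw [hS]
  refine (smul_eq_zero.mp ?_).resolve_left hN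
  rw [Nat.cast_smul_eq_nsmul, ← Finset.card_univ, ← Finset.sum_const,
    Finset.sum_congr rfl fun ν _ => hunip ν, Finset.sum_comm, ← hzero]
  simp only [Finset.mul_sum, Finset.sum_smul]

end Induced

/-- **Strong functional equation for irreducible representations (generalized
Macdonald).**  Let `R` be an algebraically closed field of characteristic `ℓ ≠ p` and
`π` an irreducible subquotient of `ρ₁ × … × ρ_K` with all `ρᵢ` irreducible cuspidal.
If no `ρᵢ` is the trivial one-dimensional representation of `GL₁(𝒌)`, or if `ℓ > 0`
divides `q − 1`, then `π` satisfies the strong Godement–Jacquet functional equation. -/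
theorem irreducible_strong_GJ [IsAlgClosed R] {Wq : Type*} [AddCommGroup Wq]
    [Module R Wq]
    (hchar : ringChar R ≠ ringChar k)
    (ψ : AddChar k R) (hψ : ∃ x, ψ x ≠ 1)
    (r : Rˣ)
    (hr : (r : R) ^ 2
      = (Fintype.card (Matrix ((i : Fin K) × Fin (nn i)) ((i : Fin K) × Fin (nn i)) k) : R))
    (ρ : ∀ i : Fin K, Representation R (GL (Fin (nn i)) k) (V i))
    (hnn : ∀ i, 1 ≤ nn i)
    (hirrρ : ∀ i, (∃ v : V i, v ≠ 0) ∧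
      ∀ W : Submodule R (V i), (∀ (g : GL (Fin (nn i)) k), ∀ v ∈ W, ρ i g v ∈ W) →
        W = ⊥ ∨ W = ⊤)
    (hcuspρ : ∀ i, IsCuspidal (ρ i))
    (W₁ W₂ : Submodule R (GL ((i : Fin K) × Fin (nn i)) k → ⨂[R] i, V i))
    (hle : W₂ ≤ W₁) (hW₁Ind : W₁ ≤ IndSub ρ)
    (hW₁stab : ∀ (g : GL ((i : Fin K) × Fin (nn i)) k), ∀ φ ∈ W₁,
      rightReg (R := R) (⨂[R] i, V i) g φ ∈ W₁)
    (hW₂stab : ∀ (g : GL ((i : Fin K) × Fin (nn i)) k), ∀ φ ∈ W₂,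
      rightReg (R := R) (⨂[R] i, V i) g φ ∈ W₂)
    (π : Representation R (GL ((i : Fin K) × Fin (nn i)) k) Wq)
    (pr : W₁ →ₗ[R] Wq) (hprsurj : Function.Surjective pr)
    (hprker : ∀ φ : W₁, pr φ = 0 ↔
      (φ : GL ((i : Fin K) × Fin (nn i)) k → ⨂[R] i, V i) ∈ W₂)
    (hprequiv : ∀ (g : GL ((i : Fin K) × Fin (nn i)) k) (φ : W₁)
      (h : rightReg (R := R) (⨂[R] i, V i) g
          (φ : GL ((i : Fin K) × Fin (nn i)) k → ⨂[R] i, V i) ∈ W₁),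
      pr ⟨rightReg (R := R) (⨂[R] i, V i) g
          (φ : GL ((i : Fin K) × Fin (nn i)) k → ⨂[R] i, V i), h⟩ = π g (pr φ))
    (hirrπ : (∃ w : Wq, w ≠ 0) ∧
      ∀ W : Submodule R Wq,
        (∀ (g : GL ((i : Fin K) × Fin (nn i)) k), ∀ w ∈ W, π g w ∈ W) →
        W = ⊥ ∨ W = ⊤)
    (hcond : (∀ i, ¬ (Module.finrank R (V i) = 1 ∧
        ∀ g : GL (Fin (nn i)) k, ρ i g = LinearMap.id)) ∨
      (ringChar R ≠ 0 ∧ ringChar R ∣ Fintype.card k - 1)) :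
    ∃ γ : R, ∀ (Φ : Matrix ((i : Fin K) × Fin (nn i)) ((i : Fin K) × Fin (nn i)) k → R)
      (w : Wq) (w' : Module.Dual R Wq),
      Z (fourier (↑r⁻¹) ψ Φ) (inve (mc π w w')) = γ * Z Φ (mc π w w') := by
  have hblock : ∀ i, ∀ A : Matrix (Fin (nn i)) (Fin (nn i)) k, A.det = 0 →
      gjOp ψ (ρ i) A = 0 := by
    intro i A hA
    rcases (hnn i).eq_or_lt with h1 | h2
    · have hA0 : A = 0 := by
        have : Subsingleton (Fin (nn i)) := by rw [← h1]; infer_instance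
        have : Nonempty (Fin (nn i)) := ⟨⟨0, hnn i⟩⟩
        rw [Matrix.det_eq_elem_of_subsingleton A ⟨0, hnn i⟩] at hA
        ext a b
        rwa [Subsingleton.elim a ⟨0, hnn i⟩, Subsingleton.elim b ⟨0, hnn i⟩]
      rw [hA0]
      refine gjOp_zero_eq_zero ψ (ρ i) (hirrρ i).2 fun htriv hfin => ?_
      rcases hcond with hc | ⟨-, hdvd⟩
      · exact absurd ⟨hfin, htriv⟩ (hc i)
      · rw [← h1, ← Nat.card_eq_fintype_card, Matrix.card_GL_field]
        simpa using (ringChar.spec R _).mpr hdvd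
    · have : Nontrivial (Fin (nn i)) := Fin.nontrivial_iff_two_le.mpr h2
      exact (hcuspρ i).gjOp_eq_zero ψ (ρ i) hA
  refine exists_gamma_of_gjOp_eq_zero ψ π _ hirrπ.1 hirrπ.2 fun A hA => ?_
  ext w
  obtain ⟨φ, rfl⟩ := hprsurj w
  have hzero := gjOp_rightReg_eq_zero ψ ρ hψ (hr ▸ pow_ne_zero 2 r.ne_zero) hblock hA
    (hW₁Ind φ.2)
  rw [LinearMap.zero_apply, ← map_zero pr]
  have hlift : (∑ h : GL ((i : Fin K) × Fin (nn i)) k,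
      ψ (Matrix.trace (A * ((h⁻¹ : GL _ k) : Matrix _ _ k))) •
        (⟨rightReg (R := R) (⨂[R] i, V i) h φ, hW₁stab h φ φ.2⟩ : W₁)) = 0 := by
    rw [← Submodule.coe_eq_zero, ← hzero]
    simp [gjOp]
  rw [← hlift, map_sum]
  simp only [gjOp, LinearMap.sum_apply, LinearMap.smul_apply, map_smul, hprequiv]

end Stmt11
end
end

section
/- Gamma factor of a Galois-distinguished cuspidal representation equals the central character at a trace-zero element: Let 𝒌/𝒌₀ be a quadratic extension of finite fields of odd characteristic p, with |𝒌₀| = q₀, let n ≥ 2, and let R be a field of characteristic different from p. Let (π,V) be an absolutely irreducible cuspidal R-representation of GL_n(𝒌) (irreducible with every GL_n(𝒌)-equivariant R-linear endomorphism of V scalar) which is distinguished by GL_n(𝒌₀), i.e. there exists a nonzero linear form Λ : V → R with Λ∘π(h) = Λ for all h ∈ GL_n(𝒌₀). Let ψ₀ : (𝒌₀,+) → R^× be a nontrivial additive character, set Ψ(a) = ψ₀(Tr_{𝒌/𝒌₀}(trace(a))) for a ∈ M_n(𝒌), and normalize the Fourier transform by F Φ(a) = q₀^{-n²}·Σ_{g∈M_n(𝒌)}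 Φ(g)Ψ(ga) (note (q₀^{n²})² = |M_n(𝒌)|). Let δ ∈ 𝒌^× with Tr_{𝒌/𝒌₀}(δ) = 0, and let ω ∈ R^× be the scalar with π(δ·1_n) = ω·Id. Then for every Φ : M_n(𝒌) → R, every v ∈ V and every v^∨ ∈ Hom_R(V,R): Z(FΦ, (f_{v,v^∨})^∨) = ω · Z(Φ, f_{v,v^∨}). -/
open Matrix
noncomputable section

namespace Stmt12

variable {k₀ k R V : Type*} [Field k₀] [Field k] [Algebra k₀ k] [Fintype k₀] [Fintype k]
  [DecidableEq k] [Field R] [AddCommGroup V] [Module R V] {n : ℕ}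

/-- The Godement–Jacquet sum `Z(Φ, f) = Σ_{g ∈ GL_n(𝒌)} Φ(g) f(g)`. -/
def Z (Φ : Matrix (Fin n) (Fin n) k → R) (f : GL (Fin n) k → R) : R :=
  ∑ g : GL (Fin n) k, Φ (g : Matrix (Fin n) (Fin n) k) * f g

/-- The matrix coefficient `f_{v,v^∨}(g) = v^∨(π(g) v)`. -/
def mc (π : Representation R (GL (Fin n) k) V) (v : V) (v' : Module.Dual R V) :
    GL (Fin n) k → R := fun g => v' (π g v)

/-- `f^∨(g) = f(g⁻¹)`. -/
def inve (f : GL (Fin n) k → R) : GL (Fin n) k → R := fun g => f g⁻¹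

/-- The Fourier transform on `M_n(𝒌)` for the character `Ψ = ψ₀ ∘ Tr_{𝒌/𝒌₀} ∘ trace`,
with normalization constant `c`. -/
def fourierGal (c : R) (ψ₀ : AddChar k₀ R) (Φ : Matrix (Fin n) (Fin n) k → R) :
    Matrix (Fin n) (Fin n) k → R :=
  fun a => c * ∑ g : Matrix (Fin n) (Fin n) k,
    Φ g * ψ₀ (Algebra.trace k₀ k (Matrix.trace (g * a)))

/-- `u` lies in the unipotent radical of the parabolic subgroup determined by `b`. -/
def UnipCond {N : ℕ} (b : Fin n → Fin N) (u : GL (Fin n) k) : Prop :=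
  (∀ i j, b j < b i → (u : Matrix (Fin n) (Fin n) k) i j = 0) ∧
  (∀ i j, b i = b j → (u : Matrix (Fin n) (Fin n) k) i j = if i = j then 1 else 0)

/-- Cuspidality: coinvariants vanish for the unipotent radical of every proper parabolic
subgroup. -/
def IsCuspidal (π : Representation R (GL (Fin n) k) V) : Prop :=
  ∀ (N : ℕ) (b : Fin n → Fin N), (∃ i j, b i ≠ b j) → ∀ h : GL (Fin n) k,
    Submodule.span R {x : V | ∃ u : GL (Fin n) k, UnipCond b u ∧
      ∃ v : V, x = v - π (h * u * h⁻¹) v} = ⊤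

/-- The embedding `GL_n(𝒌₀) → GL_n(𝒌)`. -/
def glMap (n : ℕ) : GL (Fin n) k₀ →* GL (Fin n) k :=
  Units.map ((algebraMap k₀ k).mapMatrix).toMonoidHom

/-- The scalar matrix `t·1_n ∈ GL_n(𝒌)` for `t ∈ 𝒌^×`. -/
def scalarGL (n : ℕ) (t : kˣ) : GL (Fin n) k :=
  Units.map (algebraMap k (Matrix (Fin n) (Fin n) k)).toMonoidHom t

section Cosets

variable {G : Type*} [Group G] (H : Subgroup G) {M : Type*}

lemma map_out_eq_of_mul_right {f : G → M} (hf : ∀ a, ∀ h ∈ H, f (a * h) = f a) (a : G) :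
    f (a : G ⧸ H).out = f a := by
  obtain ⟨h, hh⟩ := QuotientGroup.mk_out_eq_mul H a
  rw [hh, hf _ _ h.2]

variable [Fintype (G ⧸ H)] [AddCommMonoid M]

lemma sum_out_mul_left {f : G → M} (hf : ∀ a, ∀ h ∈ H, f (a * h) = f a) (u : G) :
    ∑ x : G ⧸ H, f (u * x.out) = ∑ x : G ⧸ H, f x.out := by
  refine Fintype.sum_equiv (MulAction.toPerm u) _ _ fun x => ?_
  rw [← map_out_eq_of_mul_right H hf (u * x.out)]
  congr 2
  conv_rhs => rw [MulAction.toPerm_apply, ← QuotientGroup.out_eq' x]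
  rfl

lemma sum_out_eq_of_support {f : G → M} (hf : ∀ a, ∀ h ∈ H, f (a * h) = f a) (d : G)
    (hd : ∀ a, d⁻¹ * a ∉ H → f a = 0) : ∑ x : G ⧸ H, f x.out = f d := by
  rw [Fintype.sum_eq_single (d : G ⧸ H), map_out_eq_of_mul_right H hf]
  intro x hx
  refine hd _ fun h => hx ?_
  rw [← QuotientGroup.out_eq' x, eq_comm]
  exact QuotientGroup.eq.2 h

lemma sum_out_sum_mul [Fintype G] [Fintype H] (f : G → M) :
    ∑ x : G ⧸ H, ∑ h : H, f (x.out * h) = ∑ g, f g := by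
  rw [← Fintype.sum_prod_type' (f := fun (x : G ⧸ H) (h : H) => f (x.out * h))]
  refine Fintype.sum_bijective (fun p : (G ⧸ H) × H => p.1.out * (p.2 : G)) ⟨?_, ?_⟩ _ _
    fun _ => rfl
  · rintro ⟨x, h⟩ ⟨y, h'⟩ e
    simp only at e
    have hxy : x = y := by
      rw [← QuotientGroup.out_eq' x, ← QuotientGroup.out_eq' y,
        ← QuotientGroup.mk_mul_of_mem x.out h.2, e, QuotientGroup.mk_mul_of_mem _ h'.2]
    subst hxy
    simpa using e
  · intro g
    refine ⟨⟨g, (g : G ⧸ H).out⁻¹ * g, ?_⟩, by simp⟩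
    exact QuotientGroup.eq.1 (QuotientGroup.out_eq' _)

end Cosets

lemma sum_units_eq_of_nonunit {A M : Type*} [Monoid A] [Fintype A] [Fintype Aˣ]
    [AddCommMonoid M] (f : A → M) (hf : ∀ a, ¬ IsUnit a → f a = 0) :
    ∑ u : Aˣ, f u = ∑ a, f a :=
  Fintype.sum_of_injective (fun u : Aˣ => (u : A)) Units.val_injective _ _ (fun a ha => hf a ha)
    fun _ => rfl

section TraceZero

variable (k₀ k)

omit [Fintype k₀] [DecidableEq k] in
lemma pow_card_eq_neg_of_trace_eq_zero (hquad : Module.finrank k₀ k = 2) {x : k}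
    (hx : Algebra.trace k₀ k x = 0) : x ^ Nat.card k₀ = -x := by
  have h := FiniteField.algebraMap_trace_eq_sum_pow k₀ k x
  rw [hx, hquad, map_zero] at h
  simp only [Finset.sum_range_succ, Finset.sum_range_zero, pow_zero, pow_one, zero_add] at h
  exact (neg_eq_of_add_eq_zero_right h.symm).symm

omit [DecidableEq k] in
lemma mem_range_of_pow_card_eq {x : k} (hx : x ^ Nat.card k₀ = x) :
    x ∈ Set.range (algebraMap k₀ k) := by
  rw [IsGalois.mem_range_algebraMap_iff_fixed]
  intro f
  obtain ⟨i, rfl⟩ := (FiniteField.bijective_frobeniusAlgEquivOfAlgebraic_pow k₀ k).2 f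
  rw [AlgEquiv.coe_pow, FiniteField.coe_frobeniusAlgEquivOfAlgebraic]
  refine Function.iterate_fixed ?_ _
  simpa [Nat.card_eq_fintype_card] using hx

variable {k₀ k}

omit [DecidableEq k] in
lemma mul_mem_range_of_trace_eq_zero (hquad : Module.finrank k₀ k = 2) {x y : k}
    (hx : Algebra.trace k₀ k x = 0) (hy : Algebra.trace k₀ k y = 0) :
    x * y ∈ Set.range (algebraMap k₀ k) := by
  apply mem_range_of_pow_card_eq
  rw [mul_pow, pow_card_eq_neg_of_trace_eq_zero k₀ k hquad hx,
    pow_card_eq_neg_of_trace_eq_zero k₀ k hquad hy, neg_mul_neg]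

omit [DecidableEq k] in
lemma inv_mul_mem_range_of_trace_eq_zero (hquad : Module.finrank k₀ k = 2) {x y : k}
    (hx : Algebra.trace k₀ k x = 0) (hy : Algebra.trace k₀ k y = 0) :
    x⁻¹ * y ∈ Set.range (algebraMap k₀ k) := by
  apply mem_range_of_pow_card_eq
  rw [mul_pow, inv_pow, pow_card_eq_neg_of_trace_eq_zero k₀ k hquad hx,
    pow_card_eq_neg_of_trace_eq_zero k₀ k hquad hy, inv_neg, neg_mul_neg]

end TraceZero

section Unipotent

omit [Fintype k] in
/-- The right kernel of a singular matrix contains a line, and the unipotent radical of the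
stabilizer of that line fixes the matrix under right multiplication. -/
lemma exists_conj_unipotent_mul_eq (hn : 2 ≤ n) {g : Matrix (Fin n) (Fin n) k}
    (hg : ¬ IsUnit g) : ∃ (b : Fin n → Fin 2) (h : GL (Fin n) k), (∃ i j, b i ≠ b j) ∧
      ∀ u : GL (Fin n) k, UnipCond b u →
        g * ((h * u * h⁻¹ : GL (Fin n) k) : Matrix (Fin n) (Fin n) k) = g := by
  have hdet : g.det = 0 := by
    by_contra h
    exact hg ((Matrix.isUnit_iff_isUnit_det g).2 (isUnit_iff_ne_zero.2 h))
  obtain ⟨v, hv0, hv⟩ := Matrix.exists_mulVec_eq_zero_iff.2 hdet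
  obtain ⟨i, hi⟩ := Function.ne_iff.1 hv0
  have hh : ((1 : Matrix (Fin n) (Fin n) k).updateCol i v).det ≠ 0 := by
    rw [← Matrix.cramer_apply, Matrix.cramer_one]
    exact hi
  set h : GL (Fin n) k := Matrix.GeneralLinearGroup.mkOfDetNeZero _ hh with hdef
  have hcol : ∀ l, (g * (h : Matrix (Fin n) (Fin n) k)) l i = 0 := by
    intro l
    have := congrFun hv l
    simpa [Matrix.mul_apply, Matrix.mulVec, dotProduct, hdef,
      Matrix.GeneralLinearGroup.mkOfDetNeZero, Matrix.GeneralLinearGroup.mk''] using this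
  have : Nontrivial (Fin n) := Fin.nontrivial_iff_two_le.2 hn
  obtain ⟨j, hj⟩ := exists_ne i
  refine ⟨fun l => if l = i then 0 else 1, h, ⟨i, j, by simp [hj]⟩, fun u hu => ?_⟩
  have hu1 : ∀ l m, l ≠ i →
      (u : Matrix (Fin n) (Fin n) k) l m = (1 : Matrix (Fin n) (Fin n) k) l m := by
    intro l m hl
    rw [Matrix.one_apply]
    by_cases hm : m = i
    · subst hm
      rw [hu.1 l m (by simp [hl]), if_neg hl]
    · exact hu.2 l m (by simp [hl, hm])
  have hgu : g * (h : Matrix (Fin n) (Fin n) k) * (u : Matrix (Fin n) (Fin n) k)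
      = g * (h : Matrix (Fin n) (Fin n) k) := by
    conv_rhs => rw [← mul_one (g * (h : Matrix (Fin n) (Fin n) k))]
    ext l m
    rw [Matrix.mul_apply, Matrix.mul_apply]
    refine Finset.sum_congr rfl fun s _ => ?_
    by_cases hs : s = i
    · rw [hs, hcol, zero_mul, zero_mul]
    · rw [hu1 s m hs]
  rw [Units.val_mul, Units.val_mul, ← mul_assoc, ← mul_assoc, hgu, mul_assoc, ← Units.val_mul,
    mul_inv_cancel, Units.val_one, mul_one]

omit [Fintype k] in
/-- A linear map on a cuspidal representation which is invariant under the right stabilizer of a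
singular matrix is zero. -/
lemma IsCuspidal.eq_zero_of_invariant (hn : 2 ≤ n) {π : Representation R (GL (Fin n) k) V}
    (hcusp : IsCuspidal π) {W : Type*} [AddCommGroup W] [Module R W] (E : V →ₗ[R] W)
    {g : Matrix (Fin n) (Fin n) k} (hg : ¬ IsUnit g)
    (hE : ∀ u : GL (Fin n) k, g * (u : Matrix (Fin n) (Fin n) k) = g →
      ∀ w, E (π u w) = E w) : E = 0 := by
  obtain ⟨b, h, hb, hu⟩ := exists_conj_unipotent_mul_eq hn hg
  rw [← LinearMap.ker_eq_top, eq_top_iff, ← hcusp 2 b hb h, Submodule.span_le]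
  rintro x ⟨u, hbu, w, rfl⟩
  rw [SetLike.mem_coe, LinearMap.mem_ker, map_sub, hE _ (hu u hbu), sub_self]

end Unipotent

section Kernel

/-- The additive character `ψ₀ ∘ Tr_{𝒌/𝒌₀} ∘ trace` of `M_n(𝒌)`. -/
def traceChar (ψ₀ : AddChar k₀ R) (a : Matrix (Fin n) (Fin n) k) : R :=
  ψ₀ (Algebra.trace k₀ k (Matrix.trace a))

omit [Fintype k₀] [Fintype k] [DecidableEq k] in
lemma traceChar_mul_comm (ψ₀ : AddChar k₀ R) (a b : Matrix (Fin n) (Fin n) k) :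
    traceChar ψ₀ (a * b) = traceChar ψ₀ (b * a) := by
  rw [traceChar, traceChar, Matrix.trace_mul_comm]

/-- The operator `Σ_a Ψ(ga) π(a⁻¹)`. -/
def gaussOp (π : Representation R (GL (Fin n) k) V) (ψ₀ : AddChar k₀ R)
    (g : Matrix (Fin n) (Fin n) k) : V →ₗ[R] V :=
  ∑ a : GL (Fin n) k, traceChar ψ₀ (g * (a : Matrix (Fin n) (Fin n) k)) • π a⁻¹

variable (π : Representation R (GL (Fin n) k) V) (ψ₀ : AddChar k₀ R)

omit [Fintype k₀] in
lemma gaussOp_apply (g : Matrix (Fin n) (Fin n) k) (v : V) :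
    gaussOp π ψ₀ g v =
      ∑ a : GL (Fin n) k, traceChar ψ₀ (g * (a : Matrix (Fin n) (Fin n) k)) • π a⁻¹ v := by
  simp [gaussOp, LinearMap.sum_apply]

omit [Fintype k₀] in
lemma gaussOp_mul_unit (g : Matrix (Fin n) (Fin n) k) (u : GL (Fin n) k) :
    gaussOp π ψ₀ (g * (u : Matrix (Fin n) (Fin n) k)) = gaussOp π ψ₀ g ∘ₗ π u := by
  ext v
  rw [LinearMap.comp_apply, gaussOp_apply, gaussOp_apply]
  refine Fintype.sum_equiv (Equiv.mulLeft u) _ _ fun a => ?_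
  rw [Equiv.coe_mulLeft, _root_.mul_inv_rev, map_mul, Module.End.mul_apply, Units.val_mul, mul_assoc,
    ← Module.End.mul_apply (π u⁻¹), ← map_mul, inv_mul_cancel, map_one, Module.End.one_apply]

omit [Fintype k₀] in
lemma gaussOp_unit_mul (g : Matrix (Fin n) (Fin n) k) (u : GL (Fin n) k) :
    gaussOp π ψ₀ ((u : Matrix (Fin n) (Fin n) k) * g) = π u ∘ₗ gaussOp π ψ₀ g := by
  ext v
  rw [LinearMap.comp_apply, gaussOp_apply, gaussOp_apply, map_sum]
  refine Fintype.sum_equiv (Equiv.mulRight u) _ _ fun a => ?_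
  rw [Equiv.coe_mulRight, _root_.mul_inv_rev, map_mul, Module.End.mul_apply, Units.val_mul, mul_assoc,
    traceChar_mul_comm, map_smul, ← Module.End.mul_apply (π u), ← map_mul, mul_inv_cancel, map_one,
    Module.End.one_apply, mul_assoc]

omit [Fintype k₀] in
lemma gaussOp_eq_zero (hn : 2 ≤ n) (hcusp : IsCuspidal π) {g : Matrix (Fin n) (Fin n) k}
    (hg : ¬ IsUnit g) : gaussOp π ψ₀ g = 0 :=
  hcusp.eq_zero_of_invariant hn _ hg fun u hu w => by
    rw [← LinearMap.comp_apply, ← gaussOp_mul_unit, hu]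

omit [Fintype k₀] in
lemma exists_gaussOp_eq_smul
    (hschur : ∀ φ : V →ₗ[R] V, (∀ g : GL (Fin n) k, φ ∘ₗ π g = π g ∘ₗ φ) →
      ∃ c : R, φ = c • LinearMap.id) :
    ∃ γ : R, ∀ g : GL (Fin n) k, gaussOp π ψ₀ (g : Matrix (Fin n) (Fin n) k) = γ • π g := by
  obtain ⟨γ, hγ⟩ := hschur (gaussOp π ψ₀ 1) fun g => by
    rw [← gaussOp_mul_unit, ← gaussOp_unit_mul, one_mul, mul_one]
  refine ⟨γ, fun g => ?_⟩
  rw [← one_mul (g : Matrix (Fin n) (Fin n) k), gaussOp_mul_unit, hγ, LinearMap.smul_comp,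
    LinearMap.id_comp]

omit [Fintype k₀] in
lemma Z_fourierGal (c : R) (Φ : Matrix (Fin n) (Fin n) k → R) (v : V) (v' : Module.Dual R V) :
    Z (fourierGal c ψ₀ Φ) (inve (mc π v v')) =
      c * ∑ g : Matrix (Fin n) (Fin n) k, Φ g * v' (gaussOp π ψ₀ g v) := by
  simp only [Z, fourierGal, inve, mc, gaussOp_apply, map_sum, map_smul, smul_eq_mul,
    Finset.mul_sum, Finset.sum_mul]
  rw [Finset.sum_comm]
  refine Finset.sum_congr rfl fun g _ => Finset.sum_congr rfl fun a _ => ?_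
  rw [traceChar]
  ring

end Kernel

section Distinguished

omit [Fintype k₀] [Fintype k] [DecidableEq k] in
lemma trace_mul_mapMatrix (x : Matrix (Fin n) (Fin n) k) (h : Matrix (Fin n) (Fin n) k₀) :
    Algebra.trace k₀ k (Matrix.trace (x * (algebraMap k₀ k).mapMatrix h)) =
      Matrix.trace (x.map (Algebra.trace k₀ k) * h) := by
  simp only [Matrix.trace, Matrix.diag_apply, Matrix.mul_apply, RingHom.mapMatrix_apply,
    Matrix.map_apply, map_sum]
  refine Finset.sum_congr rfl fun i _ => Finset.sum_congr rfl fun j _ => ?_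
  rw [mul_comm, ← Algebra.smul_def, map_smul, smul_eq_mul, mul_comm]

omit [Fintype k] [DecidableEq k] in
open Classical in
/-- The sum of `Ψ` over a translate of `M_n(𝒌₀)` is supported on matrices of trace zero. -/
lemma sum_traceChar_mapMatrix (ψ₀ : AddChar k₀ R) (hψ₀ : ∃ x, ψ₀ x ≠ 1)
    (x : Matrix (Fin n) (Fin n) k) :
    ∑ h : Matrix (Fin n) (Fin n) k₀, traceChar ψ₀ (x * (algebraMap k₀ k).mapMatrix h) =
      if x.map (Algebra.trace k₀ k) = 0 then (Fintype.card k₀ : R) ^ (n ^ 2) else 0 := by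
  simp only [traceChar, trace_mul_mapMatrix]
  set A := x.map (Algebra.trace k₀ k)
  split_ifs with hA
  · have hcard : Fintype.card (Matrix (Fin n) (Fin n) k₀) = Fintype.card k₀ ^ (n ^ 2) := by
      rw [← Nat.card_eq_fintype_card, ← Nat.card_eq_fintype_card]
      change Nat.card (Fin n → Fin n → k₀) = _
      simp [← pow_mul, pow_two]
    simp [hA, hcard]
  · let χ : AddChar (Matrix (Fin n) (Fin n) k₀) R := ψ₀.compAddMonoidHom
      ((Matrix.traceAddMonoidHom (Fin n) k₀).comp (AddMonoidHom.mulLeft A))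
    have hχ : χ ≠ 0 := by
      obtain ⟨t, ht⟩ := hψ₀
      obtain ⟨i, j, hij⟩ : ∃ i j, A i j ≠ 0 := by
        by_contra! h
        exact hA (Matrix.ext h)
      refine AddChar.ne_one_iff.2 ⟨Matrix.single j i ((A i j)⁻¹ * t), ?_⟩
      change ψ₀ (Matrix.trace (A * Matrix.single j i ((A i j)⁻¹ * t))) ≠ 1
      rw [Matrix.trace_mul_single, MulOpposite.smul_eq_mul_unop, MulOpposite.unop_op,
        mul_inv_cancel_left₀ hij]
      exact ht
    exact (AddChar.sum_eq_ite χ).trans (if_neg hχ)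

omit [DecidableEq k] in
lemma inv_scalarGL_mul_mem_range (hquad : Module.finrank k₀ k = 2) {δ : kˣ}
    (hδ : Algebra.trace k₀ k (δ : k) = 0) {x : GL (Fin n) k}
    (hx : (x : Matrix (Fin n) (Fin n) k).map (Algebra.trace k₀ k) = 0) :
    (scalarGL n δ)⁻¹ * x ∈ (glMap (k₀ := k₀) (k := k) n).range := by
  classical
  choose y hy using fun i j => inv_mul_mem_range_of_trace_eq_zero hquad hδ
    (y := (x : Matrix (Fin n) (Fin n) k) i j) (congrFun (congrFun hx i) j)
  have hyx : (algebraMap k₀ k).mapMatrix (Matrix.of y) =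
      (((scalarGL n δ)⁻¹ * x : GL (Fin n) k) : Matrix (Fin n) (Fin n) k) := by
    rw [eq_comm, Units.val_mul, Units.inv_mul_eq_iff_eq_mul]
    ext i j
    change _ = (algebraMap k (Matrix (Fin n) (Fin n) k) (δ : k) *
      (algebraMap k₀ k).mapMatrix (Matrix.of y)) i j
    rw [← Algebra.smul_def, Matrix.smul_apply, RingHom.mapMatrix_apply, Matrix.map_apply,
      Matrix.of_apply, hy, smul_eq_mul, mul_inv_cancel_left₀ δ.ne_zero]
  have hdet : (Matrix.of y).det ≠ 0 := by
    intro h0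
    have h1 := ((algebraMap k₀ k).map_det (Matrix.of y)).symm
    rw [h0, map_zero, hyx] at h1
    exact ((Matrix.isUnit_iff_isUnit_det _).1 (Units.isUnit ((scalarGL n δ)⁻¹ * x))).ne_zero h1
  exact ⟨Matrix.GeneralLinearGroup.mkOfDetNeZero _ hdet, Units.ext hyx⟩

omit [DecidableEq k] in
lemma scalarGL_mul_self_mem_range (hquad : Module.finrank k₀ k = 2) {δ : kˣ}
    (hδ : Algebra.trace k₀ k (δ : k) = 0) :
    scalarGL n δ * scalarGL n δ ∈ (glMap (k₀ := k₀) (k := k) n).range := by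
  obtain ⟨t, ht⟩ := mul_mem_range_of_trace_eq_zero hquad hδ hδ
  have ht0 : t ≠ 0 := by
    rintro rfl
    rw [map_zero, eq_comm, mul_self_eq_zero] at ht
    exact δ.ne_zero ht
  refine ⟨Units.map (algebraMap k₀ (Matrix (Fin n) (Fin n) k₀)).toMonoidHom (Units.mk0 t ht0),
    Units.ext ?_⟩
  change (algebraMap k₀ k).mapMatrix (algebraMap k₀ (Matrix (Fin n) (Fin n) k₀) t) =
    algebraMap k (Matrix (Fin n) (Fin n) k) δ * algebraMap k (Matrix (Fin n) (Fin n) k) δ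
  rw [← map_mul, ← ht]
  ext i j
  simp [Matrix.algebraMap_matrix_apply, apply_ite (algebraMap k₀ k)]

omit [Fintype k₀] [Fintype k] [DecidableEq k] in
lemma glMap_injective : Function.Injective (glMap (k₀ := k₀) (k := k) n) :=
  Units.map_injective (Matrix.map_injective (algebraMap k₀ k).injective)

variable {π : Representation R (GL (Fin n) k) V} {Λ : Module.Dual R V}

omit [Fintype k₀] [Fintype k] [DecidableEq k] in
lemma apply_inv_mul_of_mem_range
    (hΛ : ∀ (h : GL (Fin n) k₀) (v : V), Λ (π (glMap n h) v) = Λ v) (v : V) (a : GL (Fin n) k) :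
    ∀ h ∈ (glMap (k₀ := k₀) (k := k) n).range, Λ (π (a * h)⁻¹ v) = Λ (π a⁻¹ v) := by
  rintro _ ⟨h, rfl⟩
  rw [_root_.mul_inv_rev, map_mul, Module.End.mul_apply, ← map_inv, hΛ]

omit [Fintype k₀] in
/-- Cuspidality kills the part of the Gauss sum of a distinguished form coming from singular
matrices over `𝒌₀`. -/
lemma sum_singular_eq_zero [Fintype (GL (Fin n) k ⧸ (glMap (k₀ := k₀) (k := k) n).range)]
    (hn : 2 ≤ n) (hcusp : IsCuspidal π)
    (hΛ : ∀ (h : GL (Fin n) k₀) (v : V), Λ (π (glMap n h) v) = Λ v) (ψ₀ : AddChar k₀ R)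
    (v : V) (T : Finset (Matrix (Fin n) (Fin n) k₀)) (hT : ∀ h, h ∈ T ↔ ¬ IsUnit h) :
    ∑ x : GL (Fin n) k ⧸ (glMap (k₀ := k₀) (k := k) n).range, (∑ h ∈ T,
      traceChar ψ₀ ((x.out : Matrix (Fin n) (Fin n) k) * (algebraMap k₀ k).mapMatrix h)) *
        Λ (π x.out⁻¹ v) = 0 := by
  classical
  let S : Matrix (Fin n) (Fin n) k₀ → Set (GL (Fin n) k) := fun h =>
    {u | (algebraMap k₀ k).mapMatrix h * (u : Matrix (Fin n) (Fin n) k) =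
      (algebraMap k₀ k).mapMatrix h}
  have hS : ∀ (g : GL (Fin n) k₀) (h : Matrix (Fin n) (Fin n) k₀),
      S ((g : Matrix (Fin n) (Fin n) k₀) * h) = S h := by
    intro g h
    ext u
    change _ * _ = _ ↔ _ * _ = _
    rw [map_mul, mul_assoc]
    exact (Units.mul_right_inj (glMap (k := k) n g))
  simp only [← Finset.sum_fiberwise T S, Finset.sum_mul]
  rw [Finset.sum_comm]
  refine Finset.sum_eq_zero fun s _ => ?_
  by_cases hs : ∃ h₀ ∈ T, S h₀ = s
  swap
  · refine Finset.sum_eq_zero fun x _ => Finset.sum_eq_zero fun h hh => ?_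
    exact absurd ⟨h, (Finset.mem_filter.1 hh).1, (Finset.mem_filter.1 hh).2⟩ hs
  obtain ⟨h₀, hh₀, rfl⟩ := hs
  let m : GL (Fin n) k → R := fun a => ∑ h ∈ T with S h = S h₀,
    traceChar ψ₀ ((a : Matrix (Fin n) (Fin n) k) * (algebraMap k₀ k).mapMatrix h)
  have hmH : ∀ a, ∀ h ∈ (glMap (k₀ := k₀) (k := k) n).range, m (a * h) = m a := by
    rintro a _ ⟨g, rfl⟩
    refine Finset.sum_bij' (fun h _ => (g : Matrix (Fin n) (Fin n) k₀) * h)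
      (fun h _ => ((g⁻¹ : GL (Fin n) k₀) : Matrix (Fin n) (Fin n) k₀) * h) ?_ ?_ ?_ ?_ ?_
    · intro h hh
      simp only [Finset.mem_filter, hT, hS, Units.isUnit_units_mul] at hh ⊢
      exact hh
    · intro h hh
      simp only [Finset.mem_filter, hT, hS, Units.isUnit_units_mul] at hh ⊢
      exact hh
    · intro h _
      rw [← mul_assoc, ← Units.val_mul, inv_mul_cancel, Units.val_one, one_mul]
    · intro h _
      rw [← mul_assoc, ← Units.val_mul, mul_inv_cancel, Units.val_one, one_mul]
    · intro h _
      rw [map_mul, Units.val_mul, mul_assoc]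
      rfl
  have hmu : ∀ u ∈ S h₀, ∀ a, m (u * a) = m a := by
    intro u hu a
    refine Finset.sum_congr rfl fun h hh => ?_
    have hu' : u ∈ S h := (Finset.mem_filter.1 hh).2 ▸ hu
    rw [Units.val_mul, mul_assoc, traceChar_mul_comm, mul_assoc, show _ * _ = _ from hu',
      traceChar_mul_comm]
  let E : V →ₗ[R] R := ∑ x : GL (Fin n) k ⧸ (glMap (k₀ := k₀) (k := k) n).range,
    m x.out • (Λ ∘ₗ π x.out⁻¹)
  have hEapp : ∀ w, E w = ∑ x : GL (Fin n) k ⧸ (glMap (k₀ := k₀) (k := k) n).range,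
      m x.out * Λ (π x.out⁻¹ w) := by
    intro w
    simp [E, LinearMap.sum_apply]
  have hsing : ¬ IsUnit ((algebraMap k₀ k).mapMatrix h₀) := by
    rw [Matrix.isUnit_iff_isUnit_det, ← RingHom.map_det, isUnit_iff_ne_zero,
      map_ne_zero_iff _ (algebraMap k₀ k).injective, ← isUnit_iff_ne_zero,
      ← Matrix.isUnit_iff_isUnit_det]
    exact (hT h₀).1 hh₀
  have hE : E = 0 := hcusp.eq_zero_of_invariant hn E hsing fun u hu w => by
    rw [hEapp, hEapp, ← sum_out_mul_left (glMap (k₀ := k₀) (k := k) n).range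
      (f := fun a => m a * Λ (π a⁻¹ (π u w)))
      (fun a h hh => by rw [hmH a h hh, apply_inv_mul_of_mem_range hΛ _ _ h hh]) u]
    refine Finset.sum_congr rfl fun x _ => ?_
    rw [hmu u hu, ← Module.End.mul_apply, ← map_mul, _root_.mul_inv_rev, inv_mul_cancel_right]
  have := hEapp v
  rw [hE, LinearMap.zero_apply] at this
  simp only [m, Finset.sum_mul] at this
  exact this.symm

lemma dual_gaussOp_one (hn : 2 ≤ n) (hquad : Module.finrank k₀ k = 2) (hcusp : IsCuspidal π)
    (hΛ : ∀ (h : GL (Fin n) k₀) (v : V), Λ (π (glMap n h) v) = Λ v)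
    (ψ₀ : AddChar k₀ R) (hψ₀ : ∃ x, ψ₀ x ≠ 1) {δ : kˣ}
    (hδ : Algebra.trace k₀ k (δ : k) = 0) (v : V) :
    Λ (gaussOp π ψ₀ 1 v) = (Fintype.card k₀ : R) ^ (n ^ 2) * Λ (π (scalarGL n δ)⁻¹ v) := by
  classical
  let H := (glMap (k₀ := k₀) (k := k) n).range
  let F : GL (Fin n) k → R := fun a => Λ (π a⁻¹ v)
  have hF : ∀ a, ∀ h ∈ H, F (a * h) = F a := apply_inv_mul_of_mem_range hΛ v
  have hsplit : ∀ x : GL (Fin n) k ⧸ H,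
      ∑ h : H, traceChar ψ₀ (((x.out * h : GL (Fin n) k)) : Matrix (Fin n) (Fin n) k) =
        ∑ h : Matrix (Fin n) (Fin n) k₀,
          traceChar ψ₀ ((x.out : Matrix (Fin n) (Fin n) k) * (algebraMap k₀ k).mapMatrix h) -
        ∑ h : Matrix (Fin n) (Fin n) k₀ with ¬ IsUnit h,
          traceChar ψ₀ ((x.out : Matrix (Fin n) (Fin n) k) * (algebraMap k₀ k).mapMatrix h) := by
    intro x
    rw [eq_sub_iff_add_eq, ← Finset.sum_filter_add_sum_filter_not Finset.univ
      (fun h : Matrix (Fin n) (Fin n) k₀ => IsUnit h)]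
    congr 1
    rw [Finset.sum_filter, ← sum_units_eq_of_nonunit _ fun a ha => if_neg ha]
    refine (Fintype.sum_equiv (MonoidHom.ofInjective glMap_injective).toEquiv _ _
      fun h => ?_).symm
    rw [if_pos h.isUnit]
    rfl
  have hT : ∀ x : GL (Fin n) k ⧸ H,
      ∑ h : Matrix (Fin n) (Fin n) k₀,
          traceChar ψ₀ ((x.out : Matrix (Fin n) (Fin n) k) * (algebraMap k₀ k).mapMatrix h) =
        if x.out.val.map (Algebra.trace k₀ k) = 0 then (Fintype.card k₀ : R) ^ (n ^ 2) else 0 :=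
    fun x => sum_traceChar_mapMatrix ψ₀ hψ₀ _
  have hm : ∀ a : GL (Fin n) k, ∀ h ∈ H,
      ∑ g : Matrix (Fin n) (Fin n) k₀, traceChar ψ₀
          (((a * h : GL (Fin n) k) : Matrix (Fin n) (Fin n) k) * (algebraMap k₀ k).mapMatrix g) =
        ∑ g : Matrix (Fin n) (Fin n) k₀, traceChar ψ₀
          ((a : Matrix (Fin n) (Fin n) k) * (algebraMap k₀ k).mapMatrix g) := by
    rintro a _ ⟨h, rfl⟩
    refine Fintype.sum_equiv h.mulLeft _ _ fun g => ?_
    rw [Units.val_mul, mul_assoc]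
    congr 2
    exact (map_mul (algebraMap k₀ k).mapMatrix (h : Matrix (Fin n) (Fin n) k₀) g).symm
  have hδ0 : ((scalarGL n δ : GL (Fin n) k) : Matrix (Fin n) (Fin n) k).map
      (Algebra.trace k₀ k) = 0 := by
    ext i j
    change Algebra.trace k₀ k (algebraMap k (Matrix (Fin n) (Fin n) k) δ i j) = 0
    rw [Matrix.algebraMap_matrix_apply]
    split_ifs <;> simp [hδ]
  calc Λ (gaussOp π ψ₀ 1 v)
      = ∑ a : GL (Fin n) k, traceChar ψ₀ (a : Matrix (Fin n) (Fin n) k) * F a := by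
        simp [gaussOp_apply, F]
    _ = ∑ x : GL (Fin n) k ⧸ H, (∑ h : H,
          traceChar ψ₀ (((x.out * h : GL (Fin n) k)) : Matrix (Fin n) (Fin n) k)) * F x.out := by
        rw [← sum_out_sum_mul H]
        simp only [hF _ _ (Subtype.prop _), Finset.sum_mul]
    _ = ∑ x : GL (Fin n) k ⧸ H, (∑ h : Matrix (Fin n) (Fin n) k₀, traceChar ψ₀
          ((x.out : Matrix (Fin n) (Fin n) k) * (algebraMap k₀ k).mapMatrix h)) * F x.out := by
        simp only [hsplit, sub_mul, Finset.sum_sub_distrib]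
        rw [sub_eq_self]
        exact sum_singular_eq_zero hn hcusp hΛ ψ₀ v _ (by simp)
    _ = _ := by
        rw [sum_out_eq_of_support H (f := fun a => (∑ h : Matrix (Fin n) (Fin n) k₀, traceChar ψ₀
          ((a : Matrix (Fin n) (Fin n) k) * (algebraMap k₀ k).mapMatrix h)) * F a)
          (fun a h hh => by rw [hm a h hh, hF a h hh]) (scalarGL n δ)]
        · rw [sum_traceChar_mapMatrix ψ₀ hψ₀, if_pos hδ0]
        · intro a ha
          rw [sum_traceChar_mapMatrix ψ₀ hψ₀, if_neg, zero_mul]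
          exact fun h => ha (inv_scalarGL_mul_mem_range hquad hδ h)

end Distinguished

omit [Fintype k] [DecidableEq k] in
lemma card_ne_zero_of_ringChar_ne (hchar : ringChar R ≠ ringChar k) :
    (Fintype.card k₀ : R) ≠ 0 := by
  obtain ⟨p, hp, m, hpp, hm⟩ := FiniteField.card' k₀
  have : CharP k p := charP_of_injective_algebraMap (algebraMap k₀ k).injective p
  intro h
  rw [hm, Nat.cast_pow] at h
  have hpR : (p : R) = 0 := pow_eq_zero_iff m.ne_zero |>.1 h
  rw [ringChar.eq k p] at hchar
  rcases (Nat.dvd_prime hpp).1 (ringChar.dvd hpR) with h1 | h1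
  · exact CharP.ringChar_ne_one h1
  · exact hchar h1

/-- **Gamma factor of a Galois-distinguished cuspidal representation equals the central
character at a trace-zero element.**  For `𝒌/𝒌₀` quadratic of odd characteristic, `π` an
absolutely irreducible cuspidal representation of `GL_n(𝒌)` distinguished by
`GL_n(𝒌₀)`, `ψ₀` a nontrivial additive character of `𝒌₀`, `δ ∈ 𝒌^×` of trace zero and
`ω` the scalar by which `δ·1_n` acts, one has `Z(FΦ, (f_{v,v^∨})^∨) = ω Z(Φ, f_{v,v^∨})`
for all `Φ, v, v^∨`, the Fourier transform being normalized by `q₀^{-n²}`. -/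
theorem galois_distinguished_gamma (hn : 2 ≤ n)
    (hquad : Module.finrank k₀ k = 2) (hodd : ringChar k ≠ 2)
    (hchar : ringChar R ≠ ringChar k)
    (π : Representation R (GL (Fin n) k) V)
    (hV : ∃ v : V, v ≠ 0)
    (hirr : ∀ W : Submodule R V, (∀ (g : GL (Fin n) k), ∀ v ∈ W, π g v ∈ W) →
      W = ⊥ ∨ W = ⊤)
    (hschur : ∀ φ : V →ₗ[R] V, (∀ g : GL (Fin n) k, φ ∘ₗ π g = π g ∘ₗ φ) →
      ∃ c : R, φ = c • LinearMap.id)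
    (hcusp : IsCuspidal π)
    (hdist : ∃ Λ : Module.Dual R V, Λ ≠ 0 ∧
      ∀ (h : GL (Fin n) k₀) (v : V), Λ (π (glMap n h) v) = Λ v)
    (ψ₀ : AddChar k₀ R) (hψ₀ : ∃ x, ψ₀ x ≠ 1)
    (δ : kˣ) (hδ : Algebra.trace k₀ k (δ : k) = 0)
    (ω : Rˣ) (hω : π (scalarGL n δ) = ((ω : R)) • (LinearMap.id : V →ₗ[R] V))
    (Φ : Matrix (Fin n) (Fin n) k → R) (v : V) (v' : Module.Dual R V) :
    Z (fourierGal (Ring.inverse ((Fintype.card k₀ : R) ^ (n ^ 2))) ψ₀ Φ)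
        (inve (mc π v v'))
      = (ω : R) * Z Φ (mc π v v') := by
  obtain ⟨Λ, hΛ0, hΛ⟩ := hdist
  obtain ⟨w, hw⟩ : ∃ w, Λ w ≠ 0 := by
    by_contra! h
    exact hΛ0 (LinearMap.ext h)
  obtain ⟨γ, hγ⟩ := exists_gaussOp_eq_smul π ψ₀ hschur
  set q := (Fintype.card k₀ : R) ^ (n ^ 2) with hq
  have hq0 : q ≠ 0 := pow_ne_zero _ (card_ne_zero_of_ringChar_ne hchar)
  have hωω : (ω : R) * ω = 1 := by
    obtain ⟨h, hh⟩ := scalarGL_mul_self_mem_range (n := n) hquad hδ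
    have h1 := hΛ h w
    rw [hh, map_mul, hω] at h1
    simp only [Module.End.mul_apply, LinearMap.smul_apply, LinearMap.id_apply, map_smul,
      smul_eq_mul, ← mul_assoc] at h1
    exact (mul_eq_right₀ hw).1 h1
  have hγω : γ = q * ω := by
    have h1 := dual_gaussOp_one hn hquad hcusp hΛ ψ₀ hψ₀ hδ (π (scalarGL n δ) w)
    have h2 := hγ 1
    rw [Units.val_one, map_one] at h2
    rw [h2, ← Module.End.mul_apply (π _⁻¹), ← map_mul π, inv_mul_cancel, map_one, hω] at h1
    simp only [LinearMap.smul_apply, LinearMap.id_apply, Module.End.one_apply, map_smul,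
      smul_eq_mul, ← mul_assoc] at h1
    have h3 := mul_right_cancel₀ hw h1
    rw [hq, ← h3, mul_right_comm, hωω, one_mul]
  rw [Z_fourierGal π, ← sum_units_eq_of_nonunit _ fun a ha => by
    rw [gaussOp_eq_zero π ψ₀ hn hcusp ha, LinearMap.zero_apply, map_zero, mul_zero]]
  simp only [hγ, Z, mc, LinearMap.smul_apply, map_smul, smul_eq_mul, Finset.mul_sum]
  refine Finset.sum_congr rfl fun g _ => ?_
  rw [hγω, Ring.inverse_eq_inv']
  field_simp

end Stmt12
end
end

section
/- Triviality of the Galois gamma factor for a character trivial on the base field: Let 𝒌/𝒌₀ be a quadratic extension of finite fields of odd characteristic p, |𝒌₀| = q₀, n ≥ 2, and R a field of characteristic different from p. Let (π,V) be an absolutely irreducible cuspidal R-representation of GL_n(𝒌) distinguished by GL_n(𝒌₀) (there is a nonzero GL_n(𝒌₀)-invariant linear form on V). Let ψ : (𝒌,+) → R^× be a nontrivial additive character whose restriction to 𝒌₀ is trivial, set Ψ(a) = ψ(trace(a)) for a ∈ M_n(𝒌), and normalize the Fourier transform by F_ψΦ(a) = q₀^{-n²}·Σ_{g∈M_n(𝒌)}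 Φ(g)Ψ(ga). Then for every Φ : M_n(𝒌) → R, v ∈ V and v^∨ ∈ Hom_R(V,R): Z(F_ψΦ, (f_{v,v^∨})^∨) = Z(Φ, f_{v,v^∨}); that is, the Godement–Jacquet gamma factor γ(π,ψ) equals 1. -/
open Matrix
noncomputable section

namespace Stmt13

variable {k₀ k R V : Type*} [Field k₀] [Field k] [Algebra k₀ k] [Fintype k₀] [Fintype k]
  [DecidableEq k] [Field R] [AddCommGroup V] [Module R V] {n : ℕ}

/-- The Godement–Jacquet sum `Z(Φ, f) = Σ_{g ∈ GL_n(𝒌)} Φ(g) f(g)`. -/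
def Z (Φ : Matrix (Fin n) (Fin n) k → R) (f : GL (Fin n) k → R) : R :=
  ∑ g : GL (Fin n) k, Φ (g : Matrix (Fin n) (Fin n) k) * f g

/-- The matrix coefficient `f_{v,v^∨}(g) = v^∨(π(g) v)`. -/
def mc (π : Representation R (GL (Fin n) k) V) (v : V) (v' : Module.Dual R V) :
    GL (Fin n) k → R := fun g => v' (π g v)

/-- `f^∨(g) = f(g⁻¹)`. -/
def inve (f : GL (Fin n) k → R) : GL (Fin n) k → R := fun g => f g⁻¹

/-- The Fourier transform on `M_n(𝒌)` with normalization constant `c`. -/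
def fourier (c : R) (ψ : AddChar k R) (Φ : Matrix (Fin n) (Fin n) k → R) :
    Matrix (Fin n) (Fin n) k → R :=
  fun a => c * ∑ g : Matrix (Fin n) (Fin n) k, Φ g * ψ (Matrix.trace (g * a))

/-- `u` lies in the unipotent radical of the parabolic subgroup determined by `b`. -/
def UnipCond {N : ℕ} (b : Fin n → Fin N) (u : GL (Fin n) k) : Prop :=
  (∀ i j, b j < b i → (u : Matrix (Fin n) (Fin n) k) i j = 0) ∧
  (∀ i j, b i = b j → (u : Matrix (Fin n) (Fin n) k) i j = if i = j then 1 else 0)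

/-- Cuspidality: coinvariants vanish for the unipotent radical of every proper parabolic
subgroup. -/
def IsCuspidal (π : Representation R (GL (Fin n) k) V) : Prop :=
  ∀ (N : ℕ) (b : Fin n → Fin N), (∃ i j, b i ≠ b j) → ∀ h : GL (Fin n) k,
    Submodule.span R {x : V | ∃ u : GL (Fin n) k, UnipCond b u ∧
      ∃ v : V, x = v - π (h * u * h⁻¹) v} = ⊤

/-- The embedding `GL_n(𝒌₀) → GL_n(𝒌)`. -/
def glMap (n : ℕ) : GL (Fin n) k₀ →* GL (Fin n) k :=
  Units.map ((algebraMap k₀ k).mapMatrix).toMonoidHom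

omit [Fintype k] [DecidableEq k] in
/-- A linear map invariant under all `u` with `X * u = X` whenever `X` kills a fixed nonzero
vector `w` vanishes on a cuspidal representation. -/
theorem IsCuspidal.eq_zero_of_invariant {M : Type*} [AddCommGroup M] [Module R M]
    {π : Representation R (GL (Fin n) k) V} (hcusp : IsCuspidal π) (hn : 2 ≤ n)
    {w : Fin n → k} (hw : w ≠ 0) (A : V →ₗ[R] M)
    (hA : ∀ u : GL (Fin n) k,
      (∀ X : Matrix (Fin n) (Fin n) k, X *ᵥ w = 0 → X * (u : Matrix (Fin n) (Fin n) k) = X) →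
      ∀ v, A (π u v) = A v) : A = 0 := by
  obtain ⟨i₁, hi₁⟩ := Function.ne_iff.mp hw
  have hdet : ((1 : Matrix (Fin n) (Fin n) k).updateCol i₁ w).det ≠ 0 := by
    rw [← Matrix.cramer_apply, Matrix.cramer_one]
    exact hi₁
  let h : GL (Fin n) k := Matrix.GeneralLinearGroup.mkOfDetNeZero _ hdet
  have hh : (h : Matrix (Fin n) (Fin n) k).col i₁ = w := by
    ext i
    simp [h, Matrix.GeneralLinearGroup.mkOfDetNeZero]
  have hne : ∃ i j : Fin n, (if i = i₁ then (0 : Fin 2) else 1) ≠ if j = i₁ then 0 else 1 := by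
    have : Nontrivial (Fin n) := Fin.nontrivial_iff_two_le.mpr hn
    obtain ⟨j, hj⟩ := exists_ne i₁
    exact ⟨i₁, j, by simp [hj]⟩
  have htop := hcusp 2 (fun i => if i = i₁ then 0 else 1) hne h
  rw [← LinearMap.ker_eq_top, eq_top_iff, ← htop, Submodule.span_le]
  rintro x ⟨u, ⟨hu₁, hu₂⟩, v, rfl⟩
  rw [SetLike.mem_coe, LinearMap.mem_ker, map_sub, sub_eq_zero]
  refine (hA _ (fun X hX => ?_) v).symm
  have hcol : ∀ i, (X * (h : Matrix (Fin n) (Fin n) k)) i i₁ = 0 := by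
    intro i
    have := congrFun hX i
    rw [← hh] at this
    simpa [Matrix.mul_apply, Matrix.mulVec, dotProduct] using this
  have hY : X * (h : Matrix (Fin n) (Fin n) k) * (u : Matrix (Fin n) (Fin n) k)
      = X * (h : Matrix (Fin n) (Fin n) k) := by
    ext i j
    rw [Matrix.mul_apply, Finset.sum_eq_single j]
    · rw [hu₂ j j rfl, if_pos rfl, mul_one]
    · intro l _ hl
      by_cases hl₁ : l = i₁
      · rw [hl₁, hcol, zero_mul]
      · have : (u : Matrix (Fin n) (Fin n) k) l j = 0 := by
          by_cases hj : j = i₁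
          · exact hu₁ l j (by simp [hl₁, hj])
          · rw [hu₂ l j (by simp [hl₁, hj]), if_neg hl]
        rw [this, mul_zero]
    · simp
  rw [Units.val_mul, Units.val_mul, ← Matrix.mul_assoc, ← Matrix.mul_assoc, hY,
    Matrix.mul_assoc, Units.mul_inv, Matrix.mul_one]

theorem sum_out_mul_eq {G M : Type*} [Group G] [AddCommMonoid M] (H : Subgroup G)
    [Fintype (G ⧸ H)] (F : G → M) (hF : ∀ g, ∀ h ∈ H, F (g * h) = F g) (u : G) :
    ∑ q : G ⧸ H, F (u * q.out) = ∑ q : G ⧸ H, F q.out := by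
  refine Fintype.sum_equiv (MulAction.toPerm u) _ _ fun q => ?_
  have hq : MulAction.toPerm u q = ((u * q.out : G) : G ⧸ H) := by
    conv_lhs => rw [← QuotientGroup.out_eq' q]
    rfl
  obtain ⟨h, hh⟩ := QuotientGroup.mk_out_eq_mul H (u * q.out)
  rw [hq, hh, hF _ _ h.2]

theorem sum_eq_sum_out_mul {G G₀ M : Type*} [Group G] [Group G₀] [AddCommMonoid M]
    (ι : G₀ →* G) (hι : Function.Injective ι) [Fintype G] [Fintype G₀] [Fintype (G ⧸ ι.range)]
    (F : G → M) : ∑ g, F g = ∑ q : G ⧸ ι.range, ∑ h : G₀, F (q.out * ι h) := by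
  rw [← Fintype.sum_prod_type' (f := fun (q : G ⧸ ι.range) (h : G₀) => F (q.out * ι h))]
  symm
  refine Fintype.sum_bijective (fun x : (G ⧸ ι.range) × G₀ => x.1.out * ι x.2) ⟨?_, ?_⟩ _ _
    fun _ => rfl
  · rintro ⟨q, h⟩ ⟨q', h'⟩ heq
    have hmk : ∀ (q : G ⧸ ι.range) h, ((q.out * ι h : G) : G ⧸ ι.range) = q := fun q h => by
      rw [QuotientGroup.mk_mul_of_mem _ (MonoidHom.mem_range.mpr ⟨h, rfl⟩), QuotientGroup.out_eq']
    have hq : q = q' := by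
      rw [← hmk q h, ← hmk q' h']
      exact congrArg _ heq
    subst hq
    exact Prod.ext rfl (hι (mul_left_cancel heq))
  · intro g
    obtain ⟨⟨_, h, rfl⟩, hh⟩ := QuotientGroup.mk_out_eq_mul ι.range g
    refine ⟨((g : G ⧸ ι.range), h⁻¹), ?_⟩
    simp only [hh, map_inv, mul_inv_cancel_right]

omit [Fintype k₀] [Fintype k] [DecidableEq k] in
theorem glMap_injective (n : ℕ) : Function.Injective (glMap (k₀ := k₀) (k := k) n) :=
  Units.map_injective (Matrix.map_injective (algebraMap k₀ k).injective)

omit [Fintype k₀] [Fintype k] [DecidableEq k] in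
theorem coe_glMap (h : GL (Fin n) k₀) :
    ((glMap n h : GL (Fin n) k) : Matrix (Fin n) (Fin n) k) =
      (h : Matrix (Fin n) (Fin n) k₀).map (algebraMap k₀ k) := rfl

/-- For `𝒌/𝒌₀` quadratic and `ψ` nontrivial on `𝒌`, trivial on `𝒌₀`, the orthogonal of `𝒌₀`
is `𝒌₀`. -/
theorem mem_range_of_forall_psi_eq_one (hquad : Module.finrank k₀ k = 2) {ψ : AddChar k R}
    (hψ : ∃ x, ψ x ≠ 1) (hψtriv : ∀ x : k₀, ψ (algebraMap k₀ k x) = 1) {x : k}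
    (hx : ∀ t : k₀, ψ (x * algebraMap k₀ k t) = 1) : x ∈ Set.range (algebraMap k₀ k) := by
  by_contra hx₀
  have hli : LinearIndependent k₀ ![1, x] := by
    rw [LinearIndependent.pair_iff' one_ne_zero]
    intro a ha
    exact hx₀ ⟨a, by rw [← ha, Algebra.smul_def, mul_one]⟩
  have hspan := hli.span_eq_top_of_card_eq_finrank' (by simp [hquad])
  obtain ⟨y, hy⟩ := hψ
  have hmem : y ∈ Submodule.span k₀ (Set.range ![1, x]) := hspan ▸ Submodule.mem_top
  rw [Matrix.range_cons, Matrix.range_cons, Matrix.range_empty, Set.union_empty,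
    Set.singleton_union, Submodule.mem_span_pair] at hmem
  obtain ⟨a, b, rfl⟩ := hmem
  apply hy
  rw [AddChar.map_add_eq_mul, Algebra.smul_def, mul_one, hψtriv, Algebra.smul_def, mul_comm _ x,
    hx, one_mul]

omit [Fintype k₀] [Fintype k] [DecidableEq k] in
theorem mem_range_glMap {b : GL (Fin n) k}
    (hb : ∀ i j, (b : Matrix (Fin n) (Fin n) k) i j ∈ Set.range (algebraMap k₀ k)) :
    b ∈ (glMap (k₀ := k₀) (k := k) n).range := by
  choose B hB using hb
  have hBb : (Matrix.of B).map (algebraMap k₀ k) = b := by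
    ext i j
    exact hB i j
  have hdet : (Matrix.of B).det ≠ 0 := by
    intro h0
    apply Matrix.GeneralLinearGroup.det_ne_zero b
    rw [← hBb, ← RingHom.mapMatrix_apply, ← RingHom.map_det, h0, map_zero]
  exact ⟨Matrix.GeneralLinearGroup.mkOfDetNeZero _ hdet, Units.ext hBb⟩

/-- Orthogonality: `M_n(𝒌₀)` is its own orthogonal for the pairing `ψ(trace(ab))`. -/
theorem sum_psi_trace_mul_map (hquad : Module.finrank k₀ k = 2) {ψ : AddChar k R}
    (hψ : ∃ x, ψ x ≠ 1) (hψtriv : ∀ x : k₀, ψ (algebraMap k₀ k x) = 1)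
    (b : GL (Fin n) k) [Decidable (b ∈ (glMap (k₀ := k₀) (k := k) n).range)] :
    ∑ X : Matrix (Fin n) (Fin n) k₀,
        ψ (trace ((b : Matrix (Fin n) (Fin n) k) * X.map (algebraMap k₀ k))) =
      if b ∈ (glMap (k₀ := k₀) (k := k) n).range then (Fintype.card k₀ : R) ^ (n ^ 2) else 0 := by
  classical
  let χ : AddChar (Matrix (Fin n) (Fin n) k₀) R :=
    { toFun := fun X => ψ (trace ((b : Matrix (Fin n) (Fin n) k) * X.map (algebraMap k₀ k)))
      map_zero_eq_one' := by simp
      map_add_eq_mul' := fun X Y => by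
        rw [← AddChar.map_add_eq_mul, ← trace_add, ← Matrix.mul_add,
          Matrix.map_add _ (map_add _)] }
  have hχ : χ = 0 ↔ b ∈ (glMap (k₀ := k₀) (k := k) n).range := by
    constructor
    · intro h
      refine mem_range_glMap fun i j => mem_range_of_forall_psi_eq_one hquad hψ hψtriv fun t => ?_
      have h1 : χ (Matrix.single j i t) = 1 := by rw [h]; rfl
      have h2 : χ (Matrix.single j i t) = ψ (trace ((b : Matrix (Fin n) (Fin n) k) *
        (Matrix.single j i t).map (algebraMap k₀ k))) := rfl
      rwa [h2, Matrix.map_single, Matrix.trace_mul_single] at h1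
    · rintro ⟨h, rfl⟩
      refine DFunLike.ext _ _ fun X => ?_
      change ψ (trace (((glMap n h : GL (Fin n) k) : Matrix (Fin n) (Fin n) k) * X.map (algebraMap k₀ k))) = 1
      rw [coe_glMap, ← Matrix.map_mul, ← hψtriv (trace (h.1 * X))]
      exact congrArg ψ (AddMonoidHom.map_trace (algebraMap k₀ k) _).symm
  have hcard : Fintype.card (Matrix (Fin n) (Fin n) k₀) = Fintype.card k₀ ^ (n ^ 2) := by
    rw [← Nat.card_eq_fintype_card, ← Nat.card_eq_fintype_card, Matrix, Nat.card_fun, Nat.card_fun,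
      Nat.card_fin, ← pow_mul, sq]
  change ∑ X, χ X = _
  rw [AddChar.sum_eq_ite, hcard, Nat.cast_pow]
  simp only [hχ]

omit [Fintype k] [DecidableEq k] in
theorem cast_card_ne_zero (hchar : ringChar R ≠ ringChar k) : (Fintype.card k₀ : R) ≠ 0 := by
  obtain ⟨m, hp, hm⟩ := FiniteField.card k₀ (ringChar k₀)
  have hkk : ringChar k₀ = ringChar k := Algebra.ringChar_eq k₀ k
  rw [hm, Nat.cast_pow]
  refine pow_ne_zero _ fun h0 => hchar ?_
  rw [← hkk]
  exact ((Nat.dvd_prime hp).mp ((ringChar.spec R _).mp h0)).resolve_left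
    (CharP.ringChar_ne_one)

omit [Fintype k₀] in
theorem ker_mulVecLin_unit_mul (h : GL (Fin n) k₀) (X : Matrix (Fin n) (Fin n) k₀) :
    LinearMap.ker (((h : Matrix (Fin n) (Fin n) k₀) * X).mulVecLin) =
      LinearMap.ker X.mulVecLin := by
  ext v
  rw [LinearMap.mem_ker, LinearMap.mem_ker, Matrix.mulVecLin_apply, Matrix.mulVecLin_apply,
    ← Matrix.mulVec_mulVec]
  refine ⟨fun h0 => ?_, fun h0 => by rw [h0, Matrix.mulVec_zero]⟩
  have := congrArg ((h⁻¹ : GL (Fin n) k₀) : Matrix (Fin n) (Fin n) k₀).mulVec h0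
  simpa [Matrix.mulVec_mulVec] using this

/-- The Gauss sum of a distinguished cuspidal representation, evaluated on an invariant linear
form. -/
theorem sum_psi_trace_mul_distinguished (hn : 2 ≤ n) (hquad : Module.finrank k₀ k = 2)
    {π : Representation R (GL (Fin n) k) V} (hcusp : IsCuspidal π) {Λ : Module.Dual R V}
    (hΛ : ∀ (h : GL (Fin n) k₀) (v : V), Λ (π (glMap n h) v) = Λ v) {ψ : AddChar k R}
    (hψ : ∃ x, ψ x ≠ 1) (hψtriv : ∀ x : k₀, ψ (algebraMap k₀ k x) = 1) (v : V) :
    ∑ b : GL (Fin n) k, ψ (trace (b : Matrix (Fin n) (Fin n) k)) * Λ (π b⁻¹ v) =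
      (Fintype.card k₀ : R) ^ (n ^ 2) * Λ v := by
  classical
  let ι := glMap (k₀ := k₀) (k := k) n
  let E : Submodule k₀ (Fin n → k₀) → GL (Fin n) k → R := fun W b =>
    ∑ X : Matrix (Fin n) (Fin n) k₀ with LinearMap.ker X.mulVecLin = W,
      ψ (trace ((b : Matrix (Fin n) (Fin n) k) * X.map (algebraMap k₀ k)))
  have : Fintype (Submodule k₀ (Fin n → k₀)) := Fintype.ofFinite _
  have hΛ' : ∀ (g : GL (Fin n) k) (h : GL (Fin n) k₀) (x : V),
      Λ (π (g * ι h)⁻¹ x) = Λ (π g⁻¹ x) := fun g h x => by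
    rw [_root_.mul_inv_rev, map_mul, Module.End.mul_apply, ← map_inv]
    exact hΛ _ _
  have hE : ∀ W b (h : GL (Fin n) k₀), E W (b * ι h) = E W b := fun W b h => by
    refine Finset.sum_equiv (Units.mulLeft h) (fun X => ?_) fun X _ => ?_
    · simp only [Finset.mem_filter, Finset.mem_univ, true_and, Units.mulLeft_apply, ker_mulVecLin_unit_mul]
    · rw [Units.mulLeft_apply, Matrix.map_mul, Units.val_mul, Matrix.mul_assoc]
      rfl
  have hbot : ∀ b, ∑ h : GL (Fin n) k₀, ψ (trace ((b * ι h : GL (Fin n) k) :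
      Matrix (Fin n) (Fin n) k)) = E ⊥ b := fun b => by
    simp only [E]
    rw [Finset.sum_filter]
    refine Fintype.sum_of_injective Units.val Units.val_injective _ _ (fun X hX => if_neg ?_)
      fun h => ?_
    · rw [LinearMap.ker_eq_bot, Matrix.coe_mulVecLin, Matrix.mulVec_injective_iff_isUnit]
      exact hX
    · rw [if_pos]
      · rfl
      · rw [LinearMap.ker_eq_bot, Matrix.coe_mulVecLin, Matrix.mulVec_injective_iff_isUnit]
        exact h.isUnit
  have hzero : ∀ W, W ≠ ⊥ →
      ∑ q : GL (Fin n) k ⧸ ι.range, E W q.out * Λ (π (q.out)⁻¹ v) = 0 := fun W hW => by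
    obtain ⟨w, hwW, hw⟩ := Submodule.exists_mem_ne_zero_of_ne_bot hW
    let A : V →ₗ[R] R := ∑ q : GL (Fin n) k ⧸ ι.range, E W q.out • (Λ ∘ₗ π (q.out)⁻¹)
    have hA : ∀ x, A x = ∑ q : GL (Fin n) k ⧸ ι.range, E W q.out * Λ (π (q.out)⁻¹ x) := by
      intro x
      simp [A, LinearMap.sum_apply]
    have hw' : (algebraMap k₀ k) ∘ w ≠ 0 := by
      intro h0
      refine hw (funext fun i => (algebraMap k₀ k).injective ?_)
      simpa using congrFun h0 i
    rw [← hA, hcusp.eq_zero_of_invariant hn hw' A, LinearMap.zero_apply]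
    intro u hu x
    rw [hA, hA, ← sum_out_mul_eq ι.range (fun g => E W g * Λ (π g⁻¹ (π u x))) _ u]
    · refine Finset.sum_congr rfl fun q _ => ?_
      rw [← Module.End.mul_apply, ← map_mul, _root_.mul_inv_rev, inv_mul_cancel_right]
      congr 1
      refine Finset.sum_congr rfl fun X hX => ?_
      have hXw : X.map (algebraMap k₀ k) *ᵥ ((algebraMap k₀ k) ∘ w) = 0 := by
        have h0 : X *ᵥ w = 0 := by
          rw [← (Finset.mem_filter.mp hX).2] at hwW
          exact hwW
        ext i
        rw [← RingHom.map_mulVec, h0]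
        simp
      rw [Units.val_mul, Matrix.mul_assoc, Matrix.trace_mul_comm, Matrix.mul_assoc, hu _ hXw]
    · rintro g _ ⟨h, rfl⟩
      rw [hΛ', hE]
  have hmk : ∀ q : GL (Fin n) k ⧸ ι.range, q.out ∈ ι.range ↔ q = ((1 : GL (Fin n) k) : _) := by
    intro q
    conv_rhs => rw [← QuotientGroup.out_eq' q]
    rw [QuotientGroup.eq, mul_one, inv_mem_iff]
  calc ∑ b : GL (Fin n) k, ψ (trace (b : Matrix (Fin n) (Fin n) k)) * Λ (π b⁻¹ v)
      = ∑ q : GL (Fin n) k ⧸ ι.range, E ⊥ q.out * Λ (π (q.out)⁻¹ v) := by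
        rw [sum_eq_sum_out_mul ι (glMap_injective n)]
        refine Finset.sum_congr rfl fun q _ => ?_
        rw [← hbot, Finset.sum_mul]
        exact Finset.sum_congr rfl fun h _ => by rw [hΛ']
    _ = ∑ W, ∑ q : GL (Fin n) k ⧸ ι.range, E W q.out * Λ (π (q.out)⁻¹ v) :=
        (Fintype.sum_eq_single ⊥ hzero).symm
    _ = ∑ q : GL (Fin n) k ⧸ ι.range, (if q.out ∈ ι.range then
          (Fintype.card k₀ : R) ^ (n ^ 2) else 0) * Λ (π (q.out)⁻¹ v) := by
        rw [Finset.sum_comm]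
        refine Finset.sum_congr rfl fun q _ => ?_
        rw [← Finset.sum_mul, ← sum_psi_trace_mul_map hquad hψ hψtriv]
        simp only [E]
        rw [Finset.sum_fiberwise]
    _ = (Fintype.card k₀ : R) ^ (n ^ 2) * Λ v := by
        rw [Fintype.sum_eq_single ((1 : GL (Fin n) k) : GL (Fin n) k ⧸ ι.range)
          fun q hq => by rw [if_neg (mt (hmk q).mp hq), zero_mul]]
        obtain ⟨h, hh⟩ := (hmk _).mpr rfl
        rw [if_pos ((hmk _).mpr rfl), ← hh, ← one_mul (ι h), hΛ', inv_one, map_one,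
          Module.End.one_apply]

/-- The sum `Σ_a ψ(trace(g a)) π(a⁻¹)` vanishes for singular `g`. -/
theorem sum_psi_trace_mul_eq_zero (hn : 2 ≤ n) {π : Representation R (GL (Fin n) k) V}
    (hcusp : IsCuspidal π) (ψ : AddChar k R) {g : Matrix (Fin n) (Fin n) k} (hg : ¬ IsUnit g) :
    ∑ a : GL (Fin n) k, ψ (trace (g * (a : Matrix (Fin n) (Fin n) k))) • π a⁻¹ = 0 := by
  rw [Matrix.isUnit_iff_isUnit_det, isUnit_iff_ne_zero, not_not,
    ← Matrix.exists_mulVec_eq_zero_iff] at hg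
  obtain ⟨w, hw, hgw⟩ := hg
  refine hcusp.eq_zero_of_invariant hn hw _ fun u hu v => ?_
  have hgu : g * ((u⁻¹ : GL (Fin n) k) : Matrix (Fin n) (Fin n) k) = g := by
    rw [Units.mul_inv_eq_iff_eq_mul, hu g hgw]
  simp only [LinearMap.sum_apply, LinearMap.smul_apply]
  refine Fintype.sum_equiv (Equiv.mulLeft u⁻¹) _ _ fun a => ?_
  rw [Equiv.coe_mulLeft, _root_.mul_inv_rev, inv_inv, map_mul, Module.End.mul_apply, Units.val_mul,
    ← Matrix.mul_assoc, hgu]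

theorem sum_psi_trace_mul_unit (π : Representation R (GL (Fin n) k) V) (ψ : AddChar k R)
    (g : GL (Fin n) k) :
    ∑ a : GL (Fin n) k, ψ (trace ((g : Matrix (Fin n) (Fin n) k) *
        (a : Matrix (Fin n) (Fin n) k))) • π a⁻¹ =
      (∑ b : GL (Fin n) k, ψ (trace (b : Matrix (Fin n) (Fin n) k)) • π b⁻¹) ∘ₗ π g := by
  refine LinearMap.ext fun v => ?_
  simp only [LinearMap.sum_apply, LinearMap.smul_apply, LinearMap.comp_apply]
  refine Fintype.sum_equiv (Equiv.mulLeft g) _ _ fun a => ?_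
  rw [Equiv.coe_mulLeft, _root_.mul_inv_rev, ← Module.End.mul_apply, ← map_mul, inv_mul_cancel_right,
    Units.val_mul]

theorem sum_psi_trace_comm (π : Representation R (GL (Fin n) k) V) (ψ : AddChar k R)
    (g : GL (Fin n) k) :
    (∑ b : GL (Fin n) k, ψ (trace (b : Matrix (Fin n) (Fin n) k)) • π b⁻¹) ∘ₗ π g =
      π g ∘ₗ ∑ b : GL (Fin n) k, ψ (trace (b : Matrix (Fin n) (Fin n) k)) • π b⁻¹ := by
  refine LinearMap.ext fun v => ?_
  simp only [LinearMap.sum_apply, LinearMap.smul_apply, LinearMap.comp_apply, map_sum, map_smul]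
  refine Fintype.sum_equiv (MulAut.conj g⁻¹).toEquiv _ _ fun a => ?_
  have htr : trace (((MulAut.conj g⁻¹ a : GL (Fin n) k)) : Matrix (Fin n) (Fin n) k) =
      trace (a : Matrix (Fin n) (Fin n) k) := by
    rw [MulAut.conj_apply, Units.val_mul, Matrix.trace_mul_comm, ← Units.val_mul]
    simp
  change _ = ψ (trace (((MulAut.conj g⁻¹ a : GL (Fin n) k)) : Matrix (Fin n) (Fin n) k)) •
    π g (π (MulAut.conj g⁻¹ a)⁻¹ v)
  rw [htr, ← Module.End.mul_apply, ← map_mul, ← Module.End.mul_apply, ← map_mul,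
    MulAut.conj_apply]
  congr 3
  simp [_root_.mul_inv_rev, mul_assoc]

/-- **Triviality of the Galois gamma factor for a character trivial on the base field.**
For `𝒌/𝒌₀` quadratic of odd characteristic, `π` an absolutely irreducible cuspidal
representation of `GL_n(𝒌)` distinguished by `GL_n(𝒌₀)`, and `ψ` a nontrivial additive
character of `𝒌` which is trivial on `𝒌₀`, the Godement–Jacquet gamma factor is `1`:
`Z(F_ψΦ, (f_{v,v^∨})^∨) = Z(Φ, f_{v,v^∨})`, the Fourier transform being normalized by
`q₀^{-n²}`. -/
theorem galois_gamma_trivial (hn : 2 ≤ n)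
    (hquad : Module.finrank k₀ k = 2) (hodd : ringChar k ≠ 2)
    (hchar : ringChar R ≠ ringChar k)
    (π : Representation R (GL (Fin n) k) V)
    (hV : ∃ v : V, v ≠ 0)
    (hirr : ∀ W : Submodule R V, (∀ (g : GL (Fin n) k), ∀ v ∈ W, π g v ∈ W) →
      W = ⊥ ∨ W = ⊤)
    (hschur : ∀ φ : V →ₗ[R] V, (∀ g : GL (Fin n) k, φ ∘ₗ π g = π g ∘ₗ φ) →
      ∃ c : R, φ = c • LinearMap.id)
    (hcusp : IsCuspidal π)
    (hdist : ∃ Λ : Module.Dual R V, Λ ≠ 0 ∧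
      ∀ (h : GL (Fin n) k₀) (v : V), Λ (π (glMap n h) v) = Λ v)
    (ψ : AddChar k R) (hψ : ∃ x, ψ x ≠ 1)
    (hψtriv : ∀ x : k₀, ψ (algebraMap k₀ k x) = 1)
    (Φ : Matrix (Fin n) (Fin n) k → R) (v : V) (v' : Module.Dual R V) :
    Z (fourier (Ring.inverse ((Fintype.card k₀ : R) ^ (n ^ 2))) ψ Φ)
        (inve (mc π v v'))
      = Z Φ (mc π v v') := by
  obtain ⟨Λ, hΛ0, hΛ⟩ := hdist
  obtain ⟨s, hs⟩ := hschur _ (sum_psi_trace_comm π ψ)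
  have hq : (Fintype.card k₀ : R) ^ (n ^ 2) ≠ 0 := pow_ne_zero _ (cast_card_ne_zero hchar)
  have hsq : s = (Fintype.card k₀ : R) ^ (n ^ 2) := by
    obtain ⟨x, hx⟩ : ∃ x, Λ x ≠ 0 := by
      by_contra! h0
      exact hΛ0 (LinearMap.ext h0)
    have h1 := sum_psi_trace_mul_distinguished hn hquad hcusp hΛ hψ hψtriv x
    have h2 := congrArg (fun T => Λ (T x)) hs
    simp only [LinearMap.sum_apply, LinearMap.smul_apply, map_sum, map_smul, smul_eq_mul,
      LinearMap.id_apply] at h2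
    exact mul_right_cancel₀ hx (h2.symm.trans h1)
  have hT : ∀ g : Matrix (Fin n) (Fin n) k,
      v' ((∑ a : GL (Fin n) k, ψ (trace (g * (a : Matrix (Fin n) (Fin n) k))) • π a⁻¹) v) =
        ∑ a : GL (Fin n) k, ψ (trace (g * (a : Matrix (Fin n) (Fin n) k))) * v' (π a⁻¹ v) := by
    intro g
    simp
  calc Z (fourier (Ring.inverse ((Fintype.card k₀ : R) ^ (n ^ 2))) ψ Φ) (inve (mc π v v'))
      = ∑ g : Matrix (Fin n) (Fin n) k, Ring.inverse ((Fintype.card k₀ : R) ^ (n ^ 2)) *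
          (Φ g * v' ((∑ a : GL (Fin n) k,
            ψ (trace (g * (a : Matrix (Fin n) (Fin n) k))) • π a⁻¹) v)) := by
        simp only [hT, Z, fourier, inve, mc, Finset.mul_sum, Finset.sum_mul]
        rw [Finset.sum_comm]
        refine Finset.sum_congr rfl fun g _ => Finset.sum_congr rfl fun a _ => by ring
    _ = ∑ g : GL (Fin n) k, Φ (g : Matrix (Fin n) (Fin n) k) * mc π v v' g := by
        symm
        refine Fintype.sum_of_injective Units.val Units.val_injective _ _ (fun g hg => ?_)
          fun g => ?_
        · rw [sum_psi_trace_mul_eq_zero hn hcusp ψ hg]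
          simp
        · rw [sum_psi_trace_mul_unit, hs, hsq, Ring.inverse_eq_inv']
          simp only [LinearMap.comp_apply, LinearMap.smul_apply, LinearMap.id_apply, map_smul,
            smul_eq_mul, mc]
          field_simp

end Stmt13
end
end

section
/- Gamma factor of a linearly distinguished cuspidal representation equals the sign of the period: Let 𝒌 be a finite field with q elements of odd characteristic p, n = 2m with m ≥ 1, and R a field of characteristic different from p. Let H = {diag(g1,g2) : g1,g2 ∈ GL_m(𝒌)} ⊆ GL_{2m}(𝒌) and w = the block matrix [[0,1_m],[1_m,0]]. Let (π,V) be an absolutely irreducible cuspidal R-representation of GL_{2m}(𝒌), let Λ : V → R be a nonzero H-invariant linear form, and let χ ∈ R with Λ∘π(w) = χ·Λ. Let ψ : (𝒌,+) → R^× be a nontrivial additive character, set Ψ(a) = ψ(trace(a)), and normalize the Fourier transform by F_ψΦ(a) = q^{-2m²}·Σ_{g∈M_{2m}(𝒌)} Φ(g)Ψ(ga) (note (q^{2m²})² = |M_{2m}(𝒌)|). Then for every Φ : M_{2m}(𝒌) → R, v ∈ V, v^∨ ∈ Hom_R(V,R): Z(F_ψΦ, (f_{v,v^∨})^∨) = χ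 · Z(Φ, f_{v,v^∨}); that is, γ(π,ψ) = χ. -/
open Matrix
noncomputable section

namespace Stmt14

variable {k R V : Type*} [Field k] [Fintype k] [DecidableEq k] [Field R]
  [AddCommGroup V] [Module R V] {m : ℕ}

/-- The Godement–Jacquet sum over `GL_{2m}(𝒌)`. -/
def Z (Φ : Matrix (Fin m ⊕ Fin m) (Fin m ⊕ Fin m) k → R)
    (f : GL (Fin m ⊕ Fin m) k → R) : R :=
  ∑ g : GL (Fin m ⊕ Fin m) k, Φ (g : Matrix (Fin m ⊕ Fin m) (Fin m ⊕ Fin m) k) * f g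

/-- The matrix coefficient `f_{v,v^∨}(g) = v^∨(π(g) v)`. -/
def mc (π : Representation R (GL (Fin m ⊕ Fin m) k) V) (v : V) (v' : Module.Dual R V) :
    GL (Fin m ⊕ Fin m) k → R := fun g => v' (π g v)

/-- `f^∨(g) = f(g⁻¹)`. -/
def inve (f : GL (Fin m ⊕ Fin m) k → R) : GL (Fin m ⊕ Fin m) k → R := fun g => f g⁻¹

/-- The Fourier transform on `M_{2m}(𝒌)` with normalization constant `c`. -/
def fourier (c : R) (ψ : AddChar k R)
    (Φ : Matrix (Fin m ⊕ Fin m) (Fin m ⊕ Fin m) k → R) :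
    Matrix (Fin m ⊕ Fin m) (Fin m ⊕ Fin m) k → R :=
  fun a => c * ∑ g : Matrix (Fin m ⊕ Fin m) (Fin m ⊕ Fin m) k,
    Φ g * ψ (Matrix.trace (g * a))

/-- `u` lies in the unipotent radical of the parabolic subgroup determined by `b`. -/
def UnipCond {ι : Type*} [Fintype ι] [DecidableEq ι] {N : ℕ} (b : ι → Fin N)
    (u : GL ι k) : Prop :=
  (∀ i j, b j < b i → (u : Matrix ι ι k) i j = 0) ∧
  (∀ i j, b i = b j → (u : Matrix ι ι k) i j = if i = j then 1 else 0)

/-- Cuspidality: coinvariants vanish for the unipotent radical of every proper parabolic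
subgroup. -/
def IsCuspidal {ι : Type*} [Fintype ι] [DecidableEq ι]
    (π : Representation R (GL ι k) V) : Prop :=
  ∀ (N : ℕ) (b : ι → Fin N), (∃ i j, b i ≠ b j) → ∀ h : GL ι k,
    Submodule.span R {x : V | ∃ u : GL ι k, UnipCond b u ∧
      ∃ v : V, x = v - π (h * u * h⁻¹) v} = ⊤

/-- The block diagonal element `diag(g₁, g₂) ∈ GL_{2m}(𝒌)`. -/
def blockDiagGL (g₁ g₂ : GL (Fin m) k) : GL (Fin m ⊕ Fin m) k :=
  ⟨Matrix.fromBlocks ↑g₁ 0 0 ↑g₂, Matrix.fromBlocks ↑(g₁⁻¹) 0 0 ↑(g₂⁻¹),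
    by rw [Matrix.fromBlocks_multiply]
       simp only [mul_zero, zero_mul, add_zero, zero_add, ← Units.val_mul,
         mul_inv_cancel, inv_mul_cancel, Units.val_one, Matrix.fromBlocks_one],
    by rw [Matrix.fromBlocks_multiply]
       simp only [mul_zero, zero_mul, add_zero, zero_add, ← Units.val_mul,
         mul_inv_cancel, inv_mul_cancel, Units.val_one, Matrix.fromBlocks_one]⟩

/-- The Weyl element `w = antidiag(1_m, 1_m) ∈ GL_{2m}(𝒌)`. -/
def wAntidiag : GL (Fin m ⊕ Fin m) k :=
  ⟨Matrix.fromBlocks 0 1 1 0, Matrix.fromBlocks 0 1 1 0,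
    by rw [Matrix.fromBlocks_multiply]
       simp [← Matrix.fromBlocks_one],
    by rw [Matrix.fromBlocks_multiply]
       simp [← Matrix.fromBlocks_one]⟩

/-- An elementary form of cuspidality: a linear map invariant under the unipotent radical of the
stabilizer of the line spanned by `κ` vanishes. -/
theorem IsCuspidal.eq_zero_of_invariant {ι W : Type*} [Fintype ι] [DecidableEq ι] [Nontrivial ι]
    [AddCommGroup W] [Module R W] {π : Representation R (GL ι k) V} (hπ : IsCuspidal π)
    {κ : ι → k} (hκ : κ ≠ 0) (S : V →ₗ[R] W)
    (hS : ∀ (u : GL ι k) (θ : ι → k), θ ⬝ᵥ κ = 0 →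
      (u : Matrix ι ι k) = 1 + vecMulVec κ θ → ∀ v, S (π u v) = S v) :
    S = 0 := by
  obtain ⟨i₀, hi₀⟩ := Function.ne_iff.mp hκ
  have hdet : (Matrix.updateCol (1 : Matrix ι ι k) i₀ κ).det ≠ 0 := by
    rw [← Matrix.cramer_apply, Matrix.cramer_one]
    exact hi₀
  let h : GL ι k := Matrix.GeneralLinearGroup.mkOfDetNeZero _ hdet
  have hh : (h : Matrix ι ι k) = Matrix.updateCol (1 : Matrix ι ι k) i₀ κ := rfl
  have hcol : (h : Matrix ι ι k) *ᵥ Pi.single i₀ 1 = κ := by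
    rw [hh, Matrix.mulVec_single_one]
    ext i
    simp
  obtain ⟨j₀, hj₀⟩ := exists_ne i₀
  let b : ι → Fin 2 := fun i => if i = i₀ then 0 else 1
  rw [← LinearMap.ker_eq_top, eq_top_iff, ← hπ 2 b ⟨i₀, j₀, by simp [b, hj₀]⟩ h,
    Submodule.span_le]
  rintro _ ⟨u, ⟨hu₁, hu₂⟩, v, rfl⟩
  have hu : (u : Matrix ι ι k) =
      1 + vecMulVec (Pi.single i₀ 1) ((u : Matrix ι ι k) i₀ - (1 : Matrix ι ι k) i₀) := by
    ext i j
    by_cases hi : i = i₀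
    · subst hi
      simp [vecMulVec_apply]
    · by_cases hj : j = i₀
      · subst hj
        simp [vecMulVec_apply, hi, hu₁ i j (by simp [b, hi])]
      · simp [vecMulVec_apply, hi, hu₂ i j (by simp [b, hi, hj]), Matrix.one_apply]
  have hρ : ((u : Matrix ι ι k) i₀ - (1 : Matrix ι ι k) i₀) i₀ = 0 := by
    simp [hu₂ i₀ i₀ rfl]
  generalize (u : Matrix ι ι k) i₀ - (1 : Matrix ι ι k) i₀ = ρ at hu hρ
  have hhinv : ((h⁻¹ : GL ι k) : Matrix ι ι k) * (h : Matrix ι ι k) = 1 := by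
    rw [← Units.val_mul, inv_mul_cancel, Units.val_one]
  have hhinv' : (h : Matrix ι ι k) * ((h⁻¹ : GL ι k) : Matrix ι ι k) = 1 := by
    rw [← Units.val_mul, mul_inv_cancel, Units.val_one]
  have key := hS (h * u * h⁻¹) (ρ ᵥ* ((h⁻¹ : GL ι k) : Matrix ι ι k))
    (by rw [← hcol, Matrix.dotProduct_mulVec, Matrix.vecMul_vecMul, hhinv, Matrix.vecMul_one]
        simp [hρ])
    (by rw [Units.val_mul, Units.val_mul, hu, mul_add, mul_one, add_mul, hhinv',
          Matrix.mul_vecMulVec, Matrix.vecMulVec_mul, hcol]) v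
  rw [SetLike.mem_coe, LinearMap.mem_ker, map_sub, key, sub_self]

theorem card_cast_ne_zero (hchar : ringChar R ≠ ringChar k) : (Fintype.card k : R) ≠ 0 := by
  obtain ⟨n, hp, hn⟩ := FiniteField.card k (ringChar k)
  intro h
  rw [hn, Nat.cast_pow] at h
  have h1 := (ringChar.spec R (ringChar k)).mp (pow_eq_zero_iff n.ne_zero |>.mp h)
  rcases (Nat.dvd_prime hp).mp h1 with h2 | h2
  · exact CharP.ringChar_ne_one h2
  · exact hchar h2

/-- A function on matrices vanishing off the invertible ones has the same sum over `GL`. -/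
theorem sum_GL_eq_sum {ι M : Type*} [Fintype ι] [DecidableEq ι] [AddCommMonoid M]
    (F : Matrix ι ι k → M) (hF : ∀ s, ¬ IsUnit s → F s = 0) :
    ∑ s : GL ι k, F s = ∑ s, F s :=
  Fintype.sum_of_injective _ Units.val_injective _ _ (fun s hs => hF s fun ⟨u, hu⟩ => hs ⟨u, hu⟩)
    fun _ => rfl

theorem card_matrix (ι : Type*) [Fintype ι] [DecidableEq ι] :
    Fintype.card (Matrix ι ι k) = Fintype.card k ^ (Fintype.card ι ^ 2) := by
  change Fintype.card (ι → ι → k) = _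
  rw [Fintype.card_fun, Fintype.card_fun, ← pow_mul, sq]

theorem trace_fromBlocks_eq_add (A B C D : Matrix (Fin m) (Fin m) k) :
    trace (Matrix.fromBlocks A B C D) = trace A + trace D := by
  simp [trace, Fintype.sum_sum_type]

theorem sum_trace_mul {ι : Type*} [Fintype ι] [DecidableEq ι] {ψ : AddChar k R}
    (hψ : ∃ x, ψ x ≠ 1) (y : Matrix ι ι k) :
    ∑ s : Matrix ι ι k, ψ (trace (y * s)) =
      if y = 0 then (Fintype.card k : R) ^ (Fintype.card ι ^ 2) else 0 := by
  split_ifs with hy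
  · simp [hy, card_matrix]
  · obtain ⟨x, hx⟩ := hψ
    obtain ⟨i, j, hij⟩ : ∃ i j, y i j ≠ 0 := by
      by_contra! h
      exact hy (Matrix.ext h)
    have h0 : ψ (trace (y * Matrix.single j i ((y i j)⁻¹ * x))) ≠ 1 := by
      rw [Matrix.trace_mul_single]
      simpa [hij] using hx
    have h1 := Fintype.sum_equiv (Equiv.addLeft (Matrix.single j i ((y i j)⁻¹ * x)))
      (fun s => ψ (trace (y * (Matrix.single j i ((y i j)⁻¹ * x) + s))))
      (fun s => ψ (trace (y * s))) (fun _ => rfl)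
    simp only [mul_add, trace_add, AddChar.map_add_eq_mul] at h1
    rw [← Finset.mul_sum] at h1
    by_contra h2
    exact h0 (mul_right_cancel₀ h2 (by rw [h1, one_mul]))

/-- The block unipotent element with upper right block `y`. -/
def upperUnip (y : Matrix (Fin m) (Fin m) k) : GL (Fin m ⊕ Fin m) k :=
  ⟨Matrix.fromBlocks 1 y 0 1, Matrix.fromBlocks 1 (-y) 0 1,
    by simp [Matrix.fromBlocks_multiply], by simp [Matrix.fromBlocks_multiply]⟩

@[simp] theorem upperUnip_val (y : Matrix (Fin m) (Fin m) k) :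
    (upperUnip y : Matrix (Fin m ⊕ Fin m) (Fin m ⊕ Fin m) k) = Matrix.fromBlocks 1 y 0 1 := rfl

theorem upperUnip_zero : upperUnip (0 : Matrix (Fin m) (Fin m) k) = 1 :=
  Units.ext (by simp)

theorem upperUnip_inv (y : Matrix (Fin m) (Fin m) k) : (upperUnip y)⁻¹ = upperUnip (-y) :=
  Units.ext rfl

@[simp] theorem blockDiagGL_val (g₁ g₂ : GL (Fin m) k) :
    (blockDiagGL g₁ g₂ : Matrix (Fin m ⊕ Fin m) (Fin m ⊕ Fin m) k) =
      Matrix.fromBlocks ↑g₁ 0 0 ↑g₂ := rfl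

@[simp] theorem wAntidiag_val :
    ((wAntidiag : GL (Fin m ⊕ Fin m) k) : Matrix (Fin m ⊕ Fin m) (Fin m ⊕ Fin m) k) =
      Matrix.fromBlocks 0 1 1 0 := rfl

theorem wAntidiag_inv : (wAntidiag : GL (Fin m ⊕ Fin m) k)⁻¹ = wAntidiag :=
  Units.ext rfl

theorem upperUnip_mul_blockDiagGL_inv (y : Matrix (Fin m) (Fin m) k) (g₁ g₂ : GL (Fin m) k) :
    upperUnip y * (blockDiagGL g₁ g₂)⁻¹ =
      (blockDiagGL g₁ g₂)⁻¹ * upperUnip (g₁.val * y * (g₂⁻¹ : GL (Fin m) k).val) := by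
  rw [eq_inv_mul_iff_mul_eq, ← mul_assoc, mul_inv_eq_iff_eq_mul]
  exact Units.ext (by simp [Matrix.fromBlocks_multiply, mul_assoc])

/-- The Fourier coefficients at singular matrices of an `H`-invariant form along the block
unipotent group vanish. -/
theorem sum_upperUnip_eq_zero {π : Representation R (GL (Fin m ⊕ Fin m) k) V} (hm : 1 ≤ m)
    (hcusp : IsCuspidal π) (Λ : Module.Dual R V)
    (hinv : ∀ (g₁ g₂ : GL (Fin m) k) (v : V), Λ (π (blockDiagGL g₁ g₂) v) = Λ v)
    (ψ : AddChar k R) {z : Matrix (Fin m) (Fin m) k} (hz : ¬ IsUnit z) (v : V) :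
    ∑ x : Matrix (Fin m) (Fin m) k, ψ (trace (x * z)) * Λ (π (upperUnip (-x)) v) = 0 := by
  have hz0 : z.det = 0 := by
    by_contra h
    exact hz ((Matrix.isUnit_iff_isUnit_det z).mpr (isUnit_iff_ne_zero.mpr h))
  obtain ⟨κ, hκ, hzκ⟩ := Matrix.exists_mulVec_eq_zero_iff.mpr hz0
  have : Nontrivial (Fin m ⊕ Fin m) :=
    ⟨Sum.inl ⟨0, hm⟩, Sum.inr ⟨0, hm⟩, Sum.inl_ne_inr⟩
  let S : V →ₗ[R] R :=
    ∑ x : Matrix (Fin m) (Fin m) k, ψ (trace (x * z)) • (Λ ∘ₗ π (upperUnip (-x)))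
  have hSv : ∀ v, S v =
      ∑ x : Matrix (Fin m) (Fin m) k, ψ (trace (x * z)) * Λ (π (upperUnip (-x)) v) := by
    intro v
    simp [S, LinearMap.sum_apply]
  have hκ' : (Sum.elim κ 0 : Fin m ⊕ Fin m → k) ≠ 0 := by
    intro h
    exact hκ (funext fun i => congrFun h (Sum.inl i))
  have hS0 : S = 0 := by
    refine hcusp.eq_zero_of_invariant hκ' S fun u θ hθ hu v => ?_
    rw [hSv, hSv]
    set θ₁ : Fin m → k := fun i => θ (Sum.inl i)
    set θ₂ : Fin m → k := fun i => θ (Sum.inr i)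
    have hθ₁ : θ₁ ⬝ᵥ κ = 0 := by
      simpa [dotProduct, Fintype.sum_sum_type] using hθ
    have hsq : vecMulVec κ θ₁ * vecMulVec κ θ₁ = 0 := by
      rw [Matrix.vecMulVec_mul_vecMulVec, hθ₁]
      simp
    let h : GL (Fin m) k := ⟨1 + vecMulVec κ θ₁, 1 - vecMulVec κ θ₁,
      by rw [mul_sub, add_mul _ _ (vecMulVec κ θ₁), hsq]; simp,
      by rw [mul_add, sub_mul _ _ (vecMulVec κ θ₁), hsq]; simp⟩
    have hh : (h : Matrix (Fin m) (Fin m) k) = 1 + vecMulVec κ θ₁ := rfl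
    have hzh : z * (h : Matrix (Fin m) (Fin m) k) = z := by
      rw [hh, mul_add, Matrix.mul_vecMulVec, hzκ]
      simp
    have hu' : (u : Matrix (Fin m ⊕ Fin m) (Fin m ⊕ Fin m) k) =
        Matrix.fromBlocks h (vecMulVec κ θ₂) 0 1 := by
      rw [hu, hh]
      ext (i | i) (j | j) <;> simp [vecMulVec_apply, Matrix.one_apply, θ₁, θ₂]
    have hmul : ∀ x : Matrix (Fin m) (Fin m) k,
        upperUnip (-((h : Matrix (Fin m) (Fin m) k) * x + vecMulVec κ θ₂)) * u =
          blockDiagGL h 1 * upperUnip (-x) := by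
      intro x
      refine Units.ext ?_
      rw [Units.val_mul, hu']
      simp [Matrix.fromBlocks_multiply]
    symm
    refine Fintype.sum_equiv ((Units.mulLeft h).trans (Equiv.addRight (vecMulVec κ θ₂))) _ _
      fun x => ?_
    have h1 : trace (((h : Matrix (Fin m) (Fin m) k) * x + vecMulVec κ θ₂) * z) =
        trace (x * z) := by
      rw [add_mul, trace_add, mul_assoc, trace_mul_comm, mul_assoc, hzh,
        trace_mul_comm x, trace_mul_comm (vecMulVec κ θ₂),
        Matrix.mul_vecMulVec, hzκ]
      simp
    change _ = ψ (trace (((h : Matrix (Fin m) (Fin m) k) * x + vecMulVec κ θ₂) * z)) *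
      Λ (π (upperUnip (-((h : Matrix (Fin m) (Fin m) k) * x + vecMulVec κ θ₂))) (π u v))
    rw [h1, ← Module.End.mul_apply, ← map_mul, hmul, map_mul, Module.End.mul_apply, hinv]
  rw [← hSv, hS0, LinearMap.zero_apply]

/-- Fourier inversion along the block unipotent group, only invertible frequencies
contributing. -/
theorem sum_GL_sum_upperUnip {π : Representation R (GL (Fin m ⊕ Fin m) k) V} (hm : 1 ≤ m)
    (hcusp : IsCuspidal π) (Λ : Module.Dual R V)
    (hinv : ∀ (g₁ g₂ : GL (Fin m) k) (v : V), Λ (π (blockDiagGL g₁ g₂) v) = Λ v)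
    {ψ : AddChar k R} (hψ : ∃ x, ψ x ≠ 1) (v : V) :
    ∑ s : GL (Fin m) k, ∑ x : Matrix (Fin m) (Fin m) k,
      ψ (trace (x * (s : Matrix (Fin m) (Fin m) k))) * Λ (π (upperUnip (-x)) v) =
      (Fintype.card k : R) ^ (m ^ 2) * Λ v := by
  rw [sum_GL_eq_sum (fun s => ∑ x : Matrix (Fin m) (Fin m) k,
      ψ (trace (x * s)) * Λ (π (upperUnip (-x)) v))
      fun s hs => sum_upperUnip_eq_zero hm hcusp Λ hinv ψ hs v,
    Finset.sum_comm]
  simp_rw [← Finset.sum_mul, sum_trace_mul hψ]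
  simp [upperUnip_zero]

theorem sum_isUnit_toBlocks₂₁ {M : Type*} [AddCommMonoid M]
    (X : GL (Fin m ⊕ Fin m) k → M)
    (hX : ∀ a : GL (Fin m ⊕ Fin m) k, ¬ IsUnit (toBlocks₂₁ a.val) → X a = 0) :
    ∑ p : (Matrix (Fin m) (Fin m) k × GL (Fin m) k) × GL (Fin m) k × Matrix (Fin m) (Fin m) k,
      X (upperUnip p.1.1 * wAntidiag * blockDiagGL p.1.2 p.2.1 * upperUnip p.2.2) =
    ∑ a, X a := by
  have hval : ∀ (x y : Matrix (Fin m) (Fin m) k) (z s : GL (Fin m) k),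
      ((upperUnip x * wAntidiag * blockDiagGL z s * upperUnip y : GL (Fin m ⊕ Fin m) k) :
        Matrix (Fin m ⊕ Fin m) (Fin m ⊕ Fin m) k) =
      Matrix.fromBlocks (x * z.val) (x * z.val * y + s.val) z.val (z.val * y) := by
    intro x y z s
    simp [Matrix.fromBlocks_multiply]
  refine Fintype.sum_of_injective
    (fun p : (Matrix (Fin m) (Fin m) k × GL (Fin m) k) × GL (Fin m) k × Matrix (Fin m) (Fin m) k =>
      upperUnip p.1.1 * wAntidiag * blockDiagGL p.1.2 p.2.1 * upperUnip p.2.2) ?_ _ _ ?_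
    fun _ => rfl
  · rintro ⟨⟨x, z⟩, s, y⟩ ⟨⟨x', z'⟩, s', y'⟩ h
    have h' := congrArg Units.val h
    simp only [hval] at h'
    rw [Matrix.fromBlocks_inj] at h'
    obtain ⟨h1, h2, h3, h4⟩ := h'
    obtain rfl := Units.ext h3
    obtain rfl := (Units.mul_left_inj z).mp h1
    obtain rfl := (Units.mul_right_inj z).mp h4
    obtain rfl := Units.ext (add_left_cancel h2)
    rfl
  · intro a ha
    refine hX a fun ⟨z, hz⟩ => ha ?_
    set A := (a : Matrix (Fin m ⊕ Fin m) (Fin m ⊕ Fin m) k) with hA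
    have hblocks : A = Matrix.fromBlocks A.toBlocks₁₁ A.toBlocks₁₂ z A.toBlocks₂₂ := by
      rw [hz, Matrix.fromBlocks_toBlocks]
    generalize A.toBlocks₁₁ = x at hblocks
    generalize A.toBlocks₁₂ = y at hblocks
    generalize A.toBlocks₂₂ = t at hblocks
    have hs : IsUnit (y - x * (z⁻¹ : GL (Fin m) k).val * t) := by
      have h1 : ((wAntidiag * upperUnip (-(x * (z⁻¹ : GL (Fin m) k).val)) * a :
          GL (Fin m ⊕ Fin m) k) : Matrix (Fin m ⊕ Fin m) (Fin m ⊕ Fin m) k) =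
          Matrix.fromBlocks z t 0 (y - x * (z⁻¹ : GL (Fin m) k).val * t) := by
        rw [Units.val_mul, ← hA, hblocks]
        simp [Matrix.fromBlocks_multiply, mul_assoc, sub_eq_add_neg, add_comm]
      have h2 := Units.isUnit (wAntidiag * upperUnip (-(x * (z⁻¹ : GL (Fin m) k).val)) * a :
          GL (Fin m ⊕ Fin m) k)
      rw [h1, Matrix.isUnit_fromBlocks_zero₂₁] at h2
      exact h2.2
    obtain ⟨s, hs⟩ := hs
    refine ⟨((x * (z⁻¹ : GL (Fin m) k).val, z), s, (z⁻¹ : GL (Fin m) k).val * t), Units.ext ?_⟩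
    rw [← hA, hblocks, hval, hs]
    simp [mul_assoc]

theorem period_gauss_sum {π : Representation R (GL (Fin m ⊕ Fin m) k) V} (hm : 1 ≤ m)
    (hq : (Fintype.card k : R) ≠ 0) (hcusp : IsCuspidal π) (Λ : Module.Dual R V)
    (hinv : ∀ (g₁ g₂ : GL (Fin m) k) (v : V), Λ (π (blockDiagGL g₁ g₂) v) = Λ v)
    {χ : R} (hχ : ∀ v : V, Λ (π wAntidiag v) = χ * Λ v)
    {ψ : AddChar k R} (hψ : ∃ x, ψ x ≠ 1) (v : V) :
    ∑ a : GL (Fin m ⊕ Fin m) k,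
      ψ (trace (a : Matrix (Fin m ⊕ Fin m) (Fin m ⊕ Fin m) k)) * Λ (π a⁻¹ v) =
      (Fintype.card k : R) ^ (2 * m ^ 2) * χ * Λ v := by
  classical
  set X : GL (Fin m ⊕ Fin m) k → R := fun a =>
    ψ (trace (a : Matrix (Fin m ⊕ Fin m) (Fin m ⊕ Fin m) k)) * Λ (π a⁻¹ v) with hX
  let P : GL (Fin m ⊕ Fin m) k → Prop := fun a =>
    IsUnit (toBlocks₂₁ a.val)
  have hinvd : ∀ (g₁ g₂ : GL (Fin m) k) (v : V), Λ (π (blockDiagGL g₁ g₂)⁻¹ v) = Λ v :=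
    fun g₁ g₂ v => hinv g₁⁻¹ g₂⁻¹ v
  have hblk : ∀ (a : GL (Fin m ⊕ Fin m) k) (y : Matrix (Fin m) (Fin m) k),
      ((a * upperUnip y : GL (Fin m ⊕ Fin m) k) :
        Matrix (Fin m ⊕ Fin m) (Fin m ⊕ Fin m) k) =
      Matrix.fromBlocks a.val.toBlocks₁₁ (a.val.toBlocks₁₁ * y + a.val.toBlocks₁₂)
        a.val.toBlocks₂₁ (a.val.toBlocks₂₁ * y + a.val.toBlocks₂₂) := by
    intro a y
    conv_lhs => rw [Units.val_mul, ← Matrix.fromBlocks_toBlocks a.val]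
    simp [Matrix.fromBlocks_multiply]
  have htr : ∀ (a : GL (Fin m ⊕ Fin m) k) (y : Matrix (Fin m) (Fin m) k),
      trace (a * upperUnip y : GL (Fin m ⊕ Fin m) k).val =
        trace a.val + trace (y * a.val.toBlocks₂₁) := by
    intro a y
    conv_rhs => rw [← Matrix.fromBlocks_toBlocks a.val]
    rw [hblk, trace_fromBlocks_eq_add, trace_fromBlocks_eq_add, trace_add, trace_mul_comm]
    simp
    ring
  have hXu : ∀ (a : GL (Fin m ⊕ Fin m) k) (y : Matrix (Fin m) (Fin m) k),
      X (a * upperUnip y) = ψ (trace a.val) *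
        (ψ (trace (y * a.val.toBlocks₂₁)) * Λ (π (upperUnip (-y)) (π a⁻¹ v))) := by
    intro a y
    simp only [hX]
    rw [htr, AddChar.map_add_eq_mul, _root_.mul_inv_rev, upperUnip_inv, map_mul, Module.End.mul_apply,
      mul_assoc]
  have hsing : ∑ a with ¬ P a, X a = 0 := by
    have h1 : ∀ y : Matrix (Fin m) (Fin m) k,
        ∑ a with ¬ P a, X (a * upperUnip y) = ∑ a with ¬ P a, X a := by
      intro y
      refine Finset.sum_equiv (Equiv.mulRight (upperUnip y)) (fun a => ?_) fun a _ => rfl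
      simp [P, hblk, -Units.val_mul]
    have h2 : ∑ y : Matrix (Fin m) (Fin m) k, ∑ a with ¬ P a, X (a * upperUnip y) = 0 := by
      rw [Finset.sum_comm]
      refine Finset.sum_eq_zero fun a ha => ?_
      simp_rw [hXu]
      rw [← Finset.mul_sum, sum_upperUnip_eq_zero hm hcusp Λ hinv ψ (by simpa [P] using ha),
        mul_zero]
    simp_rw [h1] at h2
    simpa [card_matrix, hq] using h2
  rw [← Finset.sum_filter_add_sum_filter_not Finset.univ P, hsing, add_zero, Finset.sum_filter,
    ← sum_isUnit_toBlocks₂₁ _ fun a ha => if_neg ha]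
  have hterm : ∀ (x y : Matrix (Fin m) (Fin m) k) (z s : GL (Fin m) k),
      (if P (upperUnip x * wAntidiag * blockDiagGL z s * upperUnip y) then
        X (upperUnip x * wAntidiag * blockDiagGL z s * upperUnip y) else 0) =
      ψ (trace (x * z.val)) * (ψ (trace (z.val * y * (s⁻¹ : GL (Fin m) k).val * s.val)) *
        Λ (π (upperUnip (-(z.val * y * (s⁻¹ : GL (Fin m) k).val)))
          (π wAntidiag (π (upperUnip (-x)) v)))) := by
    intro x y z s
    have hv : (upperUnip x * wAntidiag * blockDiagGL z s : GL (Fin m ⊕ Fin m) k).val =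
        Matrix.fromBlocks (x * z.val) s.val z.val 0 := by
      simp [Matrix.fromBlocks_multiply]
    rw [if_pos, hXu, hv]
    · rw [_root_.mul_inv_rev, _root_.mul_inv_rev, map_mul, map_mul,
        Module.End.mul_apply, Module.End.mul_apply, upperUnip_inv, wAntidiag_inv, ← Module.End.mul_apply (π (upperUnip (-y))), ← map_mul,
        upperUnip_mul_blockDiagGL_inv, map_mul, Module.End.mul_apply, hinvd]
      simp [trace_fromBlocks_eq_add, mul_assoc, trace_mul_comm y]
    · change IsUnit (toBlocks₂₁ (upperUnip x * wAntidiag * blockDiagGL z s * upperUnip y).val)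
      rw [hblk, hv]
      simp
  refine (Finset.sum_congr rfl fun p _ => hterm p.1.1 p.2.2 p.1.2 p.2.1).trans ?_
  simp_rw [Fintype.sum_prod_type, ← Finset.mul_sum]
  have hsub : ∀ (z : GL (Fin m) k) (u : V), ∑ s : GL (Fin m) k, ∑ y : Matrix (Fin m) (Fin m) k,
      ψ (trace (z.val * y * (s⁻¹ : GL (Fin m) k).val * s.val)) *
        Λ (π (upperUnip (-(z.val * y * (s⁻¹ : GL (Fin m) k).val))) u) =
      (Fintype.card k : R) ^ (m ^ 2) * Λ u := by
    intro z u
    rw [← sum_GL_sum_upperUnip hm hcusp Λ hinv hψ u]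
    refine Finset.sum_congr rfl fun s _ => ?_
    exact Fintype.sum_equiv ((Units.mulLeft z).trans (Units.mulRight s⁻¹)) _
      (fun y => ψ (trace (y * s.val)) * Λ (π (upperUnip (-y)) u)) fun y => rfl
  simp_rw [hsub, hχ]
  rw [Finset.sum_comm]
  have hfin : ∀ (z : GL (Fin m) k) (x : Matrix (Fin m) (Fin m) k),
      ψ (trace (x * z.val)) *
        ((Fintype.card k : R) ^ (m ^ 2) * (χ * Λ (π (upperUnip (-x)) v))) =
      (Fintype.card k : R) ^ (m ^ 2) * χ *
        (ψ (trace (x * z.val)) * Λ (π (upperUnip (-x)) v)) := by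
    intro z x
    ring
  simp_rw [hfin, ← Finset.mul_sum]
  rw [sum_GL_sum_upperUnip hm hcusp Λ hinv hψ v, two_mul, pow_add]
  ring

/-- The operator-valued Gauss sum `∑ₐ ψ(tr(g a)) π(a⁻¹)`. -/
def gaussOp {ι : Type*} [Fintype ι] [DecidableEq ι] (π : Representation R (GL ι k) V)
    (ψ : AddChar k R) (g : Matrix ι ι k) : V →ₗ[R] V :=
  ∑ a : GL ι k, ψ (trace (g * a.val)) • π a⁻¹

theorem gaussOp_mul {ι : Type*} [Fintype ι] [DecidableEq ι] (π : Representation R (GL ι k) V)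
    (ψ : AddChar k R) (g : Matrix ι ι k) (u : GL ι k) :
    gaussOp π ψ (g * u.val) = gaussOp π ψ g ∘ₗ π u := by
  ext v
  simp only [gaussOp, LinearMap.comp_apply, LinearMap.sum_apply, LinearMap.smul_apply]
  refine Fintype.sum_equiv (Equiv.mulLeft u) _ _ fun a => ?_
  simp [mul_assoc, ← Module.End.mul_apply, ← map_mul]

theorem gaussOp_mul' {ι : Type*} [Fintype ι] [DecidableEq ι] (π : Representation R (GL ι k) V)
    (ψ : AddChar k R) (g : Matrix ι ι k) (u : GL ι k) :
    gaussOp π ψ (u.val * g) = π u ∘ₗ gaussOp π ψ g := by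
  ext v
  simp only [gaussOp, LinearMap.comp_apply, LinearMap.sum_apply, LinearMap.smul_apply, map_sum,
    map_smul]
  refine Fintype.sum_equiv (Equiv.mulRight u) _ _ fun a => ?_
  simp only [Equiv.coe_mulRight, Units.val_mul]
  rw [mul_assoc, trace_mul_comm, mul_assoc, ← Module.End.mul_apply, ← map_mul,
    _root_.mul_inv_rev, mul_inv_cancel_left]

theorem gaussOp_eq_zero {ι : Type*} [Fintype ι] [DecidableEq ι] [Nontrivial ι]
    {π : Representation R (GL ι k) V} (hπ : IsCuspidal π)
    (ψ : AddChar k R) {g : Matrix ι ι k} (hg : ¬ IsUnit g) :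
    gaussOp π ψ g = 0 := by
  have hg0 : g.det = 0 := by
    by_contra h
    exact hg ((Matrix.isUnit_iff_isUnit_det g).mpr (isUnit_iff_ne_zero.mpr h))
  obtain ⟨κ, hκ, hgκ⟩ := Matrix.exists_mulVec_eq_zero_iff.mpr hg0
  refine hπ.eq_zero_of_invariant hκ _ fun u θ _ hu v => ?_
  rw [← LinearMap.comp_apply, ← gaussOp_mul, hu, mul_add, Matrix.mul_vecMulVec, hgκ]
  simp

/-- **Gamma factor of a linearly distinguished cuspidal representation equals the sign
of the period.**  For `q` odd, `π` absolutely irreducible cuspidal on `GL_{2m}(𝒌)`,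
`Λ ≠ 0` invariant under `H = GL_m(𝒌) × GL_m(𝒌)` with `Λ∘π(w) = χ·Λ` for the Weyl
element `w`, and `ψ` nontrivial:  `Z(F_ψΦ, (f_{v,v^∨})^∨) = χ · Z(Φ, f_{v,v^∨})`, the
Fourier transform being normalized by `q^{-2m²}`. -/
theorem linear_distinguished_gamma (hm : 1 ≤ m)
    (hq : Odd (Fintype.card k)) (hchar : ringChar R ≠ ringChar k)
    (π : Representation R (GL (Fin m ⊕ Fin m) k) V)
    (hV : ∃ v : V, v ≠ 0)
    (hirr : ∀ W : Submodule R V, (∀ (g : GL (Fin m ⊕ Fin m) k), ∀ v ∈ W, π g v ∈ W) →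
      W = ⊥ ∨ W = ⊤)
    (hschur : ∀ φ : V →ₗ[R] V, (∀ g : GL (Fin m ⊕ Fin m) k, φ ∘ₗ π g = π g ∘ₗ φ) →
      ∃ c : R, φ = c • LinearMap.id)
    (hcusp : IsCuspidal π)
    (Λ : Module.Dual R V) (hΛ : Λ ≠ 0)
    (hinv : ∀ (g₁ g₂ : GL (Fin m) k) (v : V), Λ (π (blockDiagGL g₁ g₂) v) = Λ v)
    (χ : R) (hχ : ∀ v : V, Λ (π wAntidiag v) = χ * Λ v)
    (ψ : AddChar k R) (hψ : ∃ x, ψ x ≠ 1)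
    (Φ : Matrix (Fin m ⊕ Fin m) (Fin m ⊕ Fin m) k → R) (v : V)
    (v' : Module.Dual R V) :
    Z (fourier (Ring.inverse ((Fintype.card k : R) ^ (2 * m ^ 2))) ψ Φ)
        (inve (mc π v v'))
      = χ * Z Φ (mc π v v') := by
  have : Nontrivial (Fin m ⊕ Fin m) :=
    ⟨Sum.inl ⟨0, hm⟩, Sum.inr ⟨0, hm⟩, Sum.inl_ne_inr⟩
  have hcard : (Fintype.card k : R) ≠ 0 := card_cast_ne_zero hchar
  obtain ⟨c, hc⟩ := hschur (gaussOp π ψ 1) fun g => by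
    rw [← gaussOp_mul, ← gaussOp_mul', one_mul, mul_one]
  obtain ⟨v₀, hv₀⟩ : ∃ v₀, Λ v₀ ≠ 0 := by
    by_contra! h
    exact hΛ (LinearMap.ext h)
  have hc' : c = (Fintype.card k : R) ^ (2 * m ^ 2) * χ := by
    refine mul_right_cancel₀ hv₀ ?_
    rw [← period_gauss_sum hm hcard hcusp Λ hinv hχ hψ v₀]
    have h := congrArg (fun T : V →ₗ[R] V => Λ (T v₀)) hc
    simpa [gaussOp, LinearMap.sum_apply] using h.symm
  have hT : ∀ g : GL (Fin m ⊕ Fin m) k, gaussOp π ψ g.val = c • π g := by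
    intro g
    rw [← one_mul g.val, gaussOp_mul, hc]
    rfl
  have hsum : ∑ a : GL (Fin m ⊕ Fin m) k,
      (∑ g : Matrix (Fin m ⊕ Fin m) (Fin m ⊕ Fin m) k, Φ g * ψ (trace (g * a.val))) *
        v' (π a⁻¹ v) = c * Z Φ (mc π v v') := by
    calc _ = ∑ g, Φ g * v' (gaussOp π ψ g v) := by
          simp_rw [Finset.sum_mul]
          rw [Finset.sum_comm]
          refine Finset.sum_congr rfl fun g _ => ?_
          simp [gaussOp, LinearMap.sum_apply, Finset.mul_sum, mul_assoc]
      _ = ∑ g : GL (Fin m ⊕ Fin m) k, Φ g.val * v' (gaussOp π ψ g.val v) :=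
          (sum_GL_eq_sum (fun g => Φ g * v' (gaussOp π ψ g v)) fun g hg => by
            simp [gaussOp_eq_zero hcusp ψ hg]).symm
      _ = c * Z Φ (mc π v v') := by
          rw [Z, Finset.mul_sum]
          refine Finset.sum_congr rfl fun g _ => ?_
          rw [hT, LinearMap.smul_apply, map_smul, smul_eq_mul, mc]
          ring
  simp only [Z, fourier, inve, mc, mul_assoc] at hsum ⊢
  rw [← Finset.mul_sum, hsum, hc', Ring.inverse_eq_inv']
  field_simp

end Stmt14
end
end
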